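/- arXiv:2107.05690 — 4 statements merged into one kernel-verified Lean document; each statement's English description precedes it below -/
import Mathlib

section
/- For every ε > 0 and every tollbooth instance on a spider graph, there exists an item pricing p such that for every arrival order σ and every tie-breaking choice t, Wel(p,σ,t) ≥ (2/7 − ε)·OPT. (When the seller has no tie-breaking power, the competitive ratio of item pricing on spiders is at most 7/2 + ε' for every ε' > 0.) -/
open scoped Classical NNReal ENNReal

noncomputable section

namespace Tollbooth

variable {V : Type*} [Fintype V] [DecidableEq V]

/-- Total price (in `ℝ≥0∞`) of a set of edges under an item pricing `p`. -/
def price (p : Sym2 V → ℝ≥0∞) (s : Finset (Sym2 V)) : ℝ≥0∞ := ∑ e ∈ s, p e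

/-- One step of the selling process: the state consists of the set of available edges together
with the set of buyers that have purchased so far; buyer `j` purchases exactly when all the
edges of her demand path are available and either the price is strictly below her value, or the
price equals her value and her tie-breaking bit `t j` is `true`. -/
def step {n : ℕ} (p : Sym2 V → ℝ≥0∞) (Q : Fin n → Finset (Sym2 V)) (v : Fin n → ℝ≥0)
    (t : Fin n → Bool) (st : Finset (Sym2 V) × Finset (Fin n)) (j : Fin n) :
    Finset (Sym2 V) × Finset (Fin n) :=
  if Q j ⊆ st.1 ∧
      (price p (Q j) < (v j : ℝ≥0∞) ∨ (price p (Q j) = (v j : ℝ≥0∞) ∧ t j = true)) then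
    (st.1 \ Q j, insert j st.2)
  else st

/-- The set of buyers who purchase, when buyers arrive in the order `σ 0, σ 1, …`,
starting from all edges of `G` being available. -/
def purchased {n : ℕ} (G : SimpleGraph V) (p : Sym2 V → ℝ≥0∞) (Q : Fin n → Finset (Sym2 V))
    (v : Fin n → ℝ≥0) (σ : Equiv.Perm (Fin n)) (t : Fin n → Bool) : Finset (Fin n) :=
  ((List.ofFn fun i => σ i).foldl (step p Q v t) (G.edgeFinset, ∅)).2

/-- The welfare obtained by the item pricing `p` under arrival order `σ` and
tie-breaking choice `t`. -/
def Wel {n : ℕ} (G : SimpleGraph V) (p : Sym2 V → ℝ≥0∞) (Q : Fin n → Finset (Sym2 V))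
    (v : Fin n → ℝ≥0) (σ : Equiv.Perm (Fin n)) (t : Fin n → Bool) : ℝ≥0 :=
  ∑ j ∈ purchased G p Q v σ t, v j

/-- The hindsight optimal welfare: the maximum total value of a set of buyers whose demand
paths are pairwise edge-disjoint. -/
def OPT {n : ℕ} (Q : Fin n → Finset (Sym2 V)) (v : Fin n → ℝ≥0) : ℝ≥0 :=
  (Finset.univ.powerset.filter fun S : Finset (Fin n) =>
      (S : Set (Fin n)).Pairwise fun j k => Disjoint (Q j) (Q k)).sup
    fun S => ∑ j ∈ S, v j

/-- `s` is the (nonempty) edge set of a path of `G`. -/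
def IsPathEdges (G : SimpleGraph V) (s : Finset (Sym2 V)) : Prop :=
  ∃ (a b : V) (W : G.Walk a b), W.IsPath ∧ W.edges ≠ [] ∧ s = W.edges.toFinset

/-- A tollbooth instance on `G`: at least one buyer, every buyer has positive value and
demands (the edge set of) a path of `G`. -/
def Instance {n : ℕ} (G : SimpleGraph V) (Q : Fin n → Finset (Sym2 V)) (v : Fin n → ℝ≥0) :
    Prop :=
  1 ≤ n ∧ ∀ j, 0 < v j ∧ IsPathEdges G (Q j)

/-- A star: a tree all of whose edges share a common vertex. -/
def IsStar (G : SimpleGraph V) : Prop := G.IsTree ∧ ∃ c : V, ∀ e ∈ G.edgeSet, c ∈ e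

/-- A spider: a tree with at most one vertex of degree at least `3`. -/
def IsSpider (G : SimpleGraph V) : Prop :=
  G.IsTree ∧ {w : V | 3 ≤ G.degree w}.Subsingleton

/-- A cycle graph: a connected graph in which every vertex has degree exactly `2`. -/
def IsCycleGraph (G : SimpleGraph V) : Prop := G.Connected ∧ ∀ w : V, G.degree w = 2

/-- A path graph: a tree in which every vertex has degree at most `2`. -/
def IsPathGraph (G : SimpleGraph V) : Prop := G.IsTree ∧ ∀ w : V, G.degree w ≤ 2

end Tollbooth

namespace Tollbooth

/-- Maximum weight of a path of arcs `A` ending in a given vertex of the line, an arc `x → y`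
having weight `W x y`. -/
def longest (A : ℕ → ℕ → Prop) (W : ℕ → ℕ → ℝ) (y : ℕ) : ℝ :=
  ⨆ x : {x : Fin y // A x y}, longest A W x.1 + W x.1 y
termination_by y
decreasing_by exact x.1.2

theorem le_longest {A : ℕ → ℕ → Prop} (W : ℕ → ℕ → ℝ) {x y : ℕ} (hxy : x < y) (h : A x y) :
    longest A W x + W x y ≤ longest A W y := by
  rw [longest.eq_1 A W y]
  exact le_ciSup (f := fun x : {x : Fin y // A x y} => longest A W x.1 + W x.1 y)
    (Set.finite_range _).bddAbove ⟨⟨x, hxy⟩, h⟩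

theorem exists_longest_eq {A : ℕ → ℕ → Prop} (W : ℕ → ℕ → ℝ) {y : ℕ}
    (h : ∃ x < y, A x y) : ∃ x < y, A x y ∧ longest A W y = longest A W x + W x y := by
  obtain ⟨x, hxy, hx⟩ := h
  have : Nonempty {x : Fin y // A x y} := ⟨⟨⟨x, hxy⟩, hx⟩⟩
  obtain ⟨z, hz⟩ := exists_eq_ciSup_of_finite
    (f := fun x : {x : Fin y // A x y} => longest A W x.1 + W x.1 y)
  refine ⟨z.1, z.1.2, z.2, ?_⟩
  rw [longest.eq_1 A W y, ← hz]

theorem longest_zero (A : ℕ → ℕ → Prop) (W : ℕ → ℕ → ℝ) : longest A W 0 = 0 := by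
  rw [longest.eq_1]
  have : IsEmpty {x : Fin 0 // A x 0} := ⟨fun x => x.1.elim0⟩
  exact Real.iSup_of_isEmpty _

open Relation in
/-- Every `R`-path from `a` to `b` visits no vertices besides `a`, `b` and an intermediate vertex
`m`, and it is possible to walk from `a` to `b` through `m`. -/
def GoodVia (R : ℕ → ℕ → Prop) (a m b : ℕ) : Prop :=
  (a = m ∨ R a m) ∧ R m b ∧
    ∀ z, ReflTransGen R a z → ReflTransGen R z b → z = a ∨ z = m ∨ z = b

/-- The segment `[a, b)` has an essentially unique tiling by `R`-steps. -/
def Good (R : ℕ → ℕ → Prop) (a b : ℕ) : Prop := ∃ m, GoodVia R a m b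

/-- A family of good segments, separated by nonempty gaps and ending strictly before `b`. -/
structure GoodFamily (R : ℕ → ℕ → Prop) (L : Finset (ℕ × ℕ)) (b : ℕ) : Prop where
  good : ∀ s ∈ L, Good R s.1 s.2
  lt : ∀ s ∈ L, s.1 < s.2
  lt_bound : ∀ s ∈ L, s.2 < b
  separated : ∀ s ∈ L, ∀ t ∈ L, s ≠ t → s.2 < t.1 ∨ t.2 < s.1

/-- The increment of `F` over all segments of a family. -/
def mass (F : ℕ → ℝ) (L : Finset (ℕ × ℕ)) : ℝ := ∑ s ∈ L, (F s.2 - F s.1)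

theorem GoodFamily.nil (R : ℕ → ℕ → Prop) (b : ℕ) : GoodFamily R ∅ b := by
  constructor <;> simp

theorem GoodFamily.cons {R : ℕ → ℕ → Prop} {L : Finset (ℕ × ℕ)} {a b c : ℕ}
    (h : GoodFamily R L a) (hab : a < b) (hbc : b < c) (hg : Good R a b) :
    GoodFamily R (insert (a, b) L) c := by
  obtain ⟨h1, h2, h3, h4⟩ := h
  constructor
  · simpa using ⟨hg, fun x y => h1 (x, y)⟩
  · simpa using ⟨hab, fun x y => h2 (x, y)⟩
  · intro s hs
    rcases Finset.mem_insert.1 hs with rfl | hs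
    · exact hbc
    · have := h3 s hs; omega
  · intro s hs t ht hst
    rcases Finset.mem_insert.1 hs with rfl | hs <;> rcases Finset.mem_insert.1 ht with rfl | ht
    · exact absurd rfl hst
    · exact Or.inr (h3 t ht)
    · exact Or.inl (h3 s hs)
    · exact h4 s hs t ht hst

theorem GoodFamily.mass_cons {R : ℕ → ℕ → Prop} {L : Finset (ℕ × ℕ)} {a b : ℕ}
    (F : ℕ → ℝ) (h : GoodFamily R L a) (hab : a < b) :
    mass F (insert (a, b) L) = F b - F a + mass F L := by
  unfold mass
  rw [Finset.sum_insert]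
  intro hm
  have := h.lt_bound _ hm
  simp only at this
  omega

section Tight

open Relation

variable {R : ℕ → ℕ → Prop} {N : ℕ} {U : ℕ → ℝ}

theorem le_of_reflTransGen (hR : ∀ x y, R x y → x < y) {x y : ℕ} (h : ReflTransGen R x y) :
    x ≤ y := by
  induction h with
  | refl => exact le_rfl
  | tail _ h ih => exact ih.trans (hR _ _ h).le

theorem direct_or_longer (hR : ∀ x y, R x y → x < y)
    (hU : ∀ x y, R x y → U x + (2 * N + 1 - y) ≤ U y) {x y : ℕ} (hy : y ≤ N) (hxy : x ≠ y)
    (h : ReflTransGen R x y) :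
    U x + (2 * N + 1 - y) ≤ U y ∧ (R x y ∨ U x + (N + 1) + (2 * N + 1 - y) ≤ U y) := by
  induction h with
  | refl => exact absurd rfl hxy
  | @tail z y h1 h2 ih =>
    have hzy := hR _ _ h2
    have hzN : (z : ℝ) ≤ N := by exact_mod_cast (hzy.le.trans hy)
    have := hU _ _ h2
    by_cases hxz : x = z
    · subst hxz; exact ⟨this, Or.inl h2⟩
    · have := (ih (hzy.le.trans hy) hxz).1
      exact ⟨by linarith, Or.inr (by linarith)⟩

theorem good_of_tight (hR : ∀ x y, R x y → x < y)
    (hU : ∀ x y, R x y → U x + (2 * N + 1 - y) ≤ U y) {x y : ℕ} (hy : y ≤ N) (h : R x y)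
    (hT : U y < U x + (N + 1) + (2 * N + 1 - y)) : Good R x y := by
  refine ⟨x, Or.inl rfl, h, fun z h1 h2 => ?_⟩
  by_contra! hz
  have hzy := le_of_reflTransGen hR h2
  have hzN : (z : ℝ) ≤ N := by exact_mod_cast hzy.trans hy
  have := (direct_or_longer hR hU (hzy.trans hy) hz.1.symm h1).1
  have := (direct_or_longer hR hU hy hz.2.2 h2).1
  linarith

theorem good_of_tight_tight (hR : ∀ x y, R x y → x < y)
    (hU : ∀ x y, R x y → U x + (2 * N + 1 - y) ≤ U y) {w x y : ℕ} (hy : y ≤ N)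
    (h1 : R w x) (h2 : R x y) (hT1 : U x = U w + (2 * N + 1 - x))
    (hT2 : U y = U x + (2 * N + 1 - y)) (h : ∀ z, R w z → R z y → z = x) : Good R w y := by
  refine ⟨x, Or.inr h1, h2, fun z h3 h4 => ?_⟩
  by_contra! hz
  have hzy := le_of_reflTransGen hR h4
  have hzN : (z : ℝ) ≤ N := by exact_mod_cast hzy.trans hy
  have hx0 : (0 : ℝ) ≤ x := Nat.cast_nonneg x
  obtain ⟨h5, h6⟩ := direct_or_longer hR hU (hzy.trans hy) hz.1.symm h3
  obtain ⟨h7, h8⟩ := direct_or_longer hR hU hy hz.2.2 h4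
  rcases h6 with h6 | h6
  · rcases h8 with h8 | h8
    · exact hz.2.1 (h z h6 h8)
    · linarith
  · linarith

/-- Three families of good segments which together cover every unit below `x` twice, apart from
the still unfinished segments `[w, x)` and `[g, x)`. -/
def Progress (R : ℕ → ℕ → Prop) (F : ℕ → ℝ) (w x : ℕ) : Prop :=
  ∃ (g : ℕ) (A B C : Finset (ℕ × ℕ)), GoodFamily R A x ∧ GoodFamily R B w ∧ GoodFamily R C g ∧
    g < x ∧ Good R g x ∧ mass F A + mass F B + mass F C = F w + F g

theorem progress (hR : ∀ x y, R x y → x < y)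
    (hU : ∀ x y, R x y → U x + (2 * N + 1 - y) ≤ U y)
    (hpred : ∀ y, 0 < y → ∃ x, R x y ∧ U y = U x + (2 * N + 1 - y)) {F : ℕ → ℝ} (hF : F 0 = 0)
    (y : ℕ) : ∀ x, y ≤ N → R x y → U y = U x + (2 * N + 1 - y) → Progress R F x y := by
  induction y using Nat.strong_induction_on with
  | _ y ih =>
  intro x hy hxy hT
  have hlt := hR _ _ hxy
  have hN0 : (0 : ℝ) ≤ N := Nat.cast_nonneg N
  rcases Nat.eq_zero_or_pos x with rfl | hx
  · refine ⟨0, ∅, ∅, ∅, .nil _ _, .nil _ _, .nil _ _, hlt, ?_, by simp [mass, hF]⟩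
    exact good_of_tight hR hU hy hxy (by linarith)
  · obtain ⟨w, hwx, hTw⟩ := hpred x hx
    have hlw := hR _ _ hwx
    obtain ⟨g, A, B, C, hA, hB, hC, hg, hgood, hm⟩ := ih x hlt w (hlt.le.trans hy) hwx hTw
    by_cases hz : ∀ z, R w z → R z y → z = x
    · refine ⟨w, insert (g, x) C, A, B, hC.cons hg hlt hgood, hA, hB, hlw.trans hlt,
        good_of_tight_tight hR hU hy hwx hxy hTw hT hz, ?_⟩
      rw [hC.mass_cons F hg]; linarith
    · push Not at hz
      obtain ⟨z, h1, h2, hne⟩ := hz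
      have l1 := hR _ _ h1
      have l2 := hR _ _ h2
      have u1 := hU _ _ h1
      have u2 := hU _ _ h2
      have hzN : (z : ℝ) ≤ N := by exact_mod_cast l2.le.trans hy
      have hx0 : (0 : ℝ) ≤ x := Nat.cast_nonneg x
      have hxz : x < z := by
        refine lt_of_le_of_ne ?_ hne.symm
        have : (x : ℝ) ≤ z := by linarith
        exact_mod_cast this
      refine ⟨z, insert (w, z) B, A, insert (g, x) C, ?_, hA, ?_, l2, ?_, ?_⟩
      · exact hB.cons l1 l2 (good_of_tight hR hU (l2.le.trans hy) h1 (by linarith))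
      · exact hC.cons hg hxz hgood
      · exact good_of_tight hR hU hy h2 (by linarith)
      · rw [hC.mass_cons F hg, hB.mass_cons F l1]; linarith

theorem exists_goodFamily (hR : ∀ x y, R x y → x < y) (hpred : ∀ y, 0 < y → ∃ x, R x y)
    {F : ℕ → ℝ} (hF : F 0 = 0) (N : ℕ) :
    ∃ L, GoodFamily R L (N + 1) ∧ 2 / 3 * F N ≤ mass F L := by
  rcases Nat.eq_zero_or_pos N with rfl | hN
  · exact ⟨∅, .nil _ _, by simp [mass, hF]⟩
  set U := longest R fun _ y => 2 * N + 1 - y with hUdef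
  have hU : ∀ x y, R x y → U x + (2 * N + 1 - y) ≤ U y := fun x y h =>
    le_longest (fun _ y => 2 * (N : ℝ) + 1 - y) (hR x y h) h
  have hp : ∀ y, 0 < y → ∃ x, R x y ∧ U y = U x + (2 * N + 1 - y) := by
    intro y hy
    obtain ⟨x, hx⟩ := hpred y hy
    obtain ⟨z, _, h⟩ := exists_longest_eq (fun _ y => 2 * (N : ℝ) + 1 - y) ⟨x, hR _ _ hx, hx⟩
    exact ⟨z, h⟩
  obtain ⟨x, hx, hT⟩ := hp N hN
  have hxN := hR _ _ hx
  have hN0 : (0 : ℝ) ≤ N := Nat.cast_nonneg N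
  obtain ⟨g, A, B, C, hA, hB, hC, hg, hgood, hm⟩ := progress hR hU hp hF N x le_rfl hx hT
  have m1 := hB.mass_cons F hxN
  have m2 := hC.mass_cons F hg
  by_cases c1 : 2 / 3 * F N ≤ mass F A
  · exact ⟨A, ⟨hA.1, hA.2, fun s hs => (hA.3 s hs).trans (Nat.lt_succ_self N), hA.4⟩, c1⟩
  by_cases c2 : 2 / 3 * F N ≤ mass F (insert (x, N) B)
  · exact ⟨_, hB.cons hxN (Nat.lt_succ_self N)
      (good_of_tight hR hU le_rfl hx (by linarith)), c2⟩
  · exact ⟨_, hC.cons hg (Nat.lt_succ_self N) hgood, by linarith⟩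

end Tight

section Pricing

open Relation

theorem sum_Ico_increment (f : ℕ → ℝ) {a b : ℕ} (hab : a ≤ b) :
    ∑ x ∈ Finset.Ico a b, (f (x + 1) - f x) = f b - f a := by
  induction b, hab using Nat.le_induction with
  | base => simp
  | succ b hab ih => rw [Finset.sum_Ico_succ_top hab, ih]; ring

theorem sum_Ico_ofReal_increment (f : ℕ → ℝ) {a b : ℕ} (hab : a ≤ b)
    (hf : ∀ x ∈ Finset.Ico a b, f x ≤ f (x + 1)) :
    ∑ x ∈ Finset.Ico a b, ENNReal.ofReal (f (x + 1) - f x) = ENNReal.ofReal (f b - f a) := by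
  rw [← ENNReal.ofReal_sum_of_nonneg fun x hx => sub_nonneg.2 (hf x hx), sum_Ico_increment f hab]

variable {R : ℕ → ℕ → Prop} {F : ℕ → ℝ} {N : ℕ}

/-- A direction of perturbation for the potential `F` on the segment `[a, b)`: it decreases along
the steps of the unique tiling and increases along all other steps. -/
def tilt (R : ℕ → ℕ → Prop) (F : ℕ → ℝ) (N a b z : ℕ) : ℝ :=
  if ReflTransGen R a z ∧ ReflTransGen R z b then -F z
  else if ReflTransGen R a z then 1 + z else z - F N - N - 2

/-- The perturbed potential. -/
def tilted (R : ℕ → ℕ → Prop) (F : ℕ → ℝ) (N : ℕ) (δ : ℝ) (a b z : ℕ) : ℝ :=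
  F z + δ * tilt R F N a b z

theorem tilt_lt_tilt (hR : ∀ x y, R x y → x < y) (hF : Monotone F) (hF0 : F 0 = 0) {a b z w : ℕ}
    (h : R z w) (hw : w ≤ N)
    (hX : ¬ ((ReflTransGen R a z ∧ ReflTransGen R z b) ∧
      (ReflTransGen R a w ∧ ReflTransGen R w b))) :
    tilt R F N a b z < tilt R F N a b w := by
  have hzw := hR _ _ h
  have h1 : (z : ℝ) < w := by exact_mod_cast hzw
  have h2 : (w : ℝ) ≤ N := by exact_mod_cast hw
  have h3 : (0 : ℝ) ≤ z := Nat.cast_nonneg z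
  have h4 : 0 ≤ F z := hF0 ▸ hF (Nat.zero_le z)
  have h5 : F z ≤ F N := hF (hzw.le.trans hw)
  have h6 : F w ≤ F N := hF hw
  have h7 : ReflTransGen R a z → ReflTransGen R a w := fun h' => h'.tail h
  have h8 : ReflTransGen R w b → ReflTransGen R z b := fun h' => ReflTransGen.head h h'
  unfold tilt
  by_cases ha : ReflTransGen R a z
  · have ha' := h7 ha
    by_cases hb : ReflTransGen R w b
    · exact absurd ⟨⟨ha, h8 hb⟩, ha', hb⟩ hX
    · rw [if_neg (fun hc => hb hc.2 : ¬ (ReflTransGen R a w ∧ _)), if_pos ha']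
      split_ifs <;> linarith
  · rw [if_neg (fun hc => ha hc.1), if_neg ha]
    split_ifs <;> linarith

theorem tilt_bounds (hF : Monotone F) (hF0 : F 0 = 0) (a b : ℕ) {z : ℕ} (hz : z ≤ N) :
    -F N - N - 2 ≤ tilt R F N a b z ∧ tilt R F N a b z ≤ 1 + N := by
  have h2 : (z : ℝ) ≤ N := by exact_mod_cast hz
  have h3 : (0 : ℝ) ≤ z := Nat.cast_nonneg z
  have h4 : 0 ≤ F z := hF0 ▸ hF (Nat.zero_le z)
  have h5 : F z ≤ F N := hF hz
  unfold tilt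
  split_ifs <;> constructor <;> linarith

theorem sub_lt_tilted_sub (hF : Monotone F) (hF0 : F 0 = 0) {δ c : ℝ} (hδ : 0 < δ)
    {a b z w : ℕ} (hz : z ≤ N) (hw : w ≤ N)
    (h : δ * (F N + 2 * N + 3) < F w - F z - c) :
    c < tilted R F N δ a b w - tilted R F N δ a b z := by
  have h1 := (tilt_bounds (R := R) hF hF0 a b hz).2
  have h2 := (tilt_bounds (R := R) hF hF0 a b hw).1
  have h3 : δ * (tilt R F N a b z - tilt R F N a b w) ≤ δ * (F N + 2 * N + 3) :=
    mul_le_mul_of_nonneg_left (by linarith) hδ.le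
  unfold tilted
  linarith

end Pricing

/-- Intervals `[l j, r j)` with values `v j` for `j ∈ J`, together with a potential `F` measuring
the best packing to the left of a point. -/
structure LinePotential {ι : Type*} (J : Finset ι) (l r : ι → ℕ) (v : ι → ℝ≥0) (F : ℕ → ℝ) :
    Prop where
  zero : F 0 = 0
  mono : Monotone F
  value_le : ∀ j ∈ J, v j ≤ F (r j) - F (l j)
  attained : ∀ y, F (y + 1) = F y ∨ ∃ j ∈ J, r j = y + 1 ∧ F (r j) = F (l j) + v j

section Line

open Relation

variable {ι : Type*} {J : Finset ι} {l r : ι → ℕ} {v : ι → ℝ≥0} {F : ℕ → ℝ}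

theorem exists_linePotential (hlr : ∀ j ∈ J, l j < r j) :
    ∃ F, LinePotential J l r v F := by
  set W : ℕ → ℕ → ℝ := fun x y => ((J.filter fun j => l j = x ∧ r j = y).sup v : ℝ≥0) with hW
  set A : ℕ → ℕ → Prop := fun x y => y = x + 1 ∨ ∃ j ∈ J, l j = x ∧ r j = y with hA
  have hW0 : ∀ x y, 0 ≤ W x y := fun x y => NNReal.coe_nonneg _
  refine ⟨longest A W, longest_zero A W, monotone_nat_of_le_succ fun x => ?_, fun j hj => ?_,
    fun y => ?_⟩
  · have := le_longest (A := A) W (Nat.lt_succ_self x) (Or.inl rfl)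
    have := hW0 x (x + 1)
    linarith
  · have h1 := le_longest (A := A) W (hlr j hj) (Or.inr ⟨j, hj, rfl, rfl⟩)
    have h2 : (v j : ℝ) ≤ W (l j) (r j) :=
      NNReal.coe_le_coe.2 (Finset.le_sup (f := v) (Finset.mem_filter.2 ⟨hj, rfl, rfl⟩))
    linarith
  · obtain ⟨x, hx, hxA, h⟩ := exists_longest_eq (A := A) W
      ⟨y, Nat.lt_succ_self y, Or.inl rfl⟩
    rcases (J.filter fun j => l j = x ∧ r j = y + 1).eq_empty_or_nonempty with he | hne
    · left
      have hxy : x = y := by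
        rcases hxA with h' | ⟨j, hj, h'⟩
        · omega
        · exact absurd (Finset.mem_filter.2 ⟨hj, h'⟩) (he ▸ Finset.notMem_empty j)
      subst hxy
      rw [h]
      simp [hW, he]
    · right
      obtain ⟨j, hj, hs⟩ := Finset.exists_mem_eq_sup _ hne v
      obtain ⟨hjJ, hl, hr⟩ := Finset.mem_filter.1 hj
      refine ⟨j, hjJ, hr, ?_⟩
      rw [hr, h, hl]
      simp only [hW, hs]

/-- Tight steps: units on which `F` does not increase, and intervals in `J` whose value equals the
increment of `F`. -/
def TightStep (J : Finset ι) (l r : ι → ℕ) (v : ι → ℝ≥0) (F : ℕ → ℝ) (x y : ℕ) : Prop :=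
  (y = x + 1 ∧ F y = F x) ∨ ∃ j ∈ J, l j = x ∧ r j = y ∧ F y = F x + v j

theorem tightStep_lt (hlr : ∀ j ∈ J, l j < r j) (x y : ℕ) (h : TightStep J l r v F x y) :
    x < y := by
  rcases h with ⟨h, _⟩ | ⟨j, hj, rfl, rfl, _⟩
  · omega
  · exact hlr j hj

theorem LinePotential.exists_tightStep (hP : LinePotential J l r v F) {y : ℕ} (hy : 0 < y) :
    ∃ x, TightStep J l r v F x y := by
  obtain ⟨y, rfl⟩ := Nat.exists_eq_succ_of_ne_zero hy.ne'
  rcases hP.attained y with h | ⟨j, hj, hr, h⟩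
  · exact ⟨y, Or.inl ⟨rfl, h⟩⟩
  · exact ⟨l j, Or.inr ⟨j, hj, rfl, hr, by rw [← h, hr]⟩⟩

theorem exists_small {κ : Type*} (s : Finset κ) (f : κ → ℝ) (K : ℝ) :
    ∃ δ > 0, ∀ j ∈ s, 0 < f j → δ * K < f j := by
  have h : ∀ᶠ δ : ℝ in nhdsWithin 0 (Set.Ioi 0), ∀ j ∈ s, 0 < f j → δ * K < f j := by
    rw [Filter.eventually_all_finset]
    intro j _
    rw [Filter.eventually_imp_distrib_left]
    intro hf
    have hc : Filter.Tendsto (fun δ : ℝ => δ * K) (nhdsWithin 0 (Set.Ioi 0)) (nhds (0 * K)) :=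
      ((continuous_id.mul continuous_const).tendsto 0).mono_left nhdsWithin_le_nhds
    rw [zero_mul] at hc
    exact hc.eventually (gt_mem_nhds hf)
  obtain ⟨δ, h1, h2⟩ := (h.and self_mem_nhdsWithin).exists
  exact ⟨δ, h2, h1⟩

/-- The price of the unit `[x, x + 1)`: an increment of the tilted potential of the segment
containing it, or `⊤` outside of all segments. -/
def segmentPrice (R : ℕ → ℕ → Prop) (F : ℕ → ℝ) (N : ℕ) (δ : ℝ) (L : Finset (ℕ × ℕ)) (x : ℕ) :
    ℝ≥0∞ :=
  if h : ∃ s ∈ L, s.1 ≤ x ∧ x < s.2 then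
    ENNReal.ofReal (tilted R F N δ h.choose.1 h.choose.2 (x + 1) -
      tilted R F N δ h.choose.1 h.choose.2 x)
  else ⊤

theorem segmentPrice_of_mem {R : ℕ → ℕ → Prop} {N b : ℕ} {δ : ℝ} {L : Finset (ℕ × ℕ)}
    (hL : GoodFamily R L b) {s : ℕ × ℕ} (hs : s ∈ L) {x : ℕ} (h1 : s.1 ≤ x) (h2 : x < s.2) :
    segmentPrice R F N δ L x =
      ENNReal.ofReal (tilted R F N δ s.1 s.2 (x + 1) - tilted R F N δ s.1 s.2 x) := by
  have h : ∃ s ∈ L, s.1 ≤ x ∧ x < s.2 := ⟨s, hs, h1, h2⟩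
  have hc : h.choose = s := by
    by_contra hne
    have := h.choose_spec
    have := hL.separated _ h.choose_spec.1 _ hs hne
    omega
  rw [segmentPrice, dif_pos h, hc]

theorem exists_segment_of_sum_ne_top {R : ℕ → ℕ → Prop} {N b : ℕ} {δ : ℝ} {L : Finset (ℕ × ℕ)}
    (hL : GoodFamily R L b) {x y : ℕ} (hxy : x < y)
    (h : ∑ z ∈ Finset.Ico x y, segmentPrice R F N δ L z ≠ ⊤) :
    ∃ s ∈ L, s.1 ≤ x ∧ y ≤ s.2 := by
  have hm : ∀ z ∈ Finset.Ico x y, ∃ s ∈ L, s.1 ≤ z ∧ z < s.2 := by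
    intro z hz
    by_contra hn
    exact ENNReal.sum_ne_top.1 h z hz (dif_neg hn)
  obtain ⟨s, hs, h1, h2⟩ := hm x (Finset.left_mem_Ico.2 hxy)
  refine ⟨s, hs, h1, ?_⟩
  by_contra! hlt
  obtain ⟨t, ht, h3, h4⟩ := hm s.2 (Finset.mem_Ico.2 ⟨h2.le, hlt⟩)
  have hst : s ≠ t := by rintro rfl; omega
  have := hL.separated s hs t ht hst
  have := hL.lt t ht
  have := hL.lt s hs
  omega

theorem GoodVia.mem {R : ℕ → ℕ → Prop} {a m b : ℕ} (h : GoodVia R a m b) :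
    (ReflTransGen R a a ∧ ReflTransGen R a b) ∧ (ReflTransGen R a m ∧ ReflTransGen R m b) ∧
      (ReflTransGen R a b ∧ ReflTransGen R b b) := by
  obtain ⟨h1, h2, -⟩ := h
  have h3 : ReflTransGen R a m := by
    rcases h1 with rfl | h1
    · exact .refl
    · exact .single h1
  exact ⟨⟨.refl, h3.tail h2⟩, ⟨h3, .single h2⟩, h3.tail h2, .refl⟩

/-- Every unit of a good segment lies in a step of its unique tiling. -/
theorem Good.exists_step {R : ℕ → ℕ → Prop} (hR : ∀ x y, R x y → x < y) {a b x : ℕ}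
    (h : Good R a b) (hax : a ≤ x) (hxb : x < b) :
    ∃ y z, R y z ∧ y ≤ x ∧ x < z ∧ a ≤ y ∧ z ≤ b ∧
      (ReflTransGen R a y ∧ ReflTransGen R y b) ∧ (ReflTransGen R a z ∧ ReflTransGen R z b) ∧
      ∀ w, ReflTransGen R a w → ReflTransGen R w b → w ≤ y ∨ z ≤ w := by
  obtain ⟨m, h⟩ := h
  obtain ⟨ha, hm, hb⟩ := h.mem
  obtain ⟨h1, h2, h3⟩ := h
  have hmb := hR _ _ h2
  have ham := le_of_reflTransGen hR hm.1
  by_cases hxm : x < m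
  · have h1' : R a m := by
      rcases h1 with h1 | h1
      · omega
      · exact h1
    refine ⟨a, m, h1', hax, hxm, le_rfl, hmb.le, ha, hm, fun w hw hw' => ?_⟩
    rcases h3 w hw hw' with rfl | rfl | rfl <;> omega
  · refine ⟨m, b, h2, by omega, hxb, ham, le_rfl, hm, hb, fun w hw hw' => ?_⟩
    rcases h3 w hw hw' with rfl | rfl | rfl <;> omega

/-- On a line, some pricing without tie-breaking power guarantees two thirds of the optimum. -/
theorem LinePotential.exists_pricing (hP : LinePotential J l r v F) {N : ℕ}
    (hlr : ∀ j ∈ J, l j < r j) (hrN : ∀ j ∈ J, r j ≤ N) (hv : ∀ j ∈ J, 0 < v j) :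
    ∃ p : ℕ → ℝ≥0∞, ∀ D ⊆ J,
      (∀ j ∈ D, ∀ k ∈ D, j ≠ k →
        Disjoint (Finset.Ico (l j) (r j)) (Finset.Ico (l k) (r k))) →
      (∀ k ∈ D, ∑ x ∈ Finset.Ico (l k) (r k), p x ≤ v k) →
      (∀ j ∈ J, ∑ x ∈ Finset.Ico (l j) (r j), p x < v j →
        ∃ k ∈ D, ¬ Disjoint (Finset.Ico (l k) (r k)) (Finset.Ico (l j) (r j))) →
      2 / 3 * F N ≤ ∑ k ∈ D, (v k : ℝ) := by
  have hR := tightStep_lt (F := F) (v := v) hlr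
  set R := TightStep J l r v F with hRdef
  obtain ⟨L, hL, hLm⟩ := exists_goodFamily hR (fun y hy => hP.exists_tightStep hy) hP.zero N
  obtain ⟨δ, hδ, hsmall⟩ := exists_small ((Finset.range N).disjSum J)
    (Sum.elim (fun x => F (x + 1) - F x) fun j => F (r j) - F (l j) - v j) (F N + 2 * N + 3)
  have hsN : ∀ s ∈ L, s.2 ≤ N := fun s hs => Nat.lt_succ_iff.1 (hL.lt_bound s hs)
  have hinc : ∀ s ∈ L, ∀ x, s.1 ≤ x → x < s.2 →
      tilted R F N δ s.1 s.2 x ≤ tilted R F N δ s.1 s.2 (x + 1) := by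
    intro s hs x h1 h2
    have hxN : x + 1 ≤ N := (hsN s hs).trans' h2
    rcases (hP.mono (Nat.le_succ x)).lt_or_eq with hlt | heq
    · have h3 := hsmall (Sum.inl x) (Finset.inl_mem_disjSum.2 (Finset.mem_range.2 hxN))
        (sub_pos.2 hlt)
      have := sub_lt_tilted_sub (R := R) (c := 0) hP.mono hP.zero hδ (a := s.1) (b := s.2)
        (z := x) (w := x + 1)
        (by omega) hxN (by rw [sub_zero]; exact h3)
      linarith
    · have hs : R x (x + 1) := Or.inl ⟨rfl, heq.symm⟩
      by_cases hX : ((ReflTransGen R s.1 x ∧ ReflTransGen R x s.2) ∧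
          (ReflTransGen R s.1 (x + 1) ∧ ReflTransGen R (x + 1) s.2))
      · simp only [tilted, tilt, if_pos hX.1, if_pos hX.2]
        rw [Nat.succ_eq_add_one] at heq
        rw [heq]
      · have := mul_lt_mul_of_pos_left (tilt_lt_tilt hR hP.mono hP.zero hs hxN hX) hδ
        unfold tilted
        rw [Nat.succ_eq_add_one] at heq
        linarith
  refine ⟨segmentPrice R F N δ L, fun D hDJ hdisj hle hsold => ?_⟩
  have hsum : ∀ s ∈ L, ∀ x y, s.1 ≤ x → x ≤ y → y ≤ s.2 →
      ∑ z ∈ Finset.Ico x y, segmentPrice R F N δ L z =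
        ENNReal.ofReal (tilted R F N δ s.1 s.2 y - tilted R F N δ s.1 s.2 x) := by
    intro s hs x y h1 h2 h3
    rw [← sum_Ico_ofReal_increment _ h2]
    · refine Finset.sum_congr rfl fun z hz => ?_
      rw [Finset.mem_Ico] at hz
      exact segmentPrice_of_mem hL hs (by omega) (by omega)
    · intro z hz
      rw [Finset.mem_Ico] at hz
      exact hinc s hs z (by omega) (by omega)
  have hbuy : ∀ k ∈ D, (F (r k) - F (l k) = v k) ∧ ∃ s ∈ L, s.1 ≤ l k ∧ r k ≤ s.2 ∧
      (ReflTransGen R s.1 (l k) ∧ ReflTransGen R (l k) s.2) ∧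
      (ReflTransGen R s.1 (r k) ∧ ReflTransGen R (r k) s.2) := by
    intro k hk
    have hkJ := hDJ hk
    have hk1 := hle k hk
    obtain ⟨s, hs, h1, h2⟩ := exists_segment_of_sum_ne_top hL (hlr k hkJ)
      (ne_top_of_le_ne_top ENNReal.coe_ne_top hk1)
    rw [hsum s hs _ _ h1 (hlr k hkJ).le h2, ← ENNReal.ofReal_coe_nnreal,
      ENNReal.ofReal_le_ofReal_iff (NNReal.coe_nonneg _)] at hk1
    rcases (hP.value_le k hkJ).lt_or_eq with hlt | heq
    · exfalso
      have h3 := hsmall (Sum.inr k) (Finset.inr_mem_disjSum.2 hkJ) (sub_pos.2 hlt)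
      have := sub_lt_tilted_sub (R := R) (c := v k) hP.mono hP.zero hδ (a := s.1) (b := s.2)
        ((hlr k hkJ).le.trans (hrN k hkJ)) (hrN k hkJ) h3
      linarith
    · refine ⟨heq.symm, s, hs, h1, h2, ?_⟩
      by_contra hX
      have hstep : R (l k) (r k) := Or.inr ⟨k, hkJ, rfl, rfl, by linarith⟩
      have := mul_lt_mul_of_pos_left
        (tilt_lt_tilt hR hP.mono hP.zero hstep (hrN k hkJ) hX) hδ
      unfold tilted at hk1
      linarith
  have hcov : ∀ s ∈ L, ∀ x, s.1 ≤ x → x < s.2 → F (x + 1) - F x ≠ 0 →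
      ∃ k ∈ D, x ∈ Finset.Ico (l k) (r k) := by
    intro s hs x h1 h2 hx
    obtain ⟨y, z, hyz, hyx, hxz, hay, hzb, hy, hz, hyz'⟩ :=
      (hL.good s hs).exists_step hR h1 h2
    rcases hyz with ⟨rfl, hF⟩ | ⟨j, hj, rfl, rfl, hF⟩
    · obtain rfl : x = y := by omega
      exact absurd (sub_eq_zero.2 hF) hx
    · have hvj : (0 : ℝ) < v j := NNReal.coe_pos.2 (hv j hj)
      obtain ⟨k, hk, hkj⟩ := hsold j hj (by
        rw [hsum s hs _ _ hay (hlr j hj).le hzb, ← ENNReal.ofReal_coe_nnreal,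
          ENNReal.ofReal_lt_ofReal_iff hvj]
        simp only [tilted, tilt, if_pos hy, if_pos hz]
        have := mul_pos hδ hvj
        rw [hF]
        linarith)
      refine ⟨k, hk, ?_⟩
      obtain ⟨-, t, ht, h3, h4, h5, h6⟩ := hbuy k hk
      obtain ⟨w, hw1, hw2⟩ := Finset.not_disjoint_iff.1 hkj
      rw [Finset.mem_Ico] at hw1 hw2 ⊢
      obtain rfl : s = t := by
        by_contra hne
        have := hL.separated s hs t ht hne
        omega
      have := hyz' _ h5.1 h5.2
      have := hyz' _ h6.1 h6.2
      omega
  have hF0 : ∀ x, 0 ≤ F (x + 1) - F x := fun x => sub_nonneg.2 (hP.mono (Nat.le_succ x))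
  calc 2 / 3 * F N ≤ mass F L := hLm
    _ = ∑ x ∈ L.biUnion fun s => Finset.Ico s.1 s.2, (F (x + 1) - F x) := by
        rw [Finset.sum_biUnion]
        · exact Finset.sum_congr rfl fun s hs => (sum_Ico_increment F (hL.lt s hs).le).symm
        · intro s hs t ht hne
          rw [Function.onFun, Finset.disjoint_left]
          intro x hxs hxt
          rw [Finset.mem_Ico] at hxs hxt
          have := hL.separated s hs t ht hne
          omega
    _ = ∑ x ∈ (L.biUnion fun s => Finset.Ico s.1 s.2) with F (x + 1) - F x ≠ 0,
          (F (x + 1) - F x) := (Finset.sum_filter_ne_zero _).symm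
    _ ≤ ∑ x ∈ D.biUnion fun k => Finset.Ico (l k) (r k), (F (x + 1) - F x) := by
        refine Finset.sum_le_sum_of_subset_of_nonneg (fun x hx => ?_) fun x _ _ => hF0 x
        obtain ⟨hx, hne⟩ := Finset.mem_filter.1 hx
        obtain ⟨s, hs, hxs⟩ := Finset.mem_biUnion.1 hx
        rw [Finset.mem_Ico] at hxs
        exact Finset.mem_biUnion.2 (hcov s hs x hxs.1 hxs.2 hne)
    _ = ∑ k ∈ D, (v k : ℝ) := by
        rw [Finset.sum_biUnion fun j hj k hk hne => hdisj j hj k hk hne]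
        exact Finset.sum_congr rfl fun k hk => by
          rw [sum_Ico_increment F (hlr k (hDJ hk)).le, (hbuy k hk).1]

end Line

section Mechanism

variable {n : ℕ} {V : Type*}

/-- The properties of a set of purchasing buyers that hold for every arrival order and every
tie-breaking choice. -/
structure Outcome [DecidableEq V] (p : Sym2 V → ℝ≥0∞) (Q : Fin n → Finset (Sym2 V))
    (v : Fin n → ℝ≥0) (D : Finset (Fin n)) : Prop where
  disjoint : ∀ j ∈ D, ∀ k ∈ D, j ≠ k → Disjoint (Q j) (Q k)
  price_le : ∀ k ∈ D, price p (Q k) ≤ v k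
  sold : ∀ j, price p (Q j) < v j → ∃ k ∈ D, ¬ Disjoint (Q k) (Q j)

theorem foldl_step_spec [DecidableEq V] (E : Finset (Sym2 V)) (p : Sym2 V → ℝ≥0∞)
    {Q : Fin n → Finset (Sym2 V)} (v : Fin n → ℝ≥0) (t : Fin n → Bool) (hQE : ∀ j, Q j ⊆ E)
    (hQ : ∀ j, (Q j).Nonempty) (w : List (Fin n)) :
    (w.foldl (step p Q v t) (E, ∅)).1 = E \ (w.foldl (step p Q v t) (E, ∅)).2.biUnion Q ∧
    (∀ j ∈ (w.foldl (step p Q v t) (E, ∅)).2, ∀ k ∈ (w.foldl (step p Q v t) (E, ∅)).2,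
      j ≠ k → Disjoint (Q j) (Q k)) ∧
    (∀ k ∈ (w.foldl (step p Q v t) (E, ∅)).2, price p (Q k) ≤ v k) ∧
    (∀ j ∈ w, price p (Q j) < v j →
      ∃ k ∈ (w.foldl (step p Q v t) (E, ∅)).2, ¬ Disjoint (Q k) (Q j)) := by
  induction w using List.reverseRecOn with
  | nil => simp
  | append_singleton w i ih =>
    rw [List.foldl_append]
    simp only [List.foldl_cons, List.foldl_nil]
    generalize w.foldl (step p Q v t) (E, ∅) = st at ih ⊢
    obtain ⟨A, D⟩ := st
    obtain ⟨h1, h2, h3, h4⟩ := ih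
    simp only at h1 h2 h3 h4
    subst h1
    unfold step
    split_ifs with hc
    · obtain ⟨hsub, hpr⟩ := hc
      have hdis : ∀ k ∈ D, Disjoint (Q k) (Q i) := by
        intro k hk
        rw [Finset.disjoint_left]
        intro e he hei
        exact (Finset.mem_sdiff.1 (hsub hei)).2 (Finset.mem_biUnion.2 ⟨k, hk, he⟩)
      refine ⟨?_, ?_, ?_, ?_⟩
      · simp only [Finset.biUnion_insert]
        ext e
        simp only [Finset.mem_sdiff, Finset.mem_union]
        tauto
      · intro j hj k hk hjk
        rcases Finset.mem_insert.1 hj with hj' | hj' <;>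
          rcases Finset.mem_insert.1 hk with hk' | hk'
        · exact absurd (hj'.trans hk'.symm) hjk
        · exact hj' ▸ (hdis k hk').symm
        · exact hk' ▸ hdis j hj'
        · exact h2 j hj' k hk' hjk
      · intro k hk
        rcases Finset.mem_insert.1 hk with rfl | hk
        · rcases hpr with h | h
          · exact h.le
          · exact h.1.le
        · exact h3 k hk
      · intro j hj hlt
        rcases List.mem_append.1 hj with hj | hj
        · obtain ⟨k, hk, h⟩ := h4 j hj hlt
          exact ⟨k, Finset.mem_insert_of_mem hk, h⟩
        · rw [List.mem_singleton] at hj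
          subst hj
          refine ⟨j, Finset.mem_insert_self _ _, fun h => ?_⟩
          exact (hQ j).ne_empty (Finset.disjoint_self_iff_empty _ |>.1 h)
    · refine ⟨rfl, h2, h3, fun j hj hlt => ?_⟩
      rcases List.mem_append.1 hj with hj | hj
      · exact h4 j hj hlt
      · rw [List.mem_singleton] at hj
        subst hj
        by_contra! hn
        refine hc ⟨fun e he => ?_, Or.inl hlt⟩
        refine Finset.mem_sdiff.2 ⟨hQE j he, fun hm => ?_⟩
        obtain ⟨k, hk, hek⟩ := Finset.mem_biUnion.1 hm
        exact Finset.disjoint_left.1 (hn k hk) hek he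

theorem outcome_purchased [Fintype V] [DecidableEq V] (G : SimpleGraph V) (p : Sym2 V → ℝ≥0∞)
    {Q : Fin n → Finset (Sym2 V)} (v : Fin n → ℝ≥0) (hQE : ∀ j, Q j ⊆ G.edgeFinset)
    (hQ : ∀ j, (Q j).Nonempty) (σ : Equiv.Perm (Fin n)) (t : Fin n → Bool) :
    Outcome p Q v (purchased G p Q v σ t) := by
  obtain ⟨-, h2, h3, h4⟩ := foldl_step_spec G.edgeFinset p v t hQE hQ (List.ofFn fun i => σ i)
  exact ⟨h2, h3, fun j => h4 j (List.mem_ofFn.2 ⟨σ.symm j, by simp⟩)⟩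

theorem exists_eq_OPT [Fintype V] [DecidableEq V] {Q : Fin n → Finset (Sym2 V)} (v : Fin n → ℝ≥0) :
    ∃ S : Finset (Fin n), (∀ j ∈ S, ∀ k ∈ S, j ≠ k → Disjoint (Q j) (Q k)) ∧
      (OPT Q v : ℝ) = ∑ j ∈ S, (v j : ℝ) := by
  have hne : (Finset.univ.powerset.filter fun S : Finset (Fin n) =>
      (S : Set (Fin n)).Pairwise fun j k => Disjoint (Q j) (Q k)).Nonempty :=
    ⟨∅, by simp⟩
  obtain ⟨S, hS, h⟩ := Finset.exists_mem_eq_sup _ hne fun S => ∑ j ∈ S, v j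
  refine ⟨S, fun j hj k hk hjk => (Finset.mem_filter.1 hS).2 hj hk hjk, ?_⟩
  rw [OPT, h]
  push_cast
  rfl

theorem IsPathEdges.mem_edgeSet [DecidableEq V] {G : SimpleGraph V} {s : Finset (Sym2 V)}
    (h : IsPathEdges G s) {e : Sym2 V} (he : e ∈ s) : e ∈ G.edgeSet := by
  obtain ⟨a, b, W, -, -, rfl⟩ := h
  exact W.edges_subset_edgeSet (List.mem_toFinset.1 he)

theorem IsPathEdges.nonempty [DecidableEq V] {G : SimpleGraph V} {s : Finset (Sym2 V)}
    (h : IsPathEdges G s) : s.Nonempty := by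
  obtain ⟨a, b, W, -, h, rfl⟩ := h
  exact List.toFinset_nonempty_iff _ |>.2 h

theorem price_ofReal {q : Sym2 V → ℝ} (hq : ∀ e, 0 ≤ q e) (s : Finset (Sym2 V)) :
    price (fun e => ENNReal.ofReal (q e)) s = ENNReal.ofReal (∑ e ∈ s, q e) :=
  (ENNReal.ofReal_sum_of_nonneg fun e _ => hq e).symm

end Mechanism

section Combine

variable {n : ℕ} {V : Type*} [DecidableEq V]

/-- A set `C` of central edges and positions of the edges on a line, such that paths which avoid
`C` are intervals, and paths meeting `C` can only intersect if they intersect in `C`. -/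
structure Coordinates (G : SimpleGraph V) (C : Finset (Sym2 V)) (pos : Sym2 V → ℕ) (N : ℕ) :
    Prop where
  pos_lt : ∀ e ∈ G.edgeSet, pos e < N
  pos_inj : Set.InjOn pos G.edgeSet
  card_le : ∀ s, IsPathEdges G s → (s ∩ C).card ≤ 2
  interval : ∀ s, IsPathEdges G s → Disjoint s C →
    ∃ l r, l < r ∧ r ≤ N ∧ s.image pos = Finset.Ico l r
  share : ∀ s t, IsPathEdges G s → IsPathEdges G t → ¬ Disjoint s C → ¬ Disjoint t C →
    ¬ Disjoint s t → ∃ e ∈ C, e ∈ s ∧ e ∈ t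

variable {G : SimpleGraph V} {C : Finset (Sym2 V)} {pos : Sym2 V → ℕ} {N : ℕ}
  {Q : Fin n → Finset (Sym2 V)} {v : Fin n → ℝ≥0}

/-- The buyers avoiding the central edges can be priced by dual prices, and two thirds of the
total dual price is guaranteed by some item pricing. -/
theorem Coordinates.exists_outer_pricing (hC : Coordinates G C pos N) (hI : Instance G Q v) :
    ∃ (q : Sym2 V → ℝ) (T : ℝ), (∀ e, 0 ≤ q e) ∧
      (∀ j, Disjoint (Q j) C → v j ≤ ∑ e ∈ Q j, q e) ∧
      (∀ s : Finset (Sym2 V), (∀ e ∈ s, e ∈ G.edgeSet) → ∑ e ∈ s, q e ≤ T) ∧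
      ∃ p, ∀ D, Outcome p Q v D → 2 / 3 * T ≤ ∑ k ∈ D, (v k : ℝ) := by
  have hex : ∀ j, ∃ l r, Disjoint (Q j) C → l < r ∧ r ≤ N ∧ (Q j).image pos = Finset.Ico l r := by
    intro j
    by_cases h : Disjoint (Q j) C
    · obtain ⟨l, r, h⟩ := hC.interval _ (hI.2 j).2 h
      exact ⟨l, r, fun _ => h⟩
    · exact ⟨0, 0, fun h' => absurd h' h⟩
  choose l r hlr using hex
  set J : Finset (Fin n) := Finset.univ.filter fun j => Disjoint (Q j) C with hJ
  have hmem : ∀ j, j ∈ J ↔ Disjoint (Q j) C := by simp [hJ]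
  obtain ⟨F, hP⟩ := exists_linePotential (J := J) (v := v) fun j hj => (hlr j ((hmem j).1 hj)).1
  obtain ⟨p, hp⟩ := hP.exists_pricing (N := N) (fun j hj => (hlr j ((hmem j).1 hj)).1)
    (fun j hj => (hlr j ((hmem j).1 hj)).2.1) fun j _ => (hI.2 j).1
  have hinj : ∀ s : Finset (Sym2 V), (∀ e ∈ s, e ∈ G.edgeSet) → Set.InjOn pos s :=
    fun s hs => hC.pos_inj.mono hs
  have hF0 : ∀ x, 0 ≤ F (x + 1) - F x := fun x => sub_nonneg.2 (hP.mono (Nat.le_succ x))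
  refine ⟨fun e => F (pos e + 1) - F (pos e), F N, fun e => hF0 _, fun j hj => ?_,
    fun s hs => ?_, fun e => if e ∈ C then ⊤ else p (pos e), fun D hD => ?_⟩
  · obtain ⟨h1, h2, h3⟩ := hlr j hj
    rw [← Finset.sum_image (f := fun x => F (x + 1) - F x)
      (hinj _ fun e he => (hI.2 j).2.mem_edgeSet he), h3, sum_Ico_increment F h1.le]
    exact hP.value_le j ((hmem j).2 hj)
  · rw [← Finset.sum_image (f := fun x => F (x + 1) - F x) (hinj s hs)]
    calc _ ≤ ∑ x ∈ Finset.Ico 0 N, (F (x + 1) - F x) := by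
          refine Finset.sum_le_sum_of_subset_of_nonneg (fun x hx => ?_) fun x _ _ => hF0 x
          obtain ⟨e, he, rfl⟩ := Finset.mem_image.1 hx
          exact Finset.mem_Ico.2 ⟨Nat.zero_le _, hC.pos_lt e (hs e he)⟩
      _ = F N := by rw [sum_Ico_increment F (Nat.zero_le N), hP.zero, sub_zero]
  · have hDJ : D ⊆ J := by
      intro k hk
      rw [hmem, Finset.disjoint_left]
      intro e he heC
      have := ENNReal.sum_ne_top.1 (ne_top_of_le_ne_top ENNReal.coe_ne_top (hD.price_le k hk)) e he
      exact this (if_pos heC)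
    have hprice : ∀ j ∈ J, price (fun e => if e ∈ C then ⊤ else p (pos e)) (Q j) =
        ∑ x ∈ Finset.Ico (l j) (r j), p x := by
      intro j hj
      have hj' := (hmem j).1 hj
      rw [← (hlr j hj').2.2, Finset.sum_image (hinj _ fun e he => (hI.2 j).2.mem_edgeSet he)]
      exact Finset.sum_congr rfl fun e he => if_neg (Finset.disjoint_left.1 hj' he)
    have hdisj : ∀ j ∈ J, ∀ k ∈ J, (Disjoint (Finset.Ico (l j) (r j)) (Finset.Ico (l k) (r k)) ↔
        Disjoint (Q j) (Q k)) := by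
      intro j hj k hk
      rw [← (hlr j ((hmem j).1 hj)).2.2, ← (hlr k ((hmem k).1 hk)).2.2]
      constructor
      · intro h
        rw [Finset.disjoint_left] at h ⊢
        exact fun e he he' => h (Finset.mem_image_of_mem _ he) (Finset.mem_image_of_mem _ he')
      · intro h
        rw [Finset.disjoint_left] at h ⊢
        intro x hx hx'
        obtain ⟨e, he, rfl⟩ := Finset.mem_image.1 hx
        obtain ⟨e', he', hee⟩ := Finset.mem_image.1 hx'
        have := hC.pos_inj ((hI.2 k).2.mem_edgeSet he') ((hI.2 j).2.mem_edgeSet he) hee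
        exact h he (this ▸ he')
    refine hp D hDJ (fun j hj k hk hjk => ?_) (fun k hk => ?_) fun j hj hlt => ?_
    · exact (hdisj j (hDJ hj) k (hDJ hk)).2 (hD.disjoint j hj k hk hjk)
    · exact hprice k (hDJ hk) ▸ hD.price_le k hk
    · obtain ⟨k, hk, h⟩ := hD.sold j (by rwa [hprice j hj])
      exact ⟨k, hk, fun h' => h ((hdisj k (hDJ hk) j hj).1 h')⟩

/-- Half of what a packing earns beyond the total dual price can be guaranteed by pricing the
central edges. -/
theorem Coordinates.exists_central_pricing [Fintype V] (hC : Coordinates G C pos N)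
    (hI : Instance G Q v)
    {q : Sym2 V → ℝ} {T : ℝ} (hq : ∀ e, 0 ≤ q e)
    (hqv : ∀ j, Disjoint (Q j) C → v j ≤ ∑ e ∈ Q j, q e)
    (hqT : ∀ s : Finset (Sym2 V), (∀ e ∈ s, e ∈ G.edgeSet) → ∑ e ∈ s, q e ≤ T)
    {S : Finset (Fin n)} (hS : ∀ j ∈ S, ∀ k ∈ S, j ≠ k → Disjoint (Q j) (Q k)) {θ : ℝ}
    (hθ : 0 < θ) (hθ1 : θ < 1) :
    ∃ p, ∀ D, Outcome p Q v D →
      (1 - θ) / 2 * (∑ j ∈ S, (v j : ℝ) - T) ≤ ∑ k ∈ D, (v k : ℝ) := by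
  set w : Fin n → ℝ := fun j => v j - ∑ e ∈ Q j \ C, q e with hw
  set M : Finset (Fin n) := S.filter fun j => ¬ Disjoint (Q j) C ∧ 0 < w j with hM
  have hMmem : ∀ j, j ∈ M → j ∈ S ∧ ¬ Disjoint (Q j) C ∧ 0 < w j :=
    fun j hj => Finset.mem_filter.1 hj
  have hcard : ∀ j ∈ M, 0 < ((Q j ∩ C).card : ℝ) := by
    intro j hj
    rw [Nat.cast_pos, Finset.card_pos, Finset.nonempty_iff_ne_empty, Ne,
      ← Finset.disjoint_iff_inter_eq_empty]
    exact (hMmem j hj).2.1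
  set u : Fin n → ℝ := fun j => (1 - θ) * w j / (Q j ∩ C).card with hu
  have hu0 : ∀ j ∈ M, 0 < u j := fun j hj =>
    div_pos (mul_pos (by linarith) (hMmem j hj).2.2) (hcard j hj)
  obtain ⟨η, hη, hsmall⟩ := exists_small M (fun j => θ * w j) (Fintype.card (Sym2 V))
  set y : Sym2 V → ℝ := fun e => ∑ j ∈ M, if e ∈ Q j then u j else 0 with hy
  have hy0 : ∀ e, 0 ≤ y e := fun e => Finset.sum_nonneg fun j hj => by
    split_ifs
    · exact (hu0 j hj).le
    · exact le_rfl
  set g : Sym2 V → ℝ := fun e => if e ∈ C then y e else q e + η with hg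
  have hg0 : ∀ e, 0 ≤ g e := fun e => by
    simp only [hg]
    split_ifs
    · exact hy0 e
    · linarith [hq e]
  have hsplit : ∀ j, ∑ e ∈ Q j, g e =
      ∑ e ∈ Q j ∩ C, y e + (∑ e ∈ Q j \ C, q e + (Q j \ C).card * η) := by
    intro j
    rw [← Finset.sum_inter_add_sum_sdiff (Q j) C]
    congr 1
    · exact Finset.sum_congr rfl fun e he => if_pos (Finset.mem_inter.1 he).2
    · rw [← nsmul_eq_mul, ← Finset.sum_const, ← Finset.sum_add_distrib]
      exact Finset.sum_congr rfl fun e he => if_neg (Finset.mem_sdiff.1 he).2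
  refine ⟨fun e => ENNReal.ofReal (g e), fun D hD => ?_⟩
  have hpay : ∀ k ∈ D, ∑ e ∈ Q k, g e ≤ v k := by
    intro k hk
    have := hD.price_le k hk
    rwa [price_ofReal hg0, ← ENNReal.ofReal_coe_nnreal,
      ENNReal.ofReal_le_ofReal_iff (NNReal.coe_nonneg _)] at this
  have hmeet : ∀ k ∈ D, ¬ Disjoint (Q k) C := by
    intro k hk hdis
    have h1 := hpay k hk
    rw [hsplit, Finset.disjoint_iff_inter_eq_empty.1 hdis, Finset.sum_empty,
      Finset.sdiff_eq_self_of_disjoint hdis] at h1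
    have h2 : (0 : ℝ) < (Q k).card * η :=
      mul_pos (Nat.cast_pos.2 (Finset.card_pos.2 (hI.2 k).2.nonempty)) hη
    linarith [hqv k hdis]
  have hwant : ∀ j ∈ M, ∑ e ∈ Q j, g e < v j := by
    intro j hj
    have h1 : ∑ e ∈ Q j ∩ C, y e = (1 - θ) * w j := by
      have : ∀ e ∈ Q j ∩ C, y e = u j := by
        intro e he
        have hej := (Finset.mem_inter.1 he).1
        rw [hy]
        simp only
        rw [Finset.sum_eq_single_of_mem j hj, if_pos hej]
        intro k hk hkj
        refine if_neg fun hek => ?_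
        exact Finset.disjoint_left.1 (hS k (hMmem k hk).1 j (hMmem j hj).1 hkj) hek hej
      rw [Finset.sum_congr rfl this, Finset.sum_const, nsmul_eq_mul]
      exact mul_div_cancel₀ _ (hcard j hj).ne'
    have h2 : ((Q j \ C).card : ℝ) * η ≤ η * Fintype.card (Sym2 V) := by
      rw [mul_comm]
      exact mul_le_mul_of_nonneg_left (Nat.cast_le.2 (Finset.card_le_univ _)) hη.le
    have h3 := hsmall j hj (mul_pos hθ (hMmem j hj).2.2)
    have h4 : w j = v j - ∑ e ∈ Q j \ C, q e := rfl
    rw [hsplit, h1]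
    linarith
  have hwelfare : ∑ j ∈ M, u j ≤ ∑ k ∈ D, (v k : ℝ) := by
    have hnn : ∀ j ∈ M, ∀ e, 0 ≤ if e ∈ Q j then u j else 0 := fun j hj e => by
      split_ifs
      · exact (hu0 j hj).le
      · exact le_rfl
    calc ∑ j ∈ M, u j ≤ ∑ j ∈ M, ∑ k ∈ D, ∑ e ∈ Q k ∩ C, (if e ∈ Q j then u j else 0) := by
          refine Finset.sum_le_sum fun j hj => ?_
          obtain ⟨k, hk, hkj⟩ := hD.sold j (by
            rw [price_ofReal hg0, ← ENNReal.ofReal_coe_nnreal,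
              ENNReal.ofReal_lt_ofReal_iff (NNReal.coe_pos.2 (hI.2 j).1)]
            exact hwant j hj)
          obtain ⟨e, heC, hek, hej⟩ := hC.share _ _ (hI.2 k).2 (hI.2 j).2 (hmeet k hk)
            (hMmem j hj).2.1 hkj
          calc u j = if e ∈ Q j then u j else 0 := (if_pos hej).symm
            _ ≤ ∑ e ∈ Q k ∩ C, (if e ∈ Q j then u j else 0) :=
              Finset.single_le_sum (f := fun e => if e ∈ Q j then u j else 0)
                (fun e _ => hnn j hj e) (Finset.mem_inter.2 ⟨hek, heC⟩)
            _ ≤ _ := Finset.single_le_sum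
                (f := fun k => ∑ e ∈ Q k ∩ C, (if e ∈ Q j then u j else 0))
                (fun k _ => Finset.sum_nonneg fun e _ => hnn j hj e) hk
      _ = ∑ k ∈ D, ∑ e ∈ Q k ∩ C, y e := by
          rw [Finset.sum_comm]
          exact Finset.sum_congr rfl fun k _ => Finset.sum_comm
      _ ≤ ∑ k ∈ D, (v k : ℝ) := by
          refine Finset.sum_le_sum fun k hk => le_trans ?_ (hpay k hk)
          rw [hsplit]
          have h1 : 0 ≤ ∑ e ∈ Q k \ C, q e := Finset.sum_nonneg fun e _ => hq e
          have h2 : (0 : ℝ) ≤ (Q k \ C).card * η := mul_nonneg (Nat.cast_nonneg _) hη.le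
          linarith
  have hgain : ∑ j ∈ S, (v j : ℝ) ≤ ∑ j ∈ M, w j + T := by
    calc ∑ j ∈ S, (v j : ℝ)
        ≤ ∑ j ∈ S, ((if ¬ Disjoint (Q j) C ∧ 0 < w j then w j else 0) + ∑ e ∈ Q j, q e) := by
          refine Finset.sum_le_sum fun j _ => ?_
          have h1 : ∑ e ∈ Q j \ C, q e ≤ ∑ e ∈ Q j, q e :=
            Finset.sum_le_sum_of_subset_of_nonneg Finset.sdiff_subset fun e _ _ => hq e
          have h4 : w j = v j - ∑ e ∈ Q j \ C, q e := rfl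
          split_ifs with h
          · linarith
          · by_cases hd : Disjoint (Q j) C
            · linarith [hqv j hd]
            · have : w j ≤ 0 := not_lt.1 fun h' => h ⟨hd, h'⟩
              linarith
      _ = ∑ j ∈ M, w j + ∑ e ∈ S.biUnion Q, q e := by
          rw [Finset.sum_add_distrib, hM, Finset.sum_filter,
            Finset.sum_biUnion fun j hj k hk hne => hS j hj k hk hne]
      _ ≤ ∑ j ∈ M, w j + T := by
          gcongr
          refine hqT _ fun e he => ?_
          obtain ⟨j, _, hej⟩ := Finset.mem_biUnion.1 he
          exact (hI.2 j).2.mem_edgeSet hej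
  refine le_trans ?_ hwelfare
  calc (1 - θ) / 2 * (∑ j ∈ S, (v j : ℝ) - T) ≤ (1 - θ) / 2 * ∑ j ∈ M, w j :=
        mul_le_mul_of_nonneg_left (by linarith) (by linarith)
    _ = ∑ j ∈ M, (1 - θ) * w j / 2 := by
        rw [Finset.mul_sum]
        exact Finset.sum_congr rfl fun j _ => by ring
    _ ≤ ∑ j ∈ M, u j := by
        refine Finset.sum_le_sum fun j hj => ?_
        refine div_le_div_of_nonneg_left (mul_pos (by linarith) (hMmem j hj).2.2).le
          (hcard j hj) ?_
        exact_mod_cast hC.card_le _ (hI.2 j).2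

theorem Coordinates.exists_pricing [Fintype V] (hC : Coordinates G C pos N)
    (hI : Instance G Q v) {ε : ℝ} (hε : 0 < ε) : ∃ p : Sym2 V → ℝ≥0∞, ∀ (σ : Equiv.Perm (Fin n)) (t : Fin n → Bool),
      ((2 : ℝ) / 7 - ε) * (OPT Q v : ℝ) ≤ (Wel G p Q v σ t : ℝ) := by
  obtain ⟨q, T, hq, hqv, hqT, p₁, hp₁⟩ := hC.exists_outer_pricing hI
  obtain ⟨S, hS, hopt⟩ := exists_eq_OPT (Q := Q) v
  have hθ : 0 < min (1 / 2) ε := lt_min (by norm_num) hε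
  obtain ⟨p₂, hp₂⟩ := hC.exists_central_pricing hI hq hqv hqT hS hθ
    ((min_le_left _ _).trans_lt (by norm_num))
  have hout : ∀ (p : Sym2 V → ℝ≥0∞) σ t, Outcome p Q v (purchased G p Q v σ t) := fun p =>
    outcome_purchased G p v
      (fun j e he => SimpleGraph.mem_edgeFinset.2 ((hI.2 j).2.mem_edgeSet he))
      fun j => (hI.2 j).2.nonempty
  have hwel : ∀ (p : Sym2 V → ℝ≥0∞) σ t,
      (Wel G p Q v σ t : ℝ) = ∑ k ∈ purchased G p Q v σ t, (v k : ℝ) := fun p σ t => by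
    rw [Wel]; push_cast; rfl
  have hO : (0 : ℝ) ≤ OPT Q v := NNReal.coe_nonneg _
  have hεO := mul_nonneg hε.le hO
  rcases le_total (3 / 7 * (OPT Q v : ℝ)) T with h | h
  · refine ⟨p₁, fun σ t => ?_⟩
    have := hp₁ _ (hout p₁ σ t)
    rw [hwel]
    linarith
  · refine ⟨p₂, fun σ t => ?_⟩
    have h1 := hp₂ _ (hout p₂ σ t)
    rw [hwel]
    refine le_trans ?_ h1
    rw [← hopt]
    have h2 : min (1 / 2) ε ≤ ε := min_le_right _ _
    have h3 : min (1 / 2) ε ≤ 1 / 2 := min_le_left _ _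
    calc ((2 : ℝ) / 7 - ε) * (OPT Q v : ℝ)
        ≤ (1 - min (1 / 2) ε) / 2 * (4 / 7 * (OPT Q v : ℝ)) := by
          have := mul_le_mul_of_nonneg_right h2 hO
          linarith
      _ ≤ _ := mul_le_mul_of_nonneg_left (by linarith) (by linarith)

end Combine

section Spider

variable {V : Type*} {G : SimpleGraph V} {c : V} {depth : V → ℕ} {leg : V → V}

theorem exists_mem_edges_of_boundary {a b : V} (W : G.Walk a b) {X : Set V} {x y : V}
    (hx : x ∈ W.support) (hy : y ∈ W.support) (hxX : x ∈ X) (hyX : y ∉ X) :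
    ∃ u w, s(u, w) ∈ W.edges ∧ G.Adj u w ∧ u ∉ X ∧ w ∈ X := by
  by_cases ha : a ∈ X
  · obtain ⟨d, hd, h1, h2⟩ := (W.takeUntil y hy).exists_boundary_dart X ha hyX
    refine ⟨d.snd, d.fst, W.edges_takeUntil_subset_edges hy ?_, d.adj.symm, h2, h1⟩
    rw [Sym2.eq_swap]
    exact List.mem_map_of_mem hd
  · obtain ⟨d, hd, h1, h2⟩ := (W.takeUntil x hx).exists_boundary_dart Xᶜ ha (by simpa using hxX)
    refine ⟨d.fst, d.snd, W.edges_takeUntil_subset_edges hx ?_, d.adj, h1, by simpa using h2⟩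
    exact List.mem_map_of_mem hd

theorem card_filter_mem_edges_le [DecidableEq V] {a b : V} (c : V) (W : G.Walk a b)
    (hW : W.IsPath) :
    (W.edges.toFinset.filter (c ∈ ·)).card ≤ 2 ∧
      (c = a → (W.edges.toFinset.filter (c ∈ ·)).card ≤ 1) := by
  induction W with
  | nil => simp
  | @cons u v w h p ih =>
    obtain ⟨hp, hu⟩ := (SimpleGraph.Walk.cons_isPath_iff h p).1 hW
    obtain ⟨ih1, ih2⟩ := ih hp
    rw [SimpleGraph.Walk.edges_cons, List.toFinset_cons, Finset.filter_insert]
    by_cases hcu : c = u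
    · subst hcu
      have : p.edges.toFinset.filter (c ∈ ·) = ∅ := by
        refine Finset.filter_eq_empty_iff.2 fun e he hc => hu ?_
        obtain ⟨x, rfl⟩ := hc
        exact p.fst_mem_support_of_mem_edges (List.mem_toFinset.1 he)
      simp [this]
    · refine ⟨?_, fun h => absurd h hcu⟩
      split_ifs with hc
      · have hcv : c = v := (Sym2.mem_iff.1 hc).resolve_left hcu
        exact (Finset.card_insert_le _ _).trans (Nat.succ_le_succ (ih2 hcv))
      · exact ih1

/-- The vertices other than `c` are arranged on legs leaving `c`, each leg having at most one
vertex of every positive depth. -/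
structure Legs (G : SimpleGraph V) (c : V) (depth : V → ℕ) (leg : V → V) : Prop where
  depth_eq_zero : ∀ v, depth v = 0 ↔ v = c
  depth_of_adj : ∀ u v, G.Adj u v → depth v = depth u + 1 ∨ depth u = depth v + 1
  leg_eq_of_adj : ∀ u v, G.Adj u v → u ≠ c → v ≠ c → leg u = leg v
  eq_of_leg_eq : ∀ u v, u ≠ c → leg u = leg v → depth u = depth v → u = v

theorem exists_legs (hG : G.IsTree)
    (hdeg : ∀ w, w ≠ c → ∀ x y z, G.Adj w x → G.Adj w y → G.Adj w z → x = y ∨ x = z ∨ y = z) :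
    ∃ leg : V → V, Legs G c (G.dist c) leg := by
  choose P hP using fun v => hG.connected.exists_walk_length_eq_dist c v
  have hzero : ∀ v, G.dist c v = 0 ↔ v = c := fun v => by
    rw [hG.connected.dist_eq_zero_iff, eq_comm]
  have hdepth : ∀ u v, G.Adj u v → G.dist c v = G.dist c u + 1 ∨ G.dist c u = G.dist c v + 1 :=
    fun u v h => (hG.dist_eq_dist_add_one_of_adj c h).symm
  have hpath : ∀ v, (P v).IsPath := fun v => (P v).isPath_of_length_eq_dist (hP v)
  have hleg : ∀ u v, G.Adj u v → G.dist c v = G.dist c u + 1 → u ≠ c →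
      (P u).getVert 1 = (P v).getVert 1 := by
    intro u v h hd hu
    have hlen : ((P u).concat h).length = G.dist c v := by
      rw [SimpleGraph.Walk.length_concat, hP, hd]
    have hc : P v = (P u).concat h :=
      (hG.existsUnique_path c v).unique (hpath v)
        (((P u).concat h).isPath_of_length_eq_dist hlen)
    have hpos : 1 ≤ (P u).length := by
      rw [hP]
      exact Nat.one_le_iff_ne_zero.2 fun h => hu ((hzero u).1 h)
    rw [hc, SimpleGraph.Walk.concat_eq_append, SimpleGraph.Walk.getVert_append]
    split_ifs with h1
    · rfl
    · have h2 : (P u).length = 1 := by omega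
      rw [h2, Nat.sub_self, SimpleGraph.Walk.getVert_zero, ← h2,
        SimpleGraph.Walk.getVert_length]
  have hleg' : ∀ u v, G.Adj u v → u ≠ c → v ≠ c → (P u).getVert 1 = (P v).getVert 1 := by
    intro u v h hu hv
    rcases hdepth u v h with hd | hd
    · exact hleg u v h hd hu
    · exact (hleg v u h.symm hd hv).symm
  have hparent : ∀ v d, G.dist c v = d + 1 → ∃ u, G.Adj u v ∧ G.dist c u = d := by
    intro v d hd
    have hl : (P v).length = d + 1 := (hP v).trans hd
    have hadj : G.Adj (P v).penultimate v :=
      SimpleGraph.Walk.adj_penultimate fun hn => by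
        rw [← SimpleGraph.Walk.length_eq_zero_iff] at hn; omega
    refine ⟨_, hadj, ?_⟩
    have h1 : G.dist c (P v).penultimate ≤ d := by
      refine (SimpleGraph.dist_le (P v).dropLast).trans ?_
      simp [SimpleGraph.Walk.dropLast, hl]
    have := hdepth _ _ hadj
    omega
  refine ⟨fun v => (P v).getVert 1, hzero, hdepth, hleg', ?_⟩
  have key : ∀ d u v, G.dist c u = d + 1 → G.dist c v = d + 1 →
      (P u).getVert 1 = (P v).getVert 1 → u = v := by
    intro d
    induction d with
    | zero =>
      intro u v hu hv h
      rw [← zero_add 1, ← hu, ← hP u, SimpleGraph.Walk.getVert_length, hP u, hu, ← hv, ← hP v,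
        SimpleGraph.Walk.getVert_length] at h
      exact h
    | succ d ih =>
      intro u v hu hv h
      have hne : ∀ x k, G.dist c x = k + 1 → x ≠ c := fun x k hx hxc => by
        rw [(hzero x).2 hxc] at hx; omega
      obtain ⟨u', hu', hdu⟩ := hparent u _ hu
      obtain ⟨v', hv', hdv⟩ := hparent v _ hv
      have hw : u' = v' := ih u' v' hdu hdv <| by
        rw [hleg' u' u hu' (hne _ _ hdu) (hne _ _ hu), h,
          hleg' v' v hv' (hne _ _ hdv) (hne _ _ hv)]
      subst hw
      obtain ⟨w, hw, hdw⟩ := hparent u' d hdu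
      rcases hdeg u' (hne _ _ hdu) u v w hu' hv' hw.symm with h | h | h
      · exact h
      · subst h; omega
      · subst h; omega
  intro u v hu h hd
  obtain ⟨d, hdu⟩ := Nat.exists_eq_succ_of_ne_zero fun h => hu ((hzero u).1 h)
  exact key d u v hdu (hd ▸ hdu) h

namespace Legs

theorem ne_of_depth (hL : Legs G c depth leg) {u w : V} (hd : depth w = depth u + 1) : w ≠ c :=
  fun h => by rw [(hL.depth_eq_zero w).2 h] at hd; omega

theorem parent_unique (hL : Legs G c depth leg) {u u' w : V} (h : G.Adj u w) (h' : G.Adj u' w)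
    (hd : depth w = depth u + 1) (hd' : depth w = depth u' + 1) : u = u' := by
  by_cases hu : u = c
  · have := (hL.depth_eq_zero u).2 hu
    rw [hu, (hL.depth_eq_zero u').1 (by omega)]
  · have hu' : u' ≠ c := fun h => by
      have := (hL.depth_eq_zero u').2 h
      exact hu ((hL.depth_eq_zero u).1 (by omega))
    have hw := hL.ne_of_depth hd
    exact hL.eq_of_leg_eq u u' hu
      ((hL.leg_eq_of_adj u w h hu hw).trans (hL.leg_eq_of_adj u' w h' hu' hw).symm) (by omega)

/-- A walk visiting a leg at depth at least `d ≥ 1`, as well as some vertex not of this kind,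
uses the edge of this leg leading up to depth `d`. -/
theorem exists_mem_edges (hL : Legs G c depth leg) {a b : V} (W : G.Walk a b) {x y : V}
    (hx : x ∈ W.support) (hy : y ∈ W.support) {d : ℕ} (hd : 1 ≤ d) (hxd : d ≤ depth x)
    (hyx : leg y = leg x → depth y < d) :
    ∃ u w, s(u, w) ∈ W.edges ∧ G.Adj u w ∧ depth w = depth u + 1 ∧ leg w = leg x ∧
      depth w = d := by
  obtain ⟨u, w, he, hadj, hu, hw⟩ :=
    exists_mem_edges_of_boundary W (X := {z | leg z = leg x ∧ d ≤ depth z}) hx hy ⟨rfl, hxd⟩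
      fun h => absurd (hyx h.1) (not_lt.2 h.2)
  have hwc : w ≠ c := fun h => by
    have := (hL.depth_eq_zero w).2 h
    have := hw.2
    omega
  have hud : depth u < d := by
    by_cases huc : u = c
    · rw [(hL.depth_eq_zero u).2 huc]; omega
    · by_contra! h
      exact hu ⟨(hL.leg_eq_of_adj u w hadj huc hwc).trans hw.1, h⟩
  have := hL.depth_of_adj u w hadj
  have := hw.2
  exact ⟨u, w, he, hadj, by omega, hw.1, by omega⟩

/-- The endpoint of an edge which is farther away from `c`. -/
def child (G : SimpleGraph V) (c : V) (depth : V → ℕ) (e : Sym2 V) : V :=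
  if h : ∃ w u, e = s(u, w) ∧ G.Adj u w ∧ depth w = depth u + 1 then h.choose else c

theorem exists_child (hL : Legs G c depth leg) {e : Sym2 V} (he : e ∈ G.edgeSet) :
    ∃ u, e = s(u, child G c depth e) ∧ G.Adj u (child G c depth e) ∧
      depth (child G c depth e) = depth u + 1 := by
  have h : ∃ w u, e = s(u, w) ∧ G.Adj u w ∧ depth w = depth u + 1 := by
    induction e with
    | h x y =>
      rcases hL.depth_of_adj x y he with h | h
      · exact ⟨y, x, rfl, he, h⟩
      · exact ⟨x, y, Sym2.eq_swap, (G.mem_edgeSet.1 he).symm, h⟩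
  rw [child, dif_pos h]
  exact h.choose_spec

theorem child_eq (hL : Legs G c depth leg) {u w : V} (h : G.Adj u w)
    (hd : depth w = depth u + 1) : child G c depth s(u, w) = w := by
  obtain ⟨u', he, -, hd'⟩ := hL.exists_child (G.mem_edgeSet.2 h)
  rcases Sym2.eq_iff.1 he with ⟨-, h2⟩ | ⟨h1, h2⟩
  · exact h2.symm
  · rw [← h1, ← h2] at hd'
    omega

theorem exists_coordinates [Fintype V] [DecidableEq V] (hL : Legs G c depth leg) {K : ℕ}
    (hK : ∀ v, depth v < K) : ∃ C pos N, Coordinates G C pos N := by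
  set ι := Fintype.equivFin V
  set C := G.edgeFinset.filter (c ∈ ·) with hC
  set pos : Sym2 V → ℕ := fun e =>
    ι (leg (child G c depth e)) * K + depth (child G c depth e) with hpos
  have hCmem : ∀ e, e ∈ C ↔ e ∈ G.edgeSet ∧ c ∈ e := fun e => by
    rw [hC, Finset.mem_filter, SimpleGraph.mem_edgeFinset]
  have hlt : ∀ e, pos e < Fintype.card V * K := fun e =>
    calc pos e < ι (leg (child G c depth e)) * K + K := Nat.add_lt_add_left (hK _) _
      _ = (ι (leg (child G c depth e)) + 1) * K := (Nat.succ_mul _ _).symm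
      _ ≤ _ := Nat.mul_le_mul_right _ (ι (leg (child G c depth e))).2
  refine ⟨C, pos, Fintype.card V * K, fun e _ => hlt e, ?_, ?_, ?_, ?_⟩
  · intro e he e' he' h
    have hdiv : ∀ e, pos e / K = ι (leg (child G c depth e)) := fun e => by
      rw [hpos]
      simp only
      rw [Nat.mul_comm, Nat.mul_add_div (Nat.zero_lt_of_lt (hK c)), Nat.div_eq_of_lt (hK _),
        Nat.add_zero]
    have hl : leg (child G c depth e) = leg (child G c depth e') := by
      have := (hdiv e).symm.trans ((congrArg (· / K) h).trans (hdiv e'))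
      exact ι.injective (Fin.ext this)
    have hd : depth (child G c depth e) = depth (child G c depth e') := by
      simp only [hpos, hl] at h
      omega
    obtain ⟨u, hu, hadj, hdu⟩ := hL.exists_child he
    obtain ⟨u', hu', hadj', hdu'⟩ := hL.exists_child he'
    have hch := hL.eq_of_leg_eq _ _ (hL.ne_of_depth hdu) hl hd
    rw [← hch] at hadj' hdu' hu'
    rw [hu, hu', hL.parent_unique hadj hadj' hdu hdu']
  · rintro s ⟨a, b, W, hW, -, rfl⟩
    refine (Finset.card_le_card fun e he => ?_).trans (card_filter_mem_edges_le c W hW).1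
    obtain ⟨h1, h2⟩ := Finset.mem_inter.1 he
    exact Finset.mem_filter.2 ⟨h1, ((hCmem e).1 h2).2⟩
  · rintro s ⟨a, b, W, hW, hne, rfl⟩ hdis
    have hnotc : ∀ e ∈ W.edges, c ∉ e := fun e he hc =>
      Finset.disjoint_left.1 hdis (List.mem_toFinset.2 he)
        ((hCmem e).2 ⟨W.edges_subset_edgeSet he, hc⟩)
    have hsupp : ∀ e ∈ W.edges, ∃ u, u ∈ W.support ∧ child G c depth e ∈ W.support ∧
        depth (child G c depth e) = depth u + 1 := by
      intro e he
      obtain ⟨u, hu, -, hd⟩ := hL.exists_child (W.edges_subset_edgeSet he)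
      refine ⟨u, W.fst_mem_support_of_mem_edges (hu ▸ he),
        W.snd_mem_support_of_mem_edges (hu ▸ he), hd⟩
    have hleg : ∀ x ∈ W.support, 1 ≤ depth x → ∀ y ∈ W.support, leg y = leg x := by
      intro x hx hdx y hy
      by_contra hn
      obtain ⟨u, w, he, -, hd, -, hd1⟩ :=
        hL.exists_mem_edges W hx hy le_rfl hdx fun h => absurd h hn
      refine hnotc _ he ?_
      rw [(hL.depth_eq_zero u).1 (by omega)]
      exact Sym2.mem_mk_left _ _
    have hAne : (W.edges.toFinset.image pos).Nonempty :=
      ((List.toFinset_nonempty_iff _).2 hne).image _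
    have hconv : ∀ e ∈ W.edges, ∀ e' ∈ W.edges, ∀ m, pos e ≤ m → m ≤ pos e' →
        ∃ e'' ∈ W.edges, pos e'' = m := by
      intro e he e' he' m h1 h2
      obtain ⟨u, hu, hch, hd⟩ := hsupp e he
      obtain ⟨u', hu', hch', hd'⟩ := hsupp e' he'
      have hll : leg (child G c depth e) = leg (child G c depth e') :=
        hleg _ hch' (by omega) _ hch
      simp only [hpos, hll] at h1 h2 ⊢
      obtain ⟨d, rfl⟩ := Nat.exists_eq_add_of_le
        ((Nat.le_add_right (ι (leg (child G c depth e')) * K) _).trans h1)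
      obtain ⟨x, w, hxw, hadj, hdw, hlw, hwd⟩ :=
        hL.exists_mem_edges W (d := d) hch' hu (by omega) (by omega) fun _ => by omega
      refine ⟨_, hxw, ?_⟩
      rw [hL.child_eq hadj hdw, hlw, hwd]
    refine ⟨(W.edges.toFinset.image pos).min' hAne, (W.edges.toFinset.image pos).max' hAne + 1,
      Nat.lt_succ_of_le (Finset.min'_le_max' _ hAne), ?_, ?_⟩
    · obtain ⟨e, -, he⟩ := Finset.mem_image.1 (Finset.max'_mem _ hAne)
      rw [← he]
      exact hlt e
    · ext m
      rw [Finset.mem_Ico, Nat.lt_succ_iff]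
      constructor
      · exact fun h => ⟨Finset.min'_le _ _ h, Finset.le_max' _ _ h⟩
      · rintro ⟨h1, h2⟩
        obtain ⟨e, he, hem⟩ := Finset.mem_image.1 (Finset.min'_mem _ hAne)
        obtain ⟨e', he', hem'⟩ := Finset.mem_image.1 (Finset.max'_mem _ hAne)
        obtain ⟨e'', he'', h⟩ := hconv e (List.mem_toFinset.1 he) e' (List.mem_toFinset.1 he') m
          (hem.trans_le h1) (h2.trans_eq hem'.symm)
        exact Finset.mem_image.2 ⟨e'', List.mem_toFinset.2 he'', h⟩
  · rintro s t ⟨a, b, W, -, -, rfl⟩ ⟨a', b', W', -, -, rfl⟩ hs ht hst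
    have hcsupp : ∀ {a b : V} (W : G.Walk a b), ¬ Disjoint W.edges.toFinset C →
        c ∈ W.support := by
      intro a b W h
      obtain ⟨e, he, heC⟩ := Finset.not_disjoint_iff.1 h
      obtain ⟨x, rfl⟩ := ((hCmem e).1 heC).2
      exact W.fst_mem_support_of_mem_edges (List.mem_toFinset.1 he)
    obtain ⟨e, he, he'⟩ := Finset.not_disjoint_iff.1 hst
    rw [List.mem_toFinset] at he he'
    obtain ⟨x, hx, -, hdx⟩ := hL.exists_child (W.edges_subset_edgeSet he)
    have hc0 : depth c < 1 := by rw [(hL.depth_eq_zero c).2 rfl]; exact one_pos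
    obtain ⟨u, w, h1, h2, h3, h4, h5⟩ := hL.exists_mem_edges W (d := 1)
      (W.snd_mem_support_of_mem_edges (hx ▸ he)) (hcsupp W hs) le_rfl (by omega) fun _ => hc0
    obtain ⟨u', w', h1', h2', h3', h4', h5'⟩ := hL.exists_mem_edges W' (d := 1)
      (W'.snd_mem_support_of_mem_edges (hx ▸ he')) (hcsupp W' ht) le_rfl (by omega) fun _ => hc0
    have hu : u = c := (hL.depth_eq_zero u).1 (by omega)
    have hu' : u' = c := (hL.depth_eq_zero u').1 (by omega)
    have hw : w = w' :=
      hL.eq_of_leg_eq _ _ (hL.ne_of_depth h3) (h4.trans h4'.symm) (h5.trans h5'.symm)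
    subst hw hu
    rw [hu'] at h1'
    exact ⟨_, (hCmem _).2 ⟨h2, Sym2.mem_mk_left _ _⟩, List.mem_toFinset.2 h1,
      List.mem_toFinset.2 h1'⟩

end Legs

theorem IsSpider.exists_coordinates [Fintype V] [DecidableEq V] (hG : IsSpider G) :
    ∃ C pos N, Coordinates G C pos N := by
  obtain ⟨hT, hS⟩ := hG
  obtain ⟨c, hc⟩ : ∃ c, ∀ w, w ≠ c → G.degree w ≤ 2 := by
    by_cases h : ∃ c, 3 ≤ G.degree c
    · obtain ⟨c, hc⟩ := h
      exact ⟨c, fun w hw => by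
        by_contra! h
        exact hw (hS h hc)⟩
    · push Not at h
      obtain ⟨c⟩ := hT.connected.nonempty
      exact ⟨c, fun w _ => Nat.le_of_lt_succ (h w)⟩
  obtain ⟨leg, hL⟩ := exists_legs hT (c := c) fun w hw x y z hx hy hz => by
    by_contra! h
    refine absurd (hc w hw) (not_le.2 ?_)
    rw [← SimpleGraph.card_neighborFinset_eq_degree, Finset.two_lt_card]
    exact ⟨x, by simpa using hx, y, by simpa using hy, z, by simpa using hz, h⟩
  refine hL.exists_coordinates (K := Fintype.card V) fun v => ?_
  obtain ⟨W, hW⟩ := hT.connected.exists_walk_length_eq_dist c v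
  exact hW ▸ (W.isPath_of_length_eq_dist hW).length_lt

end Spider

end Tollbooth

/-- For every `ε > 0` and every tollbooth instance on a spider graph, there
exists an item pricing `p` such that for every arrival order `σ` and every tie-breaking
choice `t`, `Wel(p,σ,t) ≥ (2/7 − ε)·OPT`. -/
theorem spider_no_tie_gap_le_seven_halves {V : Type*} [Fintype V] [DecidableEq V]
    (ε : ℝ) (hε : 0 < ε)
    (G : SimpleGraph V) (hG : Tollbooth.IsSpider G)
    {n : ℕ} (Q : Fin n → Finset (Sym2 V)) (v : Fin n → ℝ≥0)
    (hI : Tollbooth.Instance G Q v) :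
    ∃ p : Sym2 V → ℝ≥0∞, ∀ (σ : Equiv.Perm (Fin n)) (t : Fin n → Bool),
      ((2 : ℝ) / 7 - ε) * (Tollbooth.OPT Q v : ℝ) ≤ (Tollbooth.Wel G p Q v σ t : ℝ) := by
  obtain ⟨C, pos, N, hC⟩ := hG.exists_coordinates
  exact hC.exists_pricing hI hε
end
end

section
/- There exists a constant C > 0 such that for every tollbooth instance on a finite simple graph G with m ≥ 2 edges and n ≥ 2 buyers, there is an item pricing p such that for every arrival order σ there is a tie-breaking choice t with Wel(p,σ,t) ≥ OPT/(C · m^{2/5} · (log m)^2 · log n). (The competitive ratio of item pricing with seller tie-breaking power on any graph is O(m^{0.4} log^2 m log n).) -/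
open scoped Classical NNReal ENNReal

noncomputable section

namespace Tollbooth

section Purchases

variable {V : Type*} [DecidableEq V]

/-- Buyer `j` accepts the price of her path, provided that it is still available. -/
def Willing {n : ℕ} (p : Sym2 V → ℝ≥0∞) (Q : Fin n → Finset (Sym2 V)) (v : Fin n → ℝ≥0)
    (t : Fin n → Bool) (j : Fin n) : Prop :=
  price p (Q j) < (v j : ℝ≥0∞) ∨ (price p (Q j) = (v j : ℝ≥0∞) ∧ t j = true)

variable {n : ℕ} {p : Sym2 V → ℝ≥0∞} {Q : Fin n → Finset (Sym2 V)}
  {v : Fin n → ℝ≥0} {t : Fin n → Bool}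

theorem step_of_buys {st : Finset (Sym2 V) × Finset (Fin n)} {j : Fin n}
    (hQ : Q j ⊆ st.1) (hj : Willing p Q v t j) :
    step p Q v t st j = (st.1 \ Q j, insert j st.2) :=
  if_pos ⟨hQ, hj⟩

theorem step_of_not_buys {st : Finset (Sym2 V) × Finset (Fin n)} {j : Fin n}
    (h : ¬(Q j ⊆ st.1 ∧ Willing p Q v t j)) : step p Q v t st j = st :=
  if_neg h

theorem foldl_step_spec_s12 (l : List (Fin n)) (st : Finset (Sym2 V) × Finset (Fin n)) :
    st.2 ⊆ (l.foldl (step p Q v t) st).2 ∧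
      (∀ j ∈ (l.foldl (step p Q v t) st).2, j ∈ st.2 ∨ Willing p Q v t j) ∧
      ∀ j ∈ l, Willing p Q v t j → Q j ⊆ st.1 → (Q j).Nonempty →
        ∃ i ∈ (l.foldl (step p Q v t) st).2, ¬Disjoint (Q i) (Q j) := by
  induction l generalizing st with
  | nil => exact ⟨subset_rfl, fun j hj => Or.inl hj, by simp⟩
  | cons a l ih =>
    rw [List.foldl_cons]
    by_cases h : Q a ⊆ st.1 ∧ Willing p Q v t a
    · rw [step_of_buys h.1 h.2]
      obtain ⟨h1, h2, h3⟩ := ih (st.1 \ Q a, insert a st.2)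
      have ha := h1 (Finset.mem_insert_self a st.2)
      refine ⟨fun x hx => h1 (Finset.mem_insert_of_mem hx), fun j hj => ?_,
        fun j hj hw hs hn => ?_⟩
      · rcases h2 j hj with h4 | h4
        · rcases Finset.mem_insert.1 h4 with rfl | h5
          · exact Or.inr h.2
          · exact Or.inl h5
        · exact Or.inr h4
      · by_cases hd : Disjoint (Q a) (Q j)
        · rcases List.mem_cons.1 hj with rfl | hj
          · exact absurd hd (by simpa using hn.ne_empty)
          · exact h3 j hj hw (Finset.subset_sdiff.2 ⟨hs, hd.symm⟩) hn
        · exact ⟨a, ha, hd⟩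
    · rw [step_of_not_buys h]
      obtain ⟨h1, h2, h3⟩ := ih st
      refine ⟨h1, h2, fun j hj hw hs hn => ?_⟩
      rcases List.mem_cons.1 hj with rfl | hj
      · exact absurd ⟨hs, hw⟩ h
      · exact h3 j hj hw hs hn

/-- The pricing that charges `q` on `U` and forbids all edges outside `U`. -/
def restrictedPrice (U : Finset (Sym2 V)) (q : Sym2 V → ℝ≥0) (e : Sym2 V) : ℝ≥0∞ :=
  if e ∈ U then (q e : ℝ≥0∞) else ⊤

theorem price_restrictedPrice {U s : Finset (Sym2 V)} {q : Sym2 V → ℝ≥0} (h : s ⊆ U) :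
    price (restrictedPrice U q) s = ((∑ e ∈ s, q e : ℝ≥0) : ℝ≥0∞) := by
  rw [price, ENNReal.ofNNReal_finsetSum]
  exact Finset.sum_congr rfl fun e he => if_pos (h he)

theorem willing_restrictedPrice {U : Finset (Sym2 V)} {q : Sym2 V → ℝ≥0} {j : Fin n} :
    Willing (restrictedPrice U q) Q v t j ↔
      Q j ⊆ U ∧ (∑ e ∈ Q j, q e < v j ∨ (∑ e ∈ Q j, q e = v j ∧ t j = true)) := by
  by_cases h : Q j ⊆ U
  · simp only [Willing, price_restrictedPrice h, h, true_and, ENNReal.coe_lt_coe,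
      ENNReal.coe_inj]
  · have htop : price (restrictedPrice U q) (Q j) = ⊤ := by
      obtain ⟨e, he, heU⟩ := Finset.not_subset.1 h
      exact ENNReal.sum_eq_top.2 ⟨e, he, if_neg heU⟩
    simp [Willing, htop, h]

variable [Fintype V] {G : SimpleGraph V}

theorem willing_of_mem_purchased {σ : Equiv.Perm (Fin n)} {j : Fin n}
    (hj : j ∈ purchased G p Q v σ t) : Willing p Q v t j := by
  have h := (foldl_step_spec_s12 (p := p) (Q := Q) (v := v) (t := t) (List.ofFn fun i => σ i)
    (G.edgeFinset, ∅)).2.1 j hj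
  simpa using h

/-- A willing buyer ends up sharing an edge with some purchasing buyer (possibly herself). -/
theorem exists_purchased_of_willing (σ : Equiv.Perm (Fin n)) {j : Fin n}
    (hw : Willing p Q v t j) (hs : Q j ⊆ G.edgeFinset) (hn : (Q j).Nonempty) :
    ∃ i ∈ purchased G p Q v σ t, ¬Disjoint (Q i) (Q j) :=
  (foldl_step_spec_s12 (List.ofFn fun i => σ i) (G.edgeFinset, ∅)).2.2 j
    (List.mem_ofFn.2 ⟨σ.symm j, by simp⟩) hw hs hn

end Purchases

section Combinatorics

theorem sum_le_sum_sum_filter {ι κ : Type*} {I : Finset ι} {A : Finset κ} {r : κ → ι → Prop}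
    [∀ j, DecidablePred (r j)]
    (w : ι → ℝ≥0) (h : ∀ i ∈ I, ∃ j ∈ A, r j i) :
    ∑ i ∈ I, w i ≤ ∑ j ∈ A, ∑ i ∈ I with r j i, w i := by
  simp_rw [Finset.sum_filter]
  rw [Finset.sum_comm]
  refine Finset.sum_le_sum fun i hi => ?_
  obtain ⟨j, hj, hji⟩ := h i hi
  calc w i = if r j i then w i else 0 := (if_pos hji).symm
    _ ≤ _ := Finset.single_le_sum (f := fun j => if r j i then w i else 0)
      (fun _ _ => zero_le) hj

/-- Greedy packing by decreasing value. -/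
theorem exists_greedy_packing {ι α : Type*} (Q : ι → Finset α) (v : ι → ℝ≥0)
    (hQ : ∀ i, (Q i).Nonempty) (B : Finset ι) :
    ∃ M ⊆ B, (M : Set ι).Pairwise (fun i j => Disjoint (Q i) (Q j)) ∧
      ∀ j ∈ B, ∃ i ∈ M, ¬Disjoint (Q i) (Q j) ∧ v j ≤ v i := by
  induction B using Finset.strongInduction with
  | H B ih =>
    rcases B.eq_empty_or_nonempty with rfl | hB
    · exact ⟨∅, by simp⟩
    obtain ⟨a, ha, hmax⟩ := B.exists_max_image v hB
    have haa : ¬Disjoint (Q a) (Q a) := by simpa using (hQ a).ne_empty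
    obtain ⟨M, hMB, hM, hcov⟩ := ih (B.filter fun j => Disjoint (Q a) (Q j))
      (Finset.filter_ssubset.2 ⟨a, ha, haa⟩)
    refine ⟨insert a M, ?_, ?_, fun j hj => ?_⟩
    · exact Finset.insert_subset ha (hMB.trans (Finset.filter_subset _ _))
    · rw [Finset.coe_insert]
      refine hM.insert fun b hb _ => ?_
      have := (Finset.mem_filter.1 (hMB hb)).2
      exact ⟨this, this.symm⟩
    · by_cases hd : Disjoint (Q a) (Q j)
      · obtain ⟨i, hi, h⟩ := hcov j (Finset.mem_filter.2 ⟨hj, hd⟩)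
        exact ⟨i, Finset.mem_insert_of_mem hi, h⟩
      · exact ⟨a, Finset.mem_insert_self a M, hd, hmax j hj⟩

/-- Some threshold `θ` loses only a harmonic factor: `∑ w ≤ H_{|S|} · θ · #{w ≥ θ}`. -/
theorem sum_le_harmonic_mul {ι : Type*} (S : Finset ι) (w : ι → ℝ≥0) (A : ℝ)
    (h : ∀ i ∈ S, (w i : ℝ) * (S.filter fun j => w i ≤ w j).card ≤ A) :
    ∑ i ∈ S, (w i : ℝ) ≤ (harmonic S.card : ℝ) * A := by
  induction S using Finset.strongInduction with
  | H S ih =>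
    rcases S.eq_empty_or_nonempty with rfl | hS
    · simp
    obtain ⟨a, ha, hmin⟩ := S.exists_min_image w hS
    have hfa : (S.filter fun j => w a ≤ w j) = S := Finset.filter_true_of_mem hmin
    have h1 := h a ha
    rw [hfa] at h1
    have h2 := ih (S.erase a) (Finset.erase_ssubset ha) fun i hi => by
      refine le_trans ?_ (h i (Finset.mem_of_mem_erase hi))
      gcongr
      exact Finset.erase_subset _ _
    have hcard : S.card = (S.erase a).card + 1 := (Finset.card_erase_add_one ha).symm
    rw [← Finset.add_sum_erase S _ ha]
    have hpos : (0 : ℝ) < ((S.erase a).card + 1 : ℝ) := by positivity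
    have h3 : (w a : ℝ) ≤ ((S.erase a).card + 1 : ℝ)⁻¹ * A := by
      rw [hcard] at h1
      push_cast at h1
      rw [inv_mul_eq_div, le_div_iff₀ hpos]
      exact h1
    rw [hcard, harmonic_succ]
    push_cast
    rw [add_mul]
    linarith

/-- Some subset of at least half the size of `T` contains none of the sets `F j` of size greater
than `log₂ n + 1`. -/
theorem exists_large_subset_avoiding {ι : Type*} {n : ℕ} (T : Finset ι)
    (F : Fin n → Finset ι) :
    ∃ R ⊆ T, T.card ≤ 2 * R.card ∧ ∀ j, F j ⊆ R → (F j).card ≤ Nat.log 2 n + 1 := by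
  by_contra! hcon
  set c := Nat.log 2 n + 1 with hc
  have hn2 : n < 2 ^ c := Nat.lt_pow_succ_log_self one_lt_two n
  set big := T.powerset.filter fun R => T.card ≤ 2 * R.card with hbig
  have hbig_card : 2 ^ T.card ≤ 2 * big.card := by
    have hcompl : (T.powerset.filter fun R => ¬T.card ≤ 2 * R.card).card ≤ big.card := by
      refine Finset.card_le_card_of_injOn (fun R => T \ R) (fun R hR => ?_) fun R hR R' hR' h => ?_
      · simp only [Finset.coe_filter, Finset.mem_powerset, Set.mem_ofPred_eq] at hR
        simp only [hbig, Finset.coe_filter, Finset.mem_powerset, Set.mem_ofPred_eq,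
          Finset.sdiff_subset, true_and, Finset.card_sdiff_of_subset hR.1]
        omega
      · simp only [Finset.coe_filter, Finset.mem_powerset, Set.mem_ofPred_eq] at hR hR'
        rw [← Finset.sdiff_sdiff_eq_self hR.1, ← Finset.sdiff_sdiff_eq_self hR'.1]
        exact congrArg (T \ ·) h
    have := Finset.card_filter_add_card_filter_not (s := T.powerset)
      (fun R : Finset ι => T.card ≤ 2 * R.card)
    rw [Finset.card_powerset, ← hbig] at this
    omega
  have hsub : big ⊆ Finset.univ.biUnion fun j : Fin n =>
      (Finset.Icc (F j) T).filter fun _ => c < (F j).card := by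
    intro R hR
    rw [hbig, Finset.mem_filter, Finset.mem_powerset] at hR
    obtain ⟨j, hj, hjc⟩ := hcon R hR.1 hR.2
    simp only [Finset.mem_biUnion, Finset.mem_univ, true_and, Finset.mem_filter, Finset.mem_Icc]
    exact ⟨j, ⟨hj, hR.1⟩, hjc⟩
  have hle : ∀ j : Fin n, 2 ^ (c + 1) *
      ((Finset.Icc (F j) T).filter fun _ => c < (F j).card).card ≤ 2 ^ T.card := by
    intro j
    by_cases hj : F j ⊆ T ∧ c < (F j).card
    · have hcard := Finset.card_le_card hj.1
      rw [Finset.filter_true_of_mem fun _ _ => hj.2, Finset.card_Icc_finset hj.1, ← pow_add]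
      exact Nat.pow_le_pow_right two_pos (by omega)
    · have : ((Finset.Icc (F j) T).filter fun _ => c < (F j).card) = ∅ := by
        refine Finset.filter_eq_empty_iff.2 fun R hR hlt => hj ⟨?_, hlt⟩
        have := Finset.mem_Icc.1 hR
        exact this.1.trans this.2
      simp [this]
  have hsum : 2 ^ (c + 1) * big.card ≤ n * 2 ^ T.card := by
    calc 2 ^ (c + 1) * big.card
        ≤ 2 ^ (c + 1) * ∑ j : Fin n,
          ((Finset.Icc (F j) T).filter fun _ => c < (F j).card).card := by
          gcongr
          exact (Finset.card_le_card hsub).trans Finset.card_biUnion_le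
      _ ≤ n * 2 ^ T.card := by
          rw [Finset.mul_sum]
          calc _ ≤ ∑ _j : Fin n, 2 ^ T.card := Finset.sum_le_sum fun j _ => hle j
            _ = n * 2 ^ T.card := by simp
  have hpos : 0 < 2 ^ T.card := by positivity
  have h1 : 2 ^ c * 2 ^ T.card ≤ n * 2 ^ T.card := by
    calc 2 ^ c * 2 ^ T.card ≤ 2 ^ c * (2 * big.card) := by gcongr
      _ = 2 ^ (c + 1) * big.card := by ring
      _ ≤ _ := hsum
  exact absurd (Nat.le_of_mul_le_mul_right h1 hpos) (not_le.2 hn2)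

end Combinatorics

section IntervalPricing

theorem add_sum_Ico_tsub {f : ℕ → ℝ≥0} (hf : Monotone f) {a b : ℕ} (hab : a ≤ b) :
    f a + ∑ i ∈ Finset.Ico a b, (f (i + 1) - f i) = f b := by
  induction b, hab using Nat.le_induction with
  | base => simp
  | succ b hab ih =>
    rw [Finset.sum_Ico_succ_top hab, ← add_assoc, ih, add_tsub_cancel_of_le (hf b.le_succ)]

variable {α : Type*} {n : ℕ} (Q : Fin n → Finset α) (v : Fin n → ℝ≥0)

/-- The maximum value of a packing that only uses items of `X`. -/
def packingValue (X : Finset α) : ℝ≥0 :=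
  (Finset.univ.filter fun S : Finset (Fin n) =>
      (S : Set (Fin n)).Pairwise (fun j k => Disjoint (Q j) (Q k)) ∧ ∀ j ∈ S, Q j ⊆ X).sup
    fun S => ∑ j ∈ S, v j

theorem exists_packingValue_eq (X : Finset α) :
    ∃ S : Finset (Fin n), (S : Set (Fin n)).Pairwise (fun j k => Disjoint (Q j) (Q k)) ∧
      (∀ j ∈ S, Q j ⊆ X) ∧ ∑ j ∈ S, v j = packingValue Q v X := by
  obtain ⟨S, hS, h⟩ := Finset.exists_mem_eq_sup (Finset.univ.filter fun S : Finset (Fin n) =>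
      (S : Set (Fin n)).Pairwise (fun j k => Disjoint (Q j) (Q k)) ∧ ∀ j ∈ S, Q j ⊆ X)
    ⟨∅, by simp⟩ fun S => ∑ j ∈ S, v j
  have hS' := (Finset.mem_filter.1 hS).2
  exact ⟨S, hS'.1, hS'.2, h.symm⟩

variable {Q v}

theorem sum_le_packingValue {X : Finset α} {S : Finset (Fin n)}
    (hS : (S : Set (Fin n)).Pairwise fun j k => Disjoint (Q j) (Q k)) (hX : ∀ j ∈ S, Q j ⊆ X) :
    ∑ j ∈ S, v j ≤ packingValue Q v X :=
  Finset.le_sup (f := fun S : Finset (Fin n) => ∑ j ∈ S, v j)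
    (Finset.mem_filter.2 ⟨Finset.mem_univ S, hS, hX⟩)

theorem packingValue_mono {X Y : Finset α} (h : X ⊆ Y) :
    packingValue Q v X ≤ packingValue Q v Y := by
  obtain ⟨S, hS, hX, hv⟩ := exists_packingValue_eq Q v X
  rw [← hv]
  exact sum_le_packingValue hS fun j hj => (hX j hj).trans h

theorem packingValue_add_le {X Y : Finset α} (h : X ⊆ Y) {j : Fin n} (hj : (Q j).Nonempty)
    (hY : Q j ⊆ Y) (hX : Disjoint (Q j) X) :
    packingValue Q v X + v j ≤ packingValue Q v Y := by
  obtain ⟨S, hS, hSX, hv⟩ := exists_packingValue_eq Q v X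
  have hjS : j ∉ S := fun hmem =>
    hj.ne_empty (Finset.disjoint_self_iff_empty _ |>.1 (hX.mono_right (hSX j hmem)))
  rw [← hv, add_comm, ← Finset.sum_insert hjS]
  refine sum_le_packingValue ?_ fun i hi => ?_
  · rw [Finset.coe_insert]
    refine hS.insert fun b hb _ => ?_
    have := hX.mono_right (hSX b hb)
    exact ⟨this, this.symm⟩
  · rcases Finset.mem_insert.1 hi with rfl | hi
    · exact hY
    · exact (hSX i hi).trans h

/-- If all demands inside `P` are intervals for a linear order of `P`, then there are prices at
which no such buyer strictly profits and all members of some optimal packing are tight. -/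
theorem exists_interval_prices (P : Finset α) (pos : α → ℕ) (N : ℕ)
    (hinj : Set.InjOn pos P) (hN : ∀ e ∈ P, pos e < N) (hQ : ∀ j, (Q j).Nonempty)
    (hinterval : ∀ j, Q j ⊆ P → ∀ x ∈ Q j, ∀ y ∈ Q j, ∀ i, pos x ≤ i → i ≤ pos y →
      ∃ z ∈ Q j, pos z = i) :
    ∃ (q : α → ℝ≥0) (T : Finset (Fin n)),
      (T : Set (Fin n)).Pairwise (fun j k => Disjoint (Q j) (Q k)) ∧
      (∀ j ∈ T, Q j ⊆ P ∧ ∑ e ∈ Q j, q e = v j) ∧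
      (∀ j, Q j ⊆ P → v j ≤ ∑ e ∈ Q j, q e) ∧ ∀ j, Q j ⊆ P → v j ≤ ∑ i ∈ T, v i := by
  set X : ℕ → Finset α := fun i => P.filter fun e => pos e < i with hX
  have hXmono : ∀ {a b}, a ≤ b → X a ⊆ X b := fun hab e he => by
    simp only [hX, Finset.mem_filter] at he ⊢
    exact ⟨he.1, he.2.trans_le hab⟩
  set f : ℕ → ℝ≥0 := fun i => packingValue Q v (X i) with hf
  have hfm : Monotone f := fun a b hab => packingValue_mono (hXmono hab)
  have hXN : X N = P := Finset.filter_true_of_mem hN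
  set q : α → ℝ≥0 := fun e => f (pos e + 1) - f (pos e) with hq
  have hsum : ∀ s ⊆ P, ∑ e ∈ s, q e = ∑ i ∈ s.image pos, (f (i + 1) - f i) := fun s hs =>
    
    (Finset.sum_image (f := fun i => f (i + 1) - f i) (hinj.mono (Finset.coe_subset.2 hs))).symm
  have hge : ∀ j, Q j ⊆ P → v j ≤ ∑ e ∈ Q j, q e := by
    intro j hj
    obtain ⟨x, hx, hxmin⟩ := (Q j).exists_min_image pos (hQ j)
    obtain ⟨y, hy, hymax⟩ := (Q j).exists_max_image pos (hQ j)
    have himg : (Q j).image pos = Finset.Ico (pos x) (pos y + 1) := by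
      ext i
      simp only [Finset.mem_image, Finset.mem_Ico, Nat.lt_succ_iff]
      constructor
      · rintro ⟨z, hz, rfl⟩
        exact ⟨hxmin z hz, hymax z hz⟩
      · rintro ⟨h1, h2⟩
        exact hinterval j hj x hx y hy i h1 h2
    have hle : pos x ≤ pos y + 1 := (hxmin y hy).trans (Nat.le_succ _)
    have h1 : f (pos x) + v j ≤ f (pos y + 1) := by
      refine packingValue_add_le (hXmono hle) (hQ j) (fun z hz => ?_) ?_
      · exact Finset.mem_filter.2 ⟨hj hz, Nat.lt_succ_of_le (hymax z hz)⟩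
      · refine Finset.disjoint_left.2 fun z hz hz' => ?_
        exact absurd (Finset.mem_filter.1 hz').2 (not_lt.2 (hxmin z hz))
    rw [← add_sum_Ico_tsub hfm hle] at h1
    rw [hsum _ hj, himg]
    exact le_of_add_le_add_left h1
  obtain ⟨T, hT, hTP, hTv⟩ := exists_packingValue_eq Q v P
  have htot : ∑ j ∈ T, ∑ e ∈ Q j, q e ≤ ∑ j ∈ T, v j := by
    rw [← Finset.sum_biUnion hT, hTv, ← hXN, hsum _ (Finset.biUnion_subset.2 hTP)]
    calc _ ≤ ∑ i ∈ Finset.Ico 0 N, (f (i + 1) - f i) := by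
          refine Finset.sum_le_sum_of_subset fun i hi => ?_
          obtain ⟨z, hz, rfl⟩ := Finset.mem_image.1 hi
          exact Finset.mem_Ico.2 ⟨Nat.zero_le _, hN z (Finset.biUnion_subset.2 hTP hz)⟩
      _ ≤ f 0 + ∑ i ∈ Finset.Ico 0 N, (f (i + 1) - f i) := le_add_self
      _ = f N := add_sum_Ico_tsub hfm (Nat.zero_le N)
  have hTge : ∀ j ∈ T, v j ≤ ∑ e ∈ Q j, q e := fun j hj => hge j (hTP j hj)
  have heq := (Finset.sum_eq_sum_iff_of_le hTge).1 (le_antisymm (Finset.sum_le_sum hTge) htot)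
  refine ⟨q, T, hT, fun j hj => ⟨hTP j hj, (heq j hj).symm⟩, hge, fun j hj => ?_⟩
  rw [hTv]
  simpa using sum_le_packingValue (Q := Q) (v := v) (X := P) (S := {j}) (by simp) (by simpa using hj)

end IntervalPricing

section Paths

variable {V : Type*} {G : SimpleGraph V}

/-- A walk inside a path `W` that avoids the `k`-th edge of `W` stays on one side of it. -/
theorem mem_side_iff_of_avoids {a b : V} {W : G.Walk a b} (hW : W.IsPath) (k : ℕ) {c d : V}
    (W' : G.Walk c d) (h : ∀ e ∈ W'.edges, ∃ i < W.length, i ≠ k ∧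
      e = s(W.getVert i, W.getVert (i + 1))) :
    ∀ x ∈ W'.support, (x ∈ Set.image W.getVert {i | i ≤ k ∧ i ≤ W.length} ↔
      c ∈ Set.image W.getVert {i | i ≤ k ∧ i ≤ W.length}) := by
  have key : ∀ i ≤ W.length, (W.getVert i ∈ Set.image W.getVert {i | i ≤ k ∧ i ≤ W.length} ↔ i ≤ k) := by
    refine fun i hi => ⟨?_, fun hk => ⟨i, ⟨hk, hi⟩, rfl⟩⟩
    rintro ⟨i', ⟨hk, hi'⟩, he⟩
    exact hW.getVert_injOn hi' hi he ▸ hk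
  induction W' with
  | nil => simp
  | @cons u w d huw p ih =>
    have ih' := ih fun e he => h e (by simp [he])
    obtain ⟨i, hi, hik, he⟩ := h s(u, w) (by simp)
    have k1 := key i hi.le
    have k2 := key (i + 1) hi
    have huw' : w ∈ Set.image W.getVert {i | i ≤ k ∧ i ≤ W.length} ↔
        u ∈ Set.image W.getVert {i | i ≤ k ∧ i ≤ W.length} := by
      rcases Sym2.eq_iff.1 he with ⟨rfl, rfl⟩ | ⟨rfl, rfl⟩
      · rw [k1, k2]; omega
      · rw [k1, k2]; omega
    intro x hx
    rw [SimpleGraph.Walk.support_cons, List.mem_cons] at hx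
    rcases hx with rfl | hx
    · exact Iff.rfl
    · exact (ih' x hx).trans huw'

/-- The edges of a walk inside a path `W` form an interval of the edge sequence of `W`. -/
theorem getVert_edge_mem_of_le_of_le {a b : V} {W : G.Walk a b} (hW : W.IsPath) {c d : V}
    (W' : G.Walk c d) (h : ∀ e ∈ W'.edges, e ∈ W.edges) {i j k : ℕ} (hij : i ≤ k) (hjk : k ≤ j)
    (hj : j < W.length) (hi' : s(W.getVert i, W.getVert (i + 1)) ∈ W'.edges)
    (hj' : s(W.getVert j, W.getVert (j + 1)) ∈ W'.edges) :
    s(W.getVert k, W.getVert (k + 1)) ∈ W'.edges := by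
  by_contra hk
  have hside := mem_side_iff_of_avoids hW k W' fun e he => by
    obtain ⟨l, hl, hle⟩ := List.getElem_of_mem (h e he)
    rw [SimpleGraph.Walk.length_edges] at hl
    rw [SimpleGraph.Walk.getElem_edges] at hle
    refine ⟨l, hl, ?_, hle.symm⟩
    rintro rfl
    exact hk (hle ▸ he)
  have h1 := hside _ (W'.fst_mem_support_of_mem_edges hi')
  have h2 := hside _ (W'.snd_mem_support_of_mem_edges hj')
  obtain ⟨l, ⟨hlk, hl⟩, hlj⟩ := h2.2 (h1.1 ⟨i, ⟨hij, by omega⟩, rfl⟩)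
  have := hW.getVert_injOn hl (show j + 1 ≤ W.length from hj) hlj
  omega

end Paths

section Pricing

variable {V : Type*} [DecidableEq V] {G : SimpleGraph V} {n : ℕ}
  {Q : Fin n → Finset (Sym2 V)} {v : Fin n → ℝ≥0}

theorem Instance.nonempty (h : Instance G Q v) (j : Fin n) : (Q j).Nonempty := by
  obtain ⟨a, b, W, -, hne, hs⟩ := (h.2 j).2
  rw [hs]
  exact List.toFinset_nonempty_iff _ |>.2 hne

theorem exists_packing_eq_OPT (Q : Fin n → Finset (Sym2 V)) (v : Fin n → ℝ≥0) :
    ∃ S : Finset (Fin n), (S : Set (Fin n)).Pairwise (fun j k => Disjoint (Q j) (Q k)) ∧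
      ∑ j ∈ S, v j = OPT Q v := by
  obtain ⟨S, hS, h⟩ := Finset.exists_mem_eq_sup (Finset.univ.powerset.filter
    fun S : Finset (Fin n) => (S : Set (Fin n)).Pairwise fun j k => Disjoint (Q j) (Q k))
    ⟨∅, by simp⟩ fun S => ∑ j ∈ S, v j
  exact ⟨S, (Finset.mem_filter.1 hS).2, h.symm⟩

variable [Fintype V]

theorem Instance.subset_edgeFinset (h : Instance G Q v) (j : Fin n) : Q j ⊆ G.edgeFinset := by
  obtain ⟨a, b, W, -, -, hs⟩ := (h.2 j).2
  intro e he
  rw [hs, List.mem_toFinset] at he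
  exact SimpleGraph.mem_edgeFinset.2 (W.edges_subset_edgeSet he)

/-- The value of any single buyer can be guaranteed. -/
theorem Instance.exists_pricing_ge_value (h : Instance G Q v) (j₀ : Fin n) :
    ∃ p : Sym2 V → ℝ≥0∞, ∀ σ : Equiv.Perm (Fin n), ∃ t : Fin n → Bool,
      v j₀ ≤ Wel G p Q v σ t := by
  obtain ⟨a, b, W, hW, -, hQW⟩ := (h.2 j₀).2
  have hlt : ∀ e ∈ Q j₀, W.edges.idxOf e < W.length := fun e he => by
    rw [hQW, List.mem_toFinset] at he
    rw [← W.length_edges]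
    exact List.idxOf_lt_length_of_mem he
  have hget : ∀ e ∈ Q j₀, s(W.getVert (W.edges.idxOf e), W.getVert (W.edges.idxOf e + 1)) = e := by
    intro e he
    rw [← SimpleGraph.Walk.getElem_edges (by rw [W.length_edges]; exact hlt e he)]
    exact List.getElem_idxOf _
  obtain ⟨q, T, hT, hTP, hge, hmax⟩ := exists_interval_prices (Q := Q) (v := v) (Q j₀)
    (fun e => W.edges.idxOf e) W.length (fun e he e' he' hee => by
      have hee' : W.edges.idxOf e = W.edges.idxOf e' := hee
      rw [← hget e he, ← hget e' he', hee']) hlt h.nonempty (by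
      intro j hj x hx y hy i hxi hiy
      obtain ⟨c, d, W', -, -, hs⟩ := (h.2 j).2
      have hmem : ∀ e, e ∈ W'.edges ↔ e ∈ Q j := fun e => by rw [hs, List.mem_toFinset]
      have hi : i < W.length := hiy.trans_lt (hlt y (hj hy))
      refine ⟨s(W.getVert i, W.getVert (i + 1)), ?_, ?_⟩
      · rw [← hmem]
        refine getVert_edge_mem_of_le_of_le hW W' (fun e he => ?_) hxi hiy (hlt y (hj hy)) ?_ ?_
        · have := hj ((hmem e).1 he)
          rwa [hQW, List.mem_toFinset] at this
        · rw [hget x (hj hx), hmem]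
          exact hx
        · rw [hget y (hj hy), hmem]
          exact hy
      · show W.edges.idxOf _ = i
        rw [← SimpleGraph.Walk.getElem_edges (by rwa [W.length_edges])]
        exact hW.isTrail.edges_nodup.idxOf_getElem i _)
  refine ⟨restrictedPrice (Q j₀) q, fun σ => ⟨fun j => decide (j ∈ T), ?_⟩⟩
  have hsold : ∀ j ∈ purchased G (restrictedPrice (Q j₀) q) Q v σ fun j => decide (j ∈ T),
      j ∈ T := by
    intro j hj
    obtain ⟨hjs, hlt | ⟨-, hjT⟩⟩ := willing_restrictedPrice.1 (willing_of_mem_purchased hj)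
    · exact absurd hlt (not_lt.2 (hge j hjs))
    · simpa using hjT
  refine (hmax j₀ subset_rfl).trans (Finset.sum_le_sum_of_subset fun i hi => ?_)
  obtain ⟨j, hj, hij⟩ := exists_purchased_of_willing (G := G) σ
    (willing_restrictedPrice (t := fun j => decide (j ∈ T)) |>.2
      ⟨(hTP i hi).1, Or.inr ⟨(hTP i hi).2, by simpa using hi⟩⟩)
    (h.subset_edgeFinset i) (h.nonempty i)
  by_cases hji : j = i
  · exact hji ▸ hj
  · exact absurd (hT (hsold j hj) hi hji) hij

theorem sum_load {ι α : Type*} [DecidableEq α] (Q : ι → Finset α) (M : Finset ι) (w : ι → ℝ)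
    (s : Finset α) :
    ∑ e ∈ s, ∑ i ∈ M, (if e ∈ Q i then w i else 0) = ∑ i ∈ M, ((s ∩ Q i).card : ℝ) * w i := by
  rw [Finset.sum_comm]
  refine Finset.sum_congr rfl fun i _ => ?_
  rw [← Finset.sum_filter, Finset.sum_const, Finset.filter_mem_eq_inter, nsmul_eq_mul]

/-- A packing of total value `W` by demands of size at most `D` yields welfare `W / (2D)`. -/
theorem Instance.exists_pricing_of_short (h : Instance G Q v) {D : ℕ} (hD : 0 < D)
    {M : Finset (Fin n)} (hM : (M : Set (Fin n)).Pairwise fun i j => Disjoint (Q i) (Q j))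
    (hMD : ∀ i ∈ M, (Q i).card ≤ D) :
    ∃ p : Sym2 V → ℝ≥0∞, ∀ (σ : Equiv.Perm (Fin n)) (t : Fin n → Bool),
      (∑ i ∈ M, (v i : ℝ)) / (2 * D) ≤ Wel G p Q v σ t := by
  have hD' : (0 : ℝ) < D := by exact_mod_cast hD
  set q : Sym2 V → ℝ≥0 := fun e => ∑ i ∈ M, if e ∈ Q i then v i / (2 * D) else 0 with hq
  have hqsum : ∀ s, ((∑ e ∈ s, q e : ℝ≥0) : ℝ) =
      ∑ i ∈ M, ((s ∩ Q i).card : ℝ) * (v i / (2 * D)) := fun s => by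
    rw [← sum_load]
    push_cast [hq]
    refine Finset.sum_congr rfl fun e _ => Finset.sum_congr rfl fun i _ => ?_
    split_ifs <;> simp
  refine ⟨restrictedPrice (M.biUnion Q) q, fun σ t => ?_⟩
  set A := purchased G (restrictedPrice (M.biUnion Q) q) Q v σ t
  have hcov : ∀ i ∈ M, ∃ j ∈ A, ¬Disjoint (Q j) (Q i) := by
    intro i hi
    refine exists_purchased_of_willing σ (willing_restrictedPrice.2
      ⟨Finset.subset_biUnion_of_mem Q hi, Or.inl ?_⟩) (h.subset_edgeFinset i) (h.nonempty i)
    rw [← NNReal.coe_lt_coe, hqsum, Finset.sum_eq_single_of_mem i hi fun j hj hji => by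
      rw [Finset.disjoint_iff_inter_eq_empty.1 (hM hi hj hji.symm)]; simp, Finset.inter_self]
    have hv : (0 : ℝ) < v i := (h.2 i).1
    have hc : ((Q i).card : ℝ) ≤ D := by exact_mod_cast hMD i hi
    rw [← mul_div_assoc, div_lt_iff₀ (by positivity)]
    nlinarith
  have hle : ∀ j ∈ A, (∑ i ∈ M with ¬Disjoint (Q j) (Q i), (v i : ℝ)) / (2 * D) ≤ v j := by
    intro j hj
    have hpay : ∑ e ∈ Q j, q e ≤ v j := by
      rcases (willing_restrictedPrice.1 (willing_of_mem_purchased hj)).2 with h1 | h1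
      exacts [h1.le, h1.1.le]
    rw [← NNReal.coe_le_coe, hqsum] at hpay
    refine le_trans ?_ hpay
    rw [Finset.sum_div]
    refine le_trans (Finset.sum_le_sum fun i hi => ?_)
      (Finset.sum_le_sum_of_subset_of_nonneg (Finset.filter_subset _ M) fun i _ _ => by positivity)
    have : (1 : ℝ) ≤ (Q j ∩ Q i).card := by
      exact_mod_cast Finset.card_pos.2
        (Finset.not_disjoint_iff_nonempty_inter.1 (Finset.mem_filter.1 hi).2)
    exact le_mul_of_one_le_left (by positivity) this
  have hsum := sum_le_sum_sum_filter v hcov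
  rw [← NNReal.coe_le_coe] at hsum
  push_cast at hsum
  calc (∑ i ∈ M, (v i : ℝ)) / (2 * D)
      ≤ (∑ j ∈ A, ∑ i ∈ M with ¬Disjoint (Q j) (Q i), (v i : ℝ)) / (2 * D) := by gcongr
    _ ≤ ∑ j ∈ A, (v j : ℝ) := by
        rw [Finset.sum_div]
        exact Finset.sum_le_sum hle
    _ = Wel G _ Q v σ t := by rw [Wel, NNReal.coe_sum]

/-- Pricing for a packing `R` of demands of size at most `ℓ` and value at least `θ`, when every
demand inside the union of `R` meets at most `c` members of `R`. -/
theorem Instance.exists_pricing_of_touch_le (h : Instance G Q v) {R : Finset (Fin n)}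
    (hR : (R : Set (Fin n)).Pairwise fun i j => Disjoint (Q i) (Q j))
    {θ ℓ : ℝ≥0} (hθ : 0 < θ) (hℓ : 0 < ℓ) (hRθ : ∀ i ∈ R, θ ≤ v i)
    (hRℓ : ∀ i ∈ R, ((Q i).card : ℝ≥0) ≤ ℓ) {c D : ℕ} (hc : 0 < c) (hD : 0 < D)
    (htouch : ∀ j, Q j ⊆ R.biUnion Q → (R.filter fun i => ¬Disjoint (Q j) (Q i)).card ≤ c) :
    ∃ p : Sym2 V → ℝ≥0∞, ∀ (σ : Equiv.Perm (Fin n)) (t : Fin n → Bool),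
      min ((R.card * θ * D / (8 * c * ℓ) : ℝ)) (R.card * θ / (8 * D ^ 2)) ≤ Wel G p Q v σ t := by
  have hD' : (0 : ℝ) < D := by exact_mod_cast hD
  have hc' : (0 : ℝ) < c := by exact_mod_cast hc
  have hθ' : (0 : ℝ) < θ := hθ
  have hℓ' : (0 : ℝ) < ℓ := hℓ
  obtain ⟨M, hMB, hM, hcov⟩ := exists_greedy_packing Q v h.nonempty
    (Finset.univ.filter fun j => Q j ⊆ R.biUnion Q ∧ (Q j).card ≤ D)
  have hMD : ∀ i ∈ M, (Q i).card ≤ D := fun i hi => (Finset.mem_filter.1 (hMB hi)).2.2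
  by_cases hcase : (R.card * θ / (4 * D) : ℝ) ≤ ∑ i ∈ M, (v i : ℝ)
  · obtain ⟨p, hp⟩ := h.exists_pricing_of_short hD hM hMD
    refine ⟨p, fun σ t => (min_le_right _ _).trans (le_trans ?_ (hp σ t))⟩
    calc (R.card * θ / (8 * D ^ 2) : ℝ) = (R.card * θ / (4 * D)) / (2 * D) := by
          field_simp; ring
      _ ≤ _ := by gcongr
  rw [not_le, lt_div_iff₀ (by positivity)] at hcase
  set α : ℝ≥0 := θ / (4 * ℓ) with hα
  have hα' : (0 : ℝ) < α := by rw [hα]; push_cast; positivity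
  have hαℓ : (α : ℝ) * ℓ = θ / 4 := by rw [hα]; push_cast; field_simp
  set U := R.biUnion Q with hU
  set q : Sym2 V → ℝ≥0 := fun e => α + ∑ i ∈ M, if e ∈ Q i then v i else 0 with hq
  have hqsum : ∀ s, ((∑ e ∈ s, q e : ℝ≥0) : ℝ) =
      s.card * α + ∑ i ∈ M, ((s ∩ Q i).card : ℝ) * v i := fun s => by
    rw [← sum_load, hq, Finset.sum_add_distrib, Finset.sum_const, nsmul_eq_mul]
    push_cast
    congr 1
    refine Finset.sum_congr rfl fun e _ => Finset.sum_congr rfl fun i _ => ?_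
    split_ifs <;> simp
  have hUcard : (U.card : ℝ) ≤ R.card * ℓ := by
    calc (U.card : ℝ) ≤ ∑ i ∈ R, ((Q i).card : ℝ) := by
          exact_mod_cast Finset.card_biUnion_le
      _ ≤ ∑ _i ∈ R, (ℓ : ℝ) := Finset.sum_le_sum fun i hi => by exact_mod_cast hRℓ i hi
      _ = R.card * ℓ := by simp
  have htotal : ((∑ e ∈ U, q e : ℝ≥0) : ℝ) ≤ R.card * θ / 2 := by
    rw [hqsum]
    have h1 : (U.card : ℝ) * α ≤ R.card * θ / 4 := by
      calc (U.card : ℝ) * α ≤ R.card * ℓ * α := by gcongr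
        _ = R.card * (α * ℓ) := by ring
        _ = _ := by rw [hαℓ]; ring
    have h2 : ∑ i ∈ M, ((U ∩ Q i).card : ℝ) * v i ≤ D * ∑ i ∈ M, (v i : ℝ) := by
      rw [Finset.mul_sum]
      refine Finset.sum_le_sum fun i hi => ?_
      gcongr
      exact (Finset.card_le_card Finset.inter_subset_right).trans (hMD i hi)
    linarith
  set R' := R.filter fun i => ∑ e ∈ Q i, q e < v i with hR'
  have hR'card : (R.card : ℝ) / 2 ≤ R'.card := by
    have h1 : ((R \ R').card : ℝ) * θ ≤ R.card * θ / 2 := by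
      refine le_trans ?_ htotal
      have hsub : ∑ i ∈ R \ R', ∑ e ∈ Q i, q e ≤ ∑ e ∈ U, q e := by
        rw [hU, Finset.sum_biUnion hR]
        exact Finset.sum_le_sum_of_subset Finset.sdiff_subset
      refine le_trans ?_ (NNReal.coe_le_coe.2 hsub)
      have : ∑ _i ∈ R \ R', θ ≤ ∑ i ∈ R \ R', ∑ e ∈ Q i, q e := by
        refine Finset.sum_le_sum fun i hi => ?_
        obtain ⟨hiR, hi'⟩ := Finset.mem_sdiff.1 hi
        by_contra! hlt
        exact hi' (Finset.mem_filter.2 ⟨hiR, hlt.trans_le (hRθ i hiR)⟩)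
      rw [Finset.sum_const, nsmul_eq_mul] at this
      exact_mod_cast this
    have h2 : ((R \ R').card : ℝ) + R'.card = R.card := by
      exact_mod_cast Finset.card_sdiff_add_card_eq_card (Finset.filter_subset _ R)
    nlinarith
  refine ⟨restrictedPrice U q, fun σ t => (min_le_left _ _).trans ?_⟩
  set A := purchased G (restrictedPrice U q) Q v σ t
  have hpay : ∀ j ∈ A, Q j ⊆ U ∧ ((∑ e ∈ Q j, q e : ℝ≥0) : ℝ) ≤ v j := by
    intro j hj
    obtain ⟨hjU, h1⟩ := willing_restrictedPrice.1 (willing_of_mem_purchased hj)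
    refine ⟨hjU, NNReal.coe_le_coe.2 ?_⟩
    rcases h1 with h1 | h1
    exacts [h1.le, h1.1.le]
  have hlong : ∀ j ∈ A, (D : ℝ) * α ≤ v j := by
    intro j hj
    obtain ⟨hjU, hjv⟩ := hpay j hj
    rw [hqsum] at hjv
    have hjcard : (0 : ℝ) < (Q j).card := by exact_mod_cast Finset.card_pos.2 (h.nonempty j)
    have hDj : D < (Q j).card := by
      by_contra! hshort
      obtain ⟨i, hi, hij, hv⟩ := hcov j
        (Finset.mem_filter.2 ⟨Finset.mem_univ j, hjU, hshort⟩)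
      have h1 : (1 : ℝ) ≤ (Q j ∩ Q i).card := by
        exact_mod_cast Finset.card_pos.2
          (Finset.not_disjoint_iff_nonempty_inter.1 fun hd => hij hd.symm)
      have h2 : ((Q j ∩ Q i).card : ℝ) * v i ≤ ∑ i ∈ M, ((Q j ∩ Q i).card : ℝ) * v i :=
        Finset.single_le_sum (f := fun i => ((Q j ∩ Q i).card : ℝ) * v i)
          (fun i _ => by positivity) hi
      have h3 : (v j : ℝ) ≤ v i := hv
      have h4 : (v i : ℝ) ≤ (Q j ∩ Q i).card * v i := le_mul_of_one_le_left (by positivity) h1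
      have h5 : 0 < ((Q j).card : ℝ) * α := mul_pos hjcard hα'
      linarith
    have h1 : (0 : ℝ) ≤ ∑ i ∈ M, ((Q j ∩ Q i).card : ℝ) * v i :=
      Finset.sum_nonneg fun i _ => by positivity
    have h2 : (D : ℝ) * α ≤ (Q j).card * α := by gcongr
    linarith
  have hblock : R'.card ≤ A.card * c := by
    have hcov' : R' ⊆ A.biUnion fun j => R.filter fun i => ¬Disjoint (Q j) (Q i) := by
      intro i hi
      obtain ⟨hiR, hiq⟩ := Finset.mem_filter.1 hi
      obtain ⟨j, hj, hji⟩ := exists_purchased_of_willing (G := G) (t := t) σ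
        (willing_restrictedPrice.2 ⟨Finset.subset_biUnion_of_mem Q hiR, Or.inl hiq⟩)
        (h.subset_edgeFinset i) (h.nonempty i)
      exact Finset.mem_biUnion.2 ⟨j, hj, Finset.mem_filter.2 ⟨hiR, hji⟩⟩
    exact (Finset.card_le_card hcov').trans
      (Finset.card_biUnion_le_card_mul _ _ _ fun j hj => htouch j (hpay j hj).1)
  have hblock' : (R'.card : ℝ) ≤ A.card * c := by exact_mod_cast hblock
  calc (R.card * θ * D / (8 * c * ℓ) : ℝ) = (R.card / 2) / c * (D * α) := by
        rw [hα]; push_cast; field_simp; ring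
    _ ≤ A.card * (D * α) := by
        gcongr
        rw [div_le_iff₀ hc']
        exact hR'card.trans hblock'
    _ = ∑ _j ∈ A, (D * α : ℝ) := by simp
    _ ≤ ∑ j ∈ A, (v j : ℝ) := Finset.sum_le_sum hlong
    _ = Wel G _ Q v σ t := by rw [Wel, NNReal.coe_sum]

/-- Pricing for a packing `T` of `k` demands with values at least `θ`. -/
theorem Instance.exists_pricing_of_packing (h : Instance G Q v) (hn : 2 ≤ n)
    {T : Finset (Fin n)} (hT : (T : Set (Fin n)).Pairwise fun i j => Disjoint (Q i) (Q j))
    (hTne : T.Nonempty) {θ : ℝ≥0} (hθ : 0 < θ) (hTθ : ∀ i ∈ T, θ ≤ v i)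
    {x : ℝ} (hx : 1 ≤ x) (hm : (G.edgeFinset.card : ℝ) = x ^ 5) :
    ∃ p : Sym2 V → ℝ≥0∞, ∀ σ : Equiv.Perm (Fin n), ∃ t : Fin n → Bool,
      T.card * θ / (128 * x ^ 2 * Real.logb 2 n) ≤ Wel G p Q v σ t := by
  have hlog : 1 ≤ Real.logb 2 n := by
    rw [Real.le_logb_iff_rpow_le one_lt_two (by positivity)]
    simpa using hn
  have hθ' : (0 : ℝ) < θ := hθ
  have hk : (0 : ℝ) < T.card := by exact_mod_cast hTne.card_pos
  have hx0 : 0 < x := by linarith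
  by_cases hkx : (T.card : ℝ) ≤ x ^ 2
  · obtain ⟨j₀, hj₀⟩ := hTne
    obtain ⟨p, hp⟩ := h.exists_pricing_ge_value j₀
    refine ⟨p, fun σ => (hp σ).imp fun t ht => ?_⟩
    have h1 : (θ : ℝ) ≤ Wel G p Q v σ t := NNReal.coe_le_coe.2 ((hTθ j₀ hj₀).trans ht)
    refine le_trans ?_ h1
    rw [div_le_iff₀ (by positivity)]
    have : x ^ 2 * 1 ≤ 128 * x ^ 2 * Real.logb 2 n := by
      gcongr
      linarith
    nlinarith
  rw [not_le] at hkx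
  set m := G.edgeFinset.card
  set ℓ : ℝ≥0 := 2 * m / T.card with hℓdef
  have hm0 : (0 : ℝ) < m := by rw [hm]; positivity
  have hℓ0 : 0 < ℓ := by
    rw [← NNReal.coe_pos, hℓdef]; push_cast; positivity
  have hℓ : (ℓ : ℝ) * T.card = 2 * m := by
    rw [hℓdef]; push_cast; field_simp
  set T' := T.filter fun i => ((Q i).card : ℝ≥0) ≤ ℓ with hT'
  have hT'card : T.card ≤ 2 * T'.card := by
    have h1 : (((T \ T').card : ℕ) : ℝ) * ℓ ≤ m := by
      have h2 : ∑ i ∈ T \ T', (Q i).card ≤ m := by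
        rw [← Finset.card_biUnion fun i hi j hj hij =>
          hT (Finset.sdiff_subset hi) (Finset.sdiff_subset hj) hij]
        exact Finset.card_le_card (Finset.biUnion_subset.2 fun i _ => h.subset_edgeFinset i)
      calc (((T \ T').card : ℕ) : ℝ) * ℓ = ∑ _i ∈ T \ T', (ℓ : ℝ) := by simp
        _ ≤ ∑ i ∈ T \ T', ((Q i).card : ℝ) := Finset.sum_le_sum fun i hi => by
            obtain ⟨hiT, hi'⟩ := Finset.mem_sdiff.1 hi
            by_contra! hlt
            exact hi' (Finset.mem_filter.2 ⟨hiT, by exact_mod_cast hlt.le⟩)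
        _ ≤ m := by exact_mod_cast h2
    have h3 : ((T \ T').card : ℝ) + T'.card = T.card := by
      exact_mod_cast Finset.card_sdiff_add_card_eq_card (Finset.filter_subset _ T)
    have h4 : (T.card : ℝ) ≤ 2 * T'.card := by
      have h5 : 2 * ((T \ T').card : ℝ) * ℓ ≤ T.card * ℓ := by linarith
      have h6 := le_of_mul_le_mul_right h5 (NNReal.coe_pos.2 hℓ0)
      linarith
    exact_mod_cast h4
  obtain ⟨R, hRT, hRcard, htouch⟩ := exists_large_subset_avoiding T' fun j : Fin n =>
    T'.filter fun i => ¬Disjoint (Q j) (Q i)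
  have hR4 : (T.card : ℝ) ≤ 4 * R.card := by
    have : T.card ≤ 4 * R.card := by omega
    exact_mod_cast this
  have hT'pw : (T' : Set (Fin n)).Pairwise fun i j => Disjoint (Q i) (Q j) :=
    hT.mono (Finset.coe_subset.2 (Finset.filter_subset _ _))
  set c := Nat.log 2 n + 1 with hc
  have hcle : (c : ℝ) ≤ 2 * Real.logb 2 n := by
    have : ((Nat.log 2 n : ℕ) : ℝ) ≤ Real.logb 2 n := by
      simpa using Real.natLog_le_logb n 2
    rw [hc]; push_cast; linarith
  set D := ⌈x⌉₊
  have hxD : x ≤ D := Nat.le_ceil x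
  have hDx : (D : ℝ) ≤ 2 * x := by
    have := Nat.ceil_lt_add_one hx0.le
    linarith
  obtain ⟨p, hp⟩ := h.exists_pricing_of_touch_le (R := R) (θ := θ) (ℓ := ℓ) (c := c) (D := D)
    (hT'pw.mono (Finset.coe_subset.2 hRT)) hθ hℓ0
    (fun i hi => hTθ i (Finset.filter_subset _ _ (hRT hi)))
    (fun i hi => (Finset.mem_filter.1 (hRT hi)).2) (Nat.succ_pos _) (Nat.ceil_pos.2 hx0) (by
      intro j hj
      refine (Finset.card_le_card (Finset.filter_subset_filter _ hRT)).trans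
        (htouch j fun i hi => ?_)
      obtain ⟨hiT, hji⟩ := Finset.mem_filter.1 hi
      obtain ⟨e, hej, hei⟩ := Finset.not_disjoint_iff.1 hji
      obtain ⟨i', hi'R, hei'⟩ := Finset.mem_biUnion.1 (hj hej)
      by_cases hii : i = i'
      · exact hii ▸ hi'R
      · exact absurd hei' (Finset.disjoint_left.1 (hT'pw hiT (hRT hi'R) hii) hei))
  refine ⟨p, fun σ => ⟨fun _ => true, le_trans (le_min ?_ ?_) (hp σ _)⟩⟩
  · have hc0 : (0 : ℝ) < c := by rw [hc]; positivity
    have hℓ0' : (0 : ℝ) < ℓ := hℓ0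
    have e1 : (R.card * θ * D / (8 * c * ℓ) : ℝ) = R.card * θ * D * T.card / (16 * c * x ^ 5) := by
      rw [← hm, div_eq_div_iff (by positivity) (by positivity)]
      linear_combination (-8 * R.card * θ * D * c : ℝ) * hℓ
    rw [e1]
    calc (T.card * θ / (128 * x ^ 2 * Real.logb 2 n) : ℝ)
        = (T.card / 4) * θ * x * x ^ 2 / (16 * (2 * Real.logb 2 n) * x ^ 5) := by
          field_simp; ring
      _ ≤ R.card * θ * D * T.card / (16 * c * x ^ 5) := by
          have : (T.card : ℝ) / 4 ≤ R.card := by linarith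
          gcongr
  · have hD0 : (0 : ℝ) < D := hx0.trans_le hxD
    calc (T.card * θ / (128 * x ^ 2 * Real.logb 2 n) : ℝ)
        ≤ T.card * θ / (128 * x ^ 2 * 1) := by gcongr
      _ = (T.card / 4) * θ / (8 * (2 * x) ^ 2) := by field_simp; ring
      _ ≤ R.card * θ / (8 * D ^ 2) := by
          have : (T.card : ℝ) / 4 ≤ R.card := by linarith
          gcongr

/-- Some packing of buyers with values at least `θ` has `OPT ≤ 2 log₂ m · (size) · θ`. -/
theorem Instance.exists_threshold_packing (h : Instance G Q v) (hm : 2 ≤ G.edgeFinset.card) :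
    ∃ (T : Finset (Fin n)) (θ : ℝ≥0),
      (T : Set (Fin n)).Pairwise (fun j k => Disjoint (Q j) (Q k)) ∧ T.Nonempty ∧ 0 < θ ∧
      (∀ i ∈ T, θ ≤ v i) ∧
      (OPT Q v : ℝ) ≤ 2 * Real.logb 2 G.edgeFinset.card * (T.card * θ) := by
  obtain ⟨S, hS, hSv⟩ := exists_packing_eq_OPT Q v
  have hlog : 1 ≤ Real.logb 2 G.edgeFinset.card := by
    rw [Real.le_logb_iff_rpow_le one_lt_two (by positivity)]
    simpa using hm
  rcases S.eq_empty_or_nonempty with rfl | hSne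
  · refine ⟨{⟨0, h.1⟩}, v ⟨0, h.1⟩, by simp, by simp, (h.2 _).1, by simp, ?_⟩
    rw [← hSv]
    simp only [Finset.sum_empty, NNReal.coe_zero]
    positivity
  obtain ⟨a, ha, hmax⟩ := S.exists_max_image
    (fun i => (v i : ℝ) * (S.filter fun j => v i ≤ v j).card) hSne
  refine ⟨S.filter fun j => v a ≤ v j, v a,
    hS.mono (Finset.coe_subset.2 (Finset.filter_subset _ _)),
    ⟨a, Finset.mem_filter.2 ⟨ha, le_rfl⟩⟩, (h.2 a).1, fun i hi => (Finset.mem_filter.1 hi).2, ?_⟩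
  have hScard : S.card ≤ G.edgeFinset.card := by
    calc S.card ≤ (S.biUnion Q).card := Finset.card_le_card_biUnion hS fun i _ => h.nonempty i
      _ ≤ _ := Finset.card_le_card (Finset.biUnion_subset.2 fun i _ => h.subset_edgeFinset i)
  have hharm : (harmonic S.card : ℝ) ≤ 2 * Real.logb 2 G.edgeFinset.card := by
    have hS1 : (1 : ℝ) ≤ S.card := by exact_mod_cast hSne.card_pos
    have hm0 : (1 : ℝ) < G.edgeFinset.card := by exact_mod_cast hm
    have h1 : Real.log S.card ≤ Real.log G.edgeFinset.card :=
      Real.log_le_log (by linarith) (by exact_mod_cast hScard)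
    have h2 : Real.log G.edgeFinset.card ≤ Real.logb 2 G.edgeFinset.card := by
      rw [Real.logb, le_div_iff₀ (Real.log_pos one_lt_two)]
      have := Real.log_two_lt_d9
      have := Real.log_pos hm0
      nlinarith
    have := harmonic_le_one_add_log S.card
    linarith
  have := sum_le_harmonic_mul S v _ hmax
  rw [← hSv]
  push_cast
  refine this.trans ?_
  rw [mul_comm (v a : ℝ)]
  gcongr

end Pricing

end Tollbooth

/-- There is a constant `C > 0` such that for every tollbooth instance on
a graph with `m ≥ 2` edges and `n ≥ 2` buyers there is an item pricing whose worst-case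
welfare (with seller tie-breaking) is at least `OPT / (C · m^{2/5} · (log₂ m)² · log₂ n)`. -/
theorem general_graph_upper_bound :
    ∃ C : ℝ, 0 < C ∧
      ∀ (V : Type) [Fintype V] [DecidableEq V] (G : SimpleGraph V) (n : ℕ)
        (Q : Fin n → Finset (Sym2 V)) (v : Fin n → ℝ≥0),
        Tollbooth.Instance G Q v → 2 ≤ G.edgeFinset.card → 2 ≤ n →
          ∃ p : Sym2 V → ℝ≥0∞, ∀ σ : Equiv.Perm (Fin n), ∃ t : Fin n → Bool,
            (Tollbooth.OPT Q v : ℝ) /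
                (C * (G.edgeFinset.card : ℝ) ^ ((2 : ℝ) / 5) *
                  (Real.logb 2 (G.edgeFinset.card : ℝ)) ^ 2 * Real.logb 2 (n : ℝ)) ≤
              (Tollbooth.Wel G p Q v σ t : ℝ) := by
  refine ⟨256, by norm_num, fun V _ _ G n Q v h hm hn => ?_⟩
  obtain ⟨T, θ, hT, hTne, hθ, hTθ, hOPT⟩ := h.exists_threshold_packing hm
  have hm1 : (1 : ℝ) ≤ G.edgeFinset.card := by exact_mod_cast one_le_two.trans hm
  obtain ⟨m, hmdef⟩ : ∃ m : ℝ, m = G.edgeFinset.card := ⟨_, rfl⟩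
  rw [← hmdef] at hm1 hOPT ⊢
  have hm0 : 0 ≤ m := by linarith
  obtain ⟨x, hx⟩ : ∃ x : ℝ, x = m ^ ((1 : ℝ) / 5) := ⟨_, rfl⟩
  have hx5 : m = x ^ 5 := by
    rw [hx, ← Real.rpow_natCast, ← Real.rpow_mul hm0]
    norm_num
  have hx2 : m ^ ((2 : ℝ) / 5) = x ^ 2 := by
    rw [hx, ← Real.rpow_natCast, ← Real.rpow_mul hm0]
    norm_num
  have hx1 : 1 ≤ x := hx ▸ Real.one_le_rpow hm1 (by norm_num)
  obtain ⟨p, hp⟩ := h.exists_pricing_of_packing hn hT hTne hθ hTθ hx1 (hmdef ▸ hx5)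
  refine ⟨p, fun σ => (hp σ).imp fun t ht => le_trans ?_ ht⟩
  have hlogm : 1 ≤ Real.logb 2 m := by
    rw [Real.le_logb_iff_rpow_le one_lt_two (by linarith), Real.rpow_one, hmdef]
    exact_mod_cast hm
  have hlogn : 1 ≤ Real.logb 2 n := by
    rw [Real.le_logb_iff_rpow_le one_lt_two (by positivity)]
    simpa using hn
  clear hx5 hx hmdef
  rw [hx2, div_le_div_iff₀ (by positivity) (by positivity)]
  calc (Tollbooth.OPT Q v : ℝ) * (128 * x ^ 2 * Real.logb 2 n)
      ≤ 2 * Real.logb 2 m * (T.card * θ) * (128 * x ^ 2 * Real.logb 2 n) := by gcongr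
    _ = T.card * θ * (256 * x ^ 2 * Real.logb 2 m * Real.logb 2 n) := by ring
    _ ≤ T.card * θ * (256 * x ^ 2 * Real.logb 2 m ^ 2 * Real.logb 2 n) := by
        have : Real.logb 2 m ≤ Real.logb 2 m ^ 2 := le_self_pow₀ hlogm two_ne_zero
        gcongr
end
end

section
/- There exists a constant c > 0 such that for every M there is a tollbooth instance on a finite simple graph G with m ≥ M edges for which every item pricing p admits an arrival order σ with max over tie-breaking choices t of Wel(p,σ,t) at most c · m^{-1/8} · OPT. (There exist tollbooth instances on which the competitive ratio of item pricing with seller tie-breaking power is Ω(m^{1/8}).) -/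
open scoped Classical NNReal ENNReal

noncomputable section

namespace Tollbooth

section SellingProcedure

variable {V : Type*} [DecidableEq V] {n : ℕ}
  {p : Sym2 V → ℝ≥0∞} {Q : Fin n → Finset (Sym2 V)} {v : Fin n → ℝ≥0} {t : Fin n → Bool}

/-- The selling process never forgets a purchase. -/
lemma subset_foldl_step (l : List (Fin n)) (st : Finset (Sym2 V) × Finset (Fin n)) :
    st.2 ⊆ (l.foldl (step p Q v t) st).2 := by
  induction l generalizing st with
  | nil => exact subset_rfl
  | cons j l ih =>
    refine subset_trans ?_ (ih _)
    unfold step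
    split_ifs
    · exact Finset.subset_insert _ _
    · exact subset_rfl

/-- The selling process only lets arriving buyers purchase. -/
lemma mem_of_mem_foldl_step {l : List (Fin n)} {E : Finset (Sym2 V)} {j : Fin n}
    (hj : j ∈ (l.foldl (step p Q v t) (E, ∅)).2) : j ∈ l := by
  induction l using List.reverseRecOn with
  | nil => simp at hj
  | append_singleton l i ih =>
    rw [List.foldl_append, List.foldl_cons, List.foldl_nil, step] at hj
    split_ifs at hj with h
    · rcases Finset.mem_insert.1 hj with rfl | hj
      · simp
      · exact List.mem_append_left _ (ih hj)
    · exact List.mem_append_left _ (ih hj)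

lemma price_le_of_mem_foldl_step {l : List (Fin n)} {E : Finset (Sym2 V)} {j : Fin n}
    (hj : j ∈ (l.foldl (step p Q v t) (E, ∅)).2) : price p (Q j) ≤ v j := by
  induction l using List.reverseRecOn with
  | nil => simp at hj
  | append_singleton l i ih =>
    rw [List.foldl_append, List.foldl_cons, List.foldl_nil, step] at hj
    split_ifs at hj with h
    · rcases Finset.mem_insert.1 hj with rfl | hj
      · exact h.2.elim le_of_lt fun h => h.1.le
      · exact ih hj
    · exact ih hj

lemma mem_foldl_step_fst (l : List (Fin n)) (E : Finset (Sym2 V)) (e : Sym2 V) :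
    e ∈ (l.foldl (step p Q v t) (E, ∅)).1 ↔
      e ∈ E ∧ ∀ j ∈ (l.foldl (step p Q v t) (E, ∅)).2, e ∉ Q j := by
  induction l using List.reverseRecOn with
  | nil => simp
  | append_singleton l i ih =>
    rw [List.foldl_append, List.foldl_cons, List.foldl_nil, step]
    split_ifs with h
    · simp only [Finset.mem_sdiff, ih, Finset.forall_mem_insert]
      tauto
    · exact ih

/-- Purchased demand sets are pairwise disjoint. -/
lemma pairwise_disjoint_foldl_step (l : List (Fin n)) (E : Finset (Sym2 V)) :
    ((l.foldl (step p Q v t) (E, ∅)).2 : Set (Fin n)).Pairwise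
      fun j k => Disjoint (Q j) (Q k) := by
  induction l using List.reverseRecOn with
  | nil => simp
  | append_singleton l i ih =>
    rw [List.foldl_append, List.foldl_cons, List.foldl_nil, step]
    split_ifs with h
    · rw [Finset.coe_insert]
      refine ih.insert fun j hj _ => ?_
      have hd : Disjoint (Q i) (Q j) := Finset.disjoint_left.2 fun e he =>
        ((mem_foldl_step_fst l E e).1 (h.1 he)).2 j hj
      exact ⟨hd, hd.symm⟩
    · exact ih

/-- A buyer who strictly prefers to buy either buys or is blocked by a buyer who has bought. -/
lemma exists_mem_foldl_step {l : List (Fin n)} {E : Finset (Sym2 V)} {j : Fin n}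
    (hj : j ∈ l) (hE : Q j ⊆ E) (hQ : (Q j).Nonempty) (hp : price p (Q j) < v j) :
    ∃ i ∈ (l.foldl (step p Q v t) (E, ∅)).2, ¬ Disjoint (Q i) (Q j) := by
  obtain ⟨l₁, l₂, rfl⟩ := List.append_of_mem hj
  rw [List.foldl_append, List.foldl_cons]
  set st := l₁.foldl (step p Q v t) (E, ∅) with hst
  suffices h : ∃ i ∈ (step p Q v t st j).2, ¬ Disjoint (Q i) (Q j) by
    obtain ⟨i, hi, h⟩ := h
    exact ⟨i, subset_foldl_step _ _ hi, h⟩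
  by_cases h : Q j ⊆ st.1
  · refine ⟨j, ?_, by simpa using hQ.ne_empty⟩
    rw [step, if_pos ⟨h, Or.inl hp⟩]
    exact Finset.mem_insert_self _ _
  · obtain ⟨e, he, hne⟩ := Finset.not_subset.1 h
    rw [hst, mem_foldl_step_fst, ← hst] at hne
    push Not at hne
    obtain ⟨i, hi, hei⟩ := hne (hE he)
    refine ⟨i, ?_, Finset.not_disjoint_iff.2 ⟨e, hei, he⟩⟩
    rw [step, if_neg fun h' => h h'.1]
    exact hi

end SellingProcedure

/-- If any two affordable demand sets `A i`, `A j` of value `1` together contain an affordable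
demand set `B b` of value `w`, and the sets `B b` fall into `k * k` intersecting families, then
letting the buyers of the sets `B b` arrive first leaves only little welfare. -/
lemma wel_append_le {V : Type*} [Fintype V] [DecidableEq V] {G : SimpleGraph V}
    {p : Sym2 V → ℝ≥0∞} {l k : ℕ} {A : Fin k → Finset (Sym2 V)} {B : Fin l → Finset (Sym2 V)}
    {w : ℝ≥0} (κ : Fin l → Fin k × Fin k) (hBG : ∀ b, B b ⊆ G.edgeFinset)
    (hκ : ∀ b c, κ b = κ c → ¬ Disjoint (B b) (B c))
    (hcheap : ∀ i j, i < j → price p (A i) ≤ 1 → price p (A j) ≤ 1 →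
      ∃ b, B b ⊆ A i ∪ A j ∧ price p (B b) < w) (t : Fin (l + k) → Bool) :
    Wel G p (Fin.append B A) (Fin.append (fun _ => w) (fun _ => 1)) 1 t ≤ k * k * w + 1 := by
  set Q := Fin.append B A with hQ
  set v : Fin (l + k) → ℝ≥0 := Fin.append (fun _ => w) (fun _ => 1) with hv
  set l₁ : List (Fin (l + k)) := List.ofFn fun b : Fin l => Fin.castAdd k b with hl₁
  set l₂ : List (Fin (l + k)) := List.ofFn fun i : Fin k => Fin.natAdd l i with hl₂
  set S := purchased G p Q v 1 t with hS
  have hS' : S = ((l₁ ++ l₂).foldl (step p Q v t) (G.edgeFinset, ∅)).2 := by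
    rw [hS, purchased, List.ofFn_add]
    rfl
  have hdisj : (S : Set (Fin (l + k))).Pairwise fun j k => Disjoint (Q j) (Q k) := by
    rw [hS']; exact pairwise_disjoint_foldl_step _ _
  have hsum : Wel G p Q v 1 t =
      ((Finset.univ.filter fun b => Fin.castAdd k b ∈ S).card : ℝ≥0) * w +
        ((Finset.univ.filter fun i => Fin.natAdd l i ∈ S).card : ℝ≥0) := by
    rw [Wel, ← hS, ← Finset.filter_univ_mem S, Finset.sum_filter, Fin.sum_univ_add]
    simp [hv, ← Finset.sum_filter]
  have hBcard : (Finset.univ.filter fun b => Fin.castAdd k b ∈ S).card ≤ k * k := by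
    calc _ ≤ (Finset.univ : Finset (Fin k × Fin k)).card := by
          refine Finset.card_le_card_of_injOn κ (fun _ _ => Finset.mem_coe.2 (Finset.mem_univ _)) ?_
          intro b hb c hc hbc
          by_contra hne
          refine hκ b c hbc ?_
          have := hdisj (by simpa using hb) (by simpa using hc)
            (fun h => hne (Fin.castAdd_injective _ _ h))
          simpa [hQ] using this
      _ = k * k := by simp
  have hA : ∀ i j, i < j → Fin.natAdd l i ∈ S → Fin.natAdd l j ∈ S → False := by
    intro i j hij hi hj
    have hpi := price_le_of_mem_foldl_step (hS' ▸ hi)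
    have hpj := price_le_of_mem_foldl_step (hS' ▸ hj)
    simp only [hQ, hv, Fin.append_right, ENNReal.coe_one] at hpi hpj
    obtain ⟨b, hb, hlt⟩ := hcheap i j hij hpi hpj
    obtain ⟨c, hc, hcb⟩ := exists_mem_foldl_step (p := p) (Q := Q) (v := v) (t := t) (l := l₁)
      (E := G.edgeFinset) (j := Fin.castAdd k b) (by simp [hl₁]) (by simpa [hQ] using hBG b)
      (by simpa [hQ, Finset.nonempty_iff_ne_empty] using hκ b b rfl) (by simpa [hQ, hv] using hlt)
    have hcl := mem_of_mem_foldl_step hc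
    obtain ⟨c, rfl⟩ : ∃ c', Fin.castAdd k c' = c := by simpa [hl₁] using hcl
    have hcS : Fin.castAdd k c ∈ S := by
      rw [hS', List.foldl_append]
      exact subset_foldl_step _ _ hc
    have key : ∀ i, Fin.natAdd l i ∈ S → Disjoint (B c) (A i) := fun i hi => by
      have := hdisj hcS hi (by simp [Fin.ext_iff]; omega)
      simpa [hQ] using this
    rw [hQ, Fin.append_left, Fin.append_left] at hcb
    exact hcb (Disjoint.mono_right hb (Finset.disjoint_union_right.2 ⟨key i hi, key j hj⟩))
  have hAcard : (Finset.univ.filter fun i => Fin.natAdd l i ∈ S).card ≤ 1 := by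
    refine Finset.card_le_one.2 fun i hi j hj => ?_
    simp only [Finset.mem_filter, Finset.mem_univ, true_and] at hi hj
    rcases lt_trichotomy i j with h | h | h
    · exact (hA i j h hi hj).elim
    · exact h
    · exact (hA j i h hj hi).elim
  rw [hsum]
  gcongr
  · exact_mod_cast hBcard
  · exact_mod_cast hAcard

/-- The edges traversed by the vertex sequence `f 0, …, f n`. -/
def seqEdges {V : Type*} [DecidableEq V] (f : ℕ → V) (n : ℕ) : Finset (Sym2 V) :=
  (Finset.range n).image fun m => s(f m, f (m + 1))

lemma exists_path_of_seq {V : Type*} {G : SimpleGraph V} {f : ℕ → V} {n : ℕ}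
    (hinj : Set.InjOn f (Set.Iic n)) (hadj : ∀ m < n, G.Adj (f m) (f (m + 1))) :
    ∃ W : G.Walk (f 0) (f n), W.IsPath ∧
      W.edges = (List.range n).map fun m => s(f m, f (m + 1)) := by
  suffices h : ∃ W : G.Walk (f 0) (f n), W.support = (List.range (n + 1)).map f ∧
      W.edges = (List.range n).map fun m => s(f m, f (m + 1)) by
    obtain ⟨W, hs, he⟩ := h
    refine ⟨W, (SimpleGraph.Walk.isPath_def W).2 ?_, he⟩
    rw [hs]
    refine List.Nodup.map_on (fun a ha b hb h => hinj ?_ ?_ h) List.nodup_range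
    · simpa [Nat.lt_succ_iff] using ha
    · simpa [Nat.lt_succ_iff] using hb
  clear hinj
  induction n with
  | zero => exact ⟨.nil, by simp, by simp⟩
  | succ n ih =>
    obtain ⟨W, hs, he⟩ := ih fun m hm => hadj m (by omega)
    refine ⟨W.concat (hadj n n.lt_succ_self), ?_, ?_⟩
    · rw [SimpleGraph.Walk.support_concat, hs, List.range_succ (n := n + 1)]
      simp
    · rw [SimpleGraph.Walk.edges_concat, he, List.range_succ]
      simp

lemma isPathEdges_seqEdges {V : Type*} [Fintype V] [DecidableEq V] {G : SimpleGraph V}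
    {f : ℕ → V} {n : ℕ} (hn : 0 < n) (hinj : Set.InjOn f (Set.Iic n))
    (hadj : ∀ m < n, G.Adj (f m) (f (m + 1))) : IsPathEdges G (seqEdges f n) := by
  obtain ⟨W, hW, he⟩ := exists_path_of_seq hinj hadj
  refine ⟨_, _, W, hW, ?_, ?_⟩
  · rw [he]; simp [hn.ne']
  · rw [he]; ext e; simp [seqEdges]

lemma card_seqEdges {V : Type*} [DecidableEq V] {f : ℕ → V} {n : ℕ}
    (hinj : Set.InjOn f (Set.Iic n)) : (seqEdges f n).card = n := by
  obtain ⟨W, hW, he⟩ := exists_path_of_seq (G := ⊤) hinj fun m hm h => by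
    have := hinj (Set.mem_Iic.2 hm.le) (Set.mem_Iic.2 hm) h
    omega
  have h := List.toFinset_card_of_nodup (he ▸ hW.isTrail.edges_nodup)
  rw [List.length_map, List.length_range] at h
  refine Eq.trans (congrArg _ ?_) h
  ext e
  simp [seqEdges]

/-- If a family of `d` subsets of `U` covers each element at most `r` times, then some member of
the family is priced below any `w` with `r * price p U < d * w`. -/
lemma exists_price_lt {V : Type*} [DecidableEq V] {d r : ℕ} {B : Fin d → Finset (Sym2 V)}
    {U : Finset (Sym2 V)} {p : Sym2 V → ℝ≥0∞} {w : ℝ≥0∞} (hB : ∀ x, B x ⊆ U)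
    (hr : ∀ e, (Finset.univ.filter fun x => e ∈ B x).card ≤ r) (hp : r * price p U < d * w) :
    ∃ x, price p (B x) < w := by
  by_contra! h
  refine hp.not_ge ?_
  calc (d : ℝ≥0∞) * w = ∑ _x : Fin d, w := by simp
    _ ≤ ∑ x, price p (B x) := Finset.sum_le_sum fun x _ => h x
    _ = ∑ x, ∑ e ∈ U, if e ∈ B x then p e else 0 := by
      refine Finset.sum_congr rfl fun x _ => ?_
      rw [← Finset.sum_filter, Finset.filter_mem_eq_inter, Finset.inter_eq_right.2 (hB x), price]
    _ = ∑ e ∈ U, ((Finset.univ.filter fun x => e ∈ B x).card : ℝ≥0∞) * p e := by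
      rw [Finset.sum_comm]
      refine Finset.sum_congr rfl fun e _ => ?_
      rw [← Finset.sum_filter, Finset.sum_const, nsmul_eq_mul]
    _ ≤ ∑ e ∈ U, (r : ℝ≥0∞) * p e := by
      gcongr with e
      exact_mod_cast hr e
    _ = r * price p U := by rw [price, Finset.mul_sum]

lemma price_union_le {V : Type*} [DecidableEq V] (p : Sym2 V → ℝ≥0∞) (s t : Finset (Sym2 V)) :
    price p (s ∪ t) ≤ price p s + price p t := by
  rw [price, price, price, ← Finset.sum_union_inter]
  exact le_self_add

/-- The vertices of the construction: an integer grid with columns `0, …, 3 * d` and rows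
`0, …, 9 * k * d`. -/
abbrev GridVertex (k d : ℕ) : Type := Fin (3 * d + 1) × Fin (9 * k * d + 1)

/-- The grid vertex in column `x` and row `y`. -/
def gridPt (k d x y : ℕ) : GridVertex k d := (Fin.ofNat _ x, Fin.ofNat _ y)

/-- The sequence that runs through the lines of slope `i`, one after the other. -/
def lineSeq (k d i n : ℕ) : GridVertex k d :=
  gridPt k d (n % (3 * d + 1)) (n / (3 * d + 1) + i * (n % (3 * d + 1)))

/-- The number of edges of the sequences `lineSeq`. -/
def lineLen (k d : ℕ) : ℕ := 6 * k * d * (3 * d + 1) + 3 * d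

/-- A staircase that stays at `x` for `3 * x` steps and then grows by one every other step. -/
def height (x t : ℕ) : ℕ := max x ((t + 1 - x) / 2)

/-- A sequence that moves by one column per step, with slope `i` or `i + e`. -/
def crossSeq (k d i e x t : ℕ) : GridVertex k d :=
  gridPt k d t (3 * k * d + i * t + e * height x t)

variable {k d : ℕ}

lemma gridPt_inj {x y x' y' : ℕ} (hx : x ≤ 3 * d) (hx' : x' ≤ 3 * d) (hy : y ≤ 9 * k * d)
    (hy' : y' ≤ 9 * k * d) : gridPt k d x y = gridPt k d x' y' ↔ x = x' ∧ y = y' := by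
  rw [gridPt, gridPt, Prod.mk.injEq, Fin.ext_iff, Fin.ext_iff]
  simp only [Fin.ofNat]
  rw [Nat.mod_eq_of_lt (by omega), Nat.mod_eq_of_lt (by omega), Nat.mod_eq_of_lt (by omega),
    Nat.mod_eq_of_lt (by omega)]

lemma lineSeq_bounds {i n : ℕ} (hi : i < k) (hn : n ≤ lineLen k d) :
    n % (3 * d + 1) ≤ 3 * d ∧
      n / (3 * d + 1) + i * (n % (3 * d + 1)) ≤ 9 * k * d := by
  have h1 : n % (3 * d + 1) ≤ 3 * d := Nat.lt_succ_iff.1 (Nat.mod_lt _ (by omega))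
  have h2 : n / (3 * d + 1) < 6 * k * d + 1 := by
    refine Nat.div_lt_of_lt_mul ?_
    unfold lineLen at hn
    linarith
  have h3 : i * (n % (3 * d + 1)) ≤ k * (3 * d) := Nat.mul_le_mul hi.le h1
  refine ⟨h1, ?_⟩
  linarith

lemma lineSeq_injOn {i : ℕ} (hi : i < k) :
    Set.InjOn (lineSeq k d i) (Set.Iic (lineLen k d)) := by
  intro n hn m hm h
  have bn := lineSeq_bounds hi hn
  have bm := lineSeq_bounds hi hm
  obtain ⟨h1, h2⟩ := (gridPt_inj bn.1 bm.1 bn.2 bm.2).1 h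
  rw [h1] at h2
  rw [← Nat.div_add_mod n (3 * d + 1), ← Nat.div_add_mod m (3 * d + 1), h1,
    Nat.add_right_cancel h2]

lemma succ_mod_div (n T : ℕ) :
    n % (T + 1) < T ∧ (n + 1) % (T + 1) = n % (T + 1) + 1 ∧ (n + 1) / (T + 1) = n / (T + 1) ∨
      n % (T + 1) = T ∧ (n + 1) % (T + 1) = 0 ∧ (n + 1) / (T + 1) = n / (T + 1) + 1 := by
  have h := Nat.div_add_mod n (T + 1)
  have hlt := Nat.mod_lt n (Nat.succ_pos T)
  set q := n / (T + 1)
  set r := n % (T + 1)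
  rcases Nat.lt_or_ge r T with hr | hr
  · refine Or.inl ⟨hr, ?_, ?_⟩
    · rw [← h, add_assoc, Nat.mul_add_mod, Nat.mod_eq_of_lt (by omega)]
    · rw [← h, add_assoc, Nat.mul_add_div (by omega), Nat.div_eq_of_lt (by omega), add_zero]
  · have : n + 1 = (T + 1) * (q + 1) := by rw [mul_add]; omega
    exact Or.inr ⟨by omega, by rw [this, Nat.mul_mod_right],
      by rw [this, Nat.mul_div_cancel_left _ (by omega)]⟩

/-- The sequences of different slopes are edge-disjoint. -/
lemma disjoint_seqEdges_lineSeq (hd : 0 < d) {i j : ℕ} (hi : i < k) (hj : j < k) (hij : i ≠ j) :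
    Disjoint (seqEdges (lineSeq k d i) (lineLen k d))
      (seqEdges (lineSeq k d j) (lineLen k d)) := by
  rw [Finset.disjoint_left]
  intro e he he'
  simp only [seqEdges, Finset.mem_image, Finset.mem_range] at he he'
  obtain ⟨n, hn, rfl⟩ := he
  obtain ⟨m, hm, h⟩ := he'
  have bn := lineSeq_bounds hi hn.le
  have bm := lineSeq_bounds hj hm.le
  have bn' := lineSeq_bounds hi (Nat.succ_le_of_lt hn)
  have bm' := lineSeq_bounds hj (Nat.succ_le_of_lt hm)
  have hsn := succ_mod_div n (3 * d)
  have hsm := succ_mod_div m (3 * d)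
  simp only [Nat.succ_eq_add_one] at bn' bm'
  rw [Sym2.eq_iff] at h
  simp only [lineSeq] at h
  rw [gridPt_inj bm.1 bn.1 bm.2 bn.2, gridPt_inj bm'.1 bn'.1 bm'.2 bn'.2,
    gridPt_inj bm.1 bn'.1 bm.2 bn'.2, gridPt_inj bm'.1 bn.1 bm'.2 bn.2] at h
  rcases h with ⟨⟨h1, h2⟩, h3, h4⟩ | ⟨⟨h1, h2⟩, h3, h4⟩
  · rcases hsn with ⟨a, b, c⟩ | ⟨a, b, c⟩ <;> rcases hsm with ⟨a', b', c'⟩ | ⟨a', b', c'⟩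
    · rw [b, b', c, c', h1] at h4
      rw [h1] at h2
      refine hij ?_
      linarith
    · omega
    · omega
    · rw [b, b', c, c'] at h4
      rw [a, a'] at h2
      have h5 : j * (3 * d) = i * (3 * d) := by omega
      exact hij (Nat.eq_of_mul_eq_mul_right (by omega) h5).symm
  · omega

lemma line_edge_mem {i c t : ℕ} (ht : t < 3 * d) (hc : c ≤ 6 * k * d) :
    s(gridPt k d t (c + i * t), gridPt k d (t + 1) (c + i * (t + 1))) ∈
      seqEdges (lineSeq k d i) (lineLen k d) := by
  rw [seqEdges, Finset.mem_image]
  refine ⟨(3 * d + 1) * c + t, Finset.mem_range.2 ?_, ?_⟩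
  · have := Nat.mul_le_mul_left (3 * d + 1) hc
    unfold lineLen
    linarith
  · rw [lineSeq, lineSeq, add_assoc, Nat.mul_add_mod, Nat.mul_add_mod, Nat.mul_add_div (by omega),
      Nat.mul_add_div (by omega), Nat.mod_eq_of_lt (by omega), Nat.mod_eq_of_lt (by omega),
      Nat.div_eq_of_lt (by omega), Nat.div_eq_of_lt (by omega), add_zero]

lemma height_le {x t : ℕ} (hx : x < d) (ht : t ≤ 3 * d) : height x t ≤ 3 * d := by
  unfold height; omega

lemma crossSeq_bound {i e x t : ℕ} (hie : i + e < k) (hx : x < d) (ht : t ≤ 3 * d) :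
    3 * k * d + i * t + e * height x t ≤ 9 * k * d := by
  have h1 : i * t ≤ i * (3 * d) := Nat.mul_le_mul_left _ ht
  have h2 : e * height x t ≤ e * (3 * d) := Nat.mul_le_mul_left _ (height_le hx ht)
  have h3 : (i + e) * (3 * d) ≤ k * (3 * d) := Nat.mul_le_mul_right _ hie.le
  have h4 := Nat.zero_le (k * d)
  linarith

lemma crossSeq_injOn {i e x : ℕ} (hie : i + e < k) (hx : x < d) :
    Set.InjOn (crossSeq k d i e x) (Set.Iic (3 * d)) := fun _ ht _ ht' h =>
  ((gridPt_inj ht ht' (crossSeq_bound hie hx ht) (crossSeq_bound hie hx ht')).1 h).1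

/-- A crossing sequence only uses edges of the two lines it alternates between. -/
lemma seqEdges_crossSeq_subset {i e x : ℕ} (hie : i + e < k) (hx : x < d) :
    seqEdges (crossSeq k d i e x) (3 * d) ⊆
      seqEdges (lineSeq k d i) (lineLen k d) ∪ seqEdges (lineSeq k d (i + e)) (lineLen k d) := by
  intro s hs
  simp only [seqEdges, Finset.mem_image, Finset.mem_range] at hs
  obtain ⟨t, ht, rfl⟩ := hs
  have hk : e * (3 * d) ≤ k * (3 * d) := Nat.mul_le_mul_right _ (by omega)
  have hh : e * height x t ≤ e * (3 * d) := Nat.mul_le_mul_left _ (height_le hx ht.le)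
  rcases (by unfold height; omega :
    height x (t + 1) = height x t ∨ height x (t + 1) = height x t + 1) with h | h
  · refine Finset.mem_union_left _ ?_
    have := line_edge_mem (k := k) (i := i) (c := 3 * k * d + e * height x t) ht (by linarith)
    rw [crossSeq, crossSeq, h]
    convert this using 3 <;> ring_nf
  · refine Finset.mem_union_right _ ?_
    have ht' : e * t ≤ e * (3 * d) := Nat.mul_le_mul_left _ ht.le
    have hh0 := Nat.zero_le (e * height x t)
    have het0 := Nat.zero_le (e * t)
    obtain ⟨c, hc⟩ : ∃ c, 3 * k * d + e * height x t = c + e * t :=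
      Nat.exists_eq_add_of_le' (by linarith)
    have := line_edge_mem (k := k) (i := i + e) (c := c) ht (by linarith)
    rw [crossSeq, crossSeq, h]
    convert this using 3
    · linarith
    · linarith

/-- Any two crossing sequences with the same slopes share an edge. -/
lemma not_disjoint_seqEdges_crossSeq {x x' : ℕ} (i e : ℕ) (hx : x < d) (hx' : x' < d) :
    ¬ Disjoint (seqEdges (crossSeq k d i e x) (3 * d)) (seqEdges (crossSeq k d i e x') (3 * d)) := by
  wlog h : x ≤ x' generalizing x x'
  · exact fun hd => this hx' hx (by omega) hd.symm
  have key : ∃ t < 3 * d, height x t = height x' t ∧ height x (t + 1) = height x' (t + 1) := by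
    rcases h.eq_or_lt with rfl | h
    · exact ⟨0, by omega, rfl, rfl⟩
    · exact ⟨2 * x' + x - 1, by omega, by unfold height; omega, by unfold height; omega⟩
  obtain ⟨t, ht, h1, h2⟩ := key
  refine Finset.not_disjoint_iff.2 ⟨_, Finset.mem_image_of_mem _ (Finset.mem_range.2 ht), ?_⟩
  rw [crossSeq, crossSeq, h1, h2]
  exact Finset.mem_image_of_mem _ (Finset.mem_range.2 ht)

/-- Every edge lies on at most three crossing sequences with given slopes. -/
lemma card_crossSeq_le {i e : ℕ} (he : 0 < e) (hie : i + e < k) (s : Sym2 (GridVertex k d)) :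
    (Finset.univ.filter fun x : Fin d => s ∈ seqEdges (crossSeq k d i e x) (3 * d)).card ≤ 3 := by
  rcases Finset.eq_empty_or_nonempty
    (Finset.univ.filter fun x : Fin d => s ∈ seqEdges (crossSeq k d i e x) (3 * d)) with h | ⟨y, hy⟩
  · simp [h]
  simp only [seqEdges, Finset.mem_image, Finset.mem_range, Finset.mem_filter, Finset.mem_univ,
    true_and] at hy
  obtain ⟨t, ht, rfl⟩ := hy
  rw [← Finset.card_map Fin.valEmbedding]
  refine le_trans (Finset.card_le_card (t := {height y t, t + 1 - 2 * height y t,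
    t - 2 * height y t}) ?_) Finset.card_le_three
  intro x hx
  simp only [seqEdges, Finset.mem_map, Finset.mem_image, Finset.mem_range, Finset.mem_filter,
    Finset.mem_univ, true_and] at hx
  obtain ⟨x, ⟨u, hu, h⟩, rfl⟩ := hx
  have hh : height x t = height y t := by
    have b (z : Fin d) {w : ℕ} (hw : w ≤ 3 * d) := crossSeq_bound hie z.2 hw
    rw [Sym2.eq_iff] at h
    simp only [crossSeq] at h
    rw [gridPt_inj hu.le ht.le (b x hu.le) (b y ht.le), gridPt_inj hu ht (b x hu) (b y ht),
      gridPt_inj hu.le ht (b x hu.le) (b y ht), gridPt_inj hu ht.le (b x hu) (b y ht.le)] at h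
    rcases h with ⟨⟨rfl, h⟩, -⟩ | ⟨⟨h, -⟩, h', -⟩
    · exact Nat.eq_of_mul_eq_mul_left he (Nat.add_left_cancel h)
    · omega
  simp only [Fin.valEmbedding_apply, Finset.mem_insert, Finset.mem_singleton]
  unfold height at hh ⊢
  omega

/-- The union of all the lines. -/
def lineGraph (k d : ℕ) : SimpleGraph (GridVertex k d) :=
  SimpleGraph.fromEdgeSet {s | ∃ i < k, s ∈ seqEdges (lineSeq k d i) (lineLen k d)}

lemma lineGraph_adj_of_mem {k d : ℕ} {f : ℕ → GridVertex k d} {n m : ℕ} (hm : m < n)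
    (hinj : Set.InjOn f (Set.Iic n))
    (h : ∃ i < k, s(f m, f (m + 1)) ∈ seqEdges (lineSeq k d i) (lineLen k d)) :
    (lineGraph k d).Adj (f m) (f (m + 1)) := by
  refine (SimpleGraph.fromEdgeSet_adj _).2 ⟨h, fun h => ?_⟩
  have := hinj (Set.mem_Iic.2 hm.le) (Set.mem_Iic.2 hm) h
  omega

lemma isPathEdges_lineSeq {k d i : ℕ} (hd : 0 < d) (hi : i < k) :
    IsPathEdges (lineGraph k d) (seqEdges (lineSeq k d i) (lineLen k d)) :=
  isPathEdges_seqEdges (by unfold lineLen; omega) (lineSeq_injOn hi) fun _ hm =>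
    lineGraph_adj_of_mem hm (lineSeq_injOn hi)
      ⟨i, hi, Finset.mem_image_of_mem _ (Finset.mem_range.2 hm)⟩

lemma isPathEdges_crossSeq {k d i e x : ℕ} (hie : i + e < k) (hx : x < d) :
    IsPathEdges (lineGraph k d) (seqEdges (crossSeq k d i e x) (3 * d)) := by
  refine isPathEdges_seqEdges (by omega) (crossSeq_injOn hie hx) fun m hm =>
    lineGraph_adj_of_mem hm (crossSeq_injOn hie hx) ?_
  rcases Finset.mem_union.1 (seqEdges_crossSeq_subset hie hx
    (Finset.mem_image_of_mem _ (Finset.mem_range.2 hm))) with h | h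
  · exact ⟨i, by omega, h⟩
  · exact ⟨i + e, hie, h⟩

lemma IsPathEdges.subset_edgeFinset {V : Type*} [Fintype V] [DecidableEq V] {G : SimpleGraph V}
    {s : Finset (Sym2 V)} (h : IsPathEdges G s) : s ⊆ G.edgeFinset := by
  obtain ⟨a, b, W, -, -, rfl⟩ := h
  exact fun e he => SimpleGraph.mem_edgeFinset.2 (W.edges_subset_edgeSet (List.mem_toFinset.1 he))

lemma lineLen_le_card_edgeFinset {k d : ℕ} (hd : 0 < d) (hk : 0 < k) :
    lineLen k d ≤ (lineGraph k d).edgeFinset.card := by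
  rw [← card_seqEdges (lineSeq_injOn (d := d) hk)]
  exact Finset.card_le_card (isPathEdges_lineSeq hd hk).subset_edgeFinset

lemma card_edgeFinset_lineGraph_le (k d : ℕ) :
    (lineGraph k d).edgeFinset.card ≤ k * lineLen k d := by
  calc _ ≤ ((Finset.range k).biUnion fun i =>
          seqEdges (lineSeq k d i) (lineLen k d)).card := by
        refine Finset.card_le_card fun e he => ?_
        rw [SimpleGraph.mem_edgeFinset, lineGraph, SimpleGraph.edgeSet_fromEdgeSet] at he
        simpa using he.1
    _ ≤ (Finset.range k).card * lineLen k d := Finset.card_biUnion_le_card_mul _ _ _ fun _ hi =>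
        (card_seqEdges (lineSeq_injOn (Finset.mem_range.1 hi))).le
    _ = k * lineLen k d := by rw [Finset.card_range]

lemma natCast_le_OPT_append {V : Type*} [DecidableEq V] {l k : ℕ}
    {A : Fin k → Finset (Sym2 V)} (B : Fin l → Finset (Sym2 V)) (w : ℝ≥0)
    (hA : ∀ i j, i ≠ j → Disjoint (A i) (A j)) :
    (k : ℝ≥0) ≤ OPT (Fin.append B A) (Fin.append (fun _ => w) (fun _ => 1)) := by
  have hS : Finset.univ.map (Fin.natAddEmb l) ∈
      Finset.univ.powerset.filter fun S : Finset (Fin (l + k)) =>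
        (S : Set (Fin (l + k))).Pairwise fun j k =>
          Disjoint (Fin.append B A j) (Fin.append B A k) := by
    simp only [Finset.powerset_univ, Finset.mem_filter, Finset.mem_univ, true_and]
    intro a ha b hb hab
    simp only [Finset.coe_map, Finset.coe_univ, Set.image_univ, Set.mem_range,
      Fin.natAddEmb_apply] at ha hb
    obtain ⟨i, rfl⟩ := ha
    obtain ⟨j, rfl⟩ := hb
    simpa using hA i j fun h => hab (by rw [h])
  refine le_trans (by simp) (Finset.le_sup (f := fun S : Finset (Fin (l + k)) =>
    ∑ j ∈ S, Fin.append (fun _ => w) (fun _ => (1 : ℝ≥0)) j) hS)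

/-- For every `k` there are tollbooth instances of polynomial size on which the competitive ratio
of item pricing is at least `k / 8`. -/
lemma exists_instance {k : ℕ} (hk : 0 < k) :
    ∃ (V : Type) (iV : Fintype V) (dV : DecidableEq V) (G : SimpleGraph V)
      (n : ℕ) (Q : Fin n → Finset (Sym2 V)) (v : Fin n → ℝ≥0),
      Instance G Q v ∧ k ≤ G.edgeFinset.card ∧ G.edgeFinset.card ≤ 256 * k ^ 8 ∧
        (k : ℝ≥0) ≤ OPT Q v ∧ ∀ p t, Wel G p Q v 1 t ≤ 8 := by
  set d := k ^ 2 with hd'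
  have hd : 0 < d := by positivity
  let β := {q : Fin k × Fin k // q.1 < q.2} × Fin d
  let f : Fin (Fintype.card β) ≃ β := (Fintype.equivFin β).symm
  let A (i : Fin k) := seqEdges (lineSeq k d i) (lineLen k d)
  let C (b : β) := seqEdges (crossSeq k d b.1.1.1 (b.1.1.2 - b.1.1.1) b.2) (3 * d)
  have hlt (b : β) : (b.1.1.1 : ℕ) + (b.1.1.2 - b.1.1.1) < k := by
    have := b.1.1.2.2
    have := Fin.lt_def.1 b.1.2
    omega
  have hC (b : β) : IsPathEdges (lineGraph k d) (C b) := isPathEdges_crossSeq (hlt b) b.2.2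
  have hA (i : Fin k) : IsPathEdges (lineGraph k d) (A i) := isPathEdges_lineSeq hd i.2
  set w : ℝ≥0 := 7 / d with hw
  have hdw : (d : ℝ≥0) * w = 7 := mul_div_cancel₀ _ (by positivity)
  refine ⟨GridVertex k d, inferInstance, inferInstance, lineGraph k d, Fintype.card β + k,
    Fin.append (fun b => C (f b)) A, Fin.append (fun _ => w) (fun _ => 1), ⟨by omega, ?_⟩,
    ?_, ?_, ?_, fun p t => ?_⟩
  · intro j
    induction j using Fin.addCases with
    | left b => simpa using ⟨by positivity, hC (f b)⟩
    | right i => simpa using hA i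
  · refine le_trans ?_ (lineLen_le_card_edgeFinset hd hk)
    have h2 : k ≤ d := Nat.le_self_pow (by omega) k
    exact Nat.le_add_left_of_le (by omega)
  · refine (card_edgeFinset_lineGraph_le k d).trans ?_
    have h3 : k ^ 3 ≤ k ^ 8 := Nat.pow_le_pow_right hk (by omega)
    have h4 : k ^ 4 ≤ k ^ 8 := Nat.pow_le_pow_right hk (by omega)
    have h6 : k ^ 6 ≤ k ^ 8 := Nat.pow_le_pow_right hk (by omega)
    calc k * lineLen k d = 18 * k ^ 6 + 6 * k ^ 4 + 3 * k ^ 3 := by rw [lineLen, hd']; ring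
      _ ≤ 256 * k ^ 8 := by omega
  · exact natCast_le_OPT_append _ _ fun i j hij =>
      disjoint_seqEdges_lineSeq hd i.2 j.2 (Fin.val_ne_of_ne hij)
  · refine (wel_append_le (fun b => (f b).1.1) (fun b => (hC (f b)).subset_edgeFinset) ?_ ?_
      t).trans ?_
    · intro b c hbc
      simp only [C]
      rw [hbc]
      exact not_disjoint_seqEdges_crossSeq _ _ (f b).2.2 (f c).2.2
    · intro i j hij hi hj
      have hij' := Fin.lt_def.1 hij
      have hcov (x : Fin d) : C (⟨(i, j), hij⟩, x) ⊆ A i ∪ A j := by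
        have := seqEdges_crossSeq_subset (hlt (⟨(i, j), hij⟩, x)) x.2
        simpa only [Nat.add_sub_cancel' hij'.le] using this
      obtain ⟨x, hx⟩ := exists_price_lt (B := fun x => C (⟨(i, j), hij⟩, x)) (p := p) (w := w)
        (r := 3) hcov
        (fun e => card_crossSeq_le (by simpa using hij') (hlt (⟨(i, j), hij⟩, ⟨0, hd⟩)) e)
        (by
          calc (3 : ℕ) * price p (A i ∪ A j) ≤ (3 : ℕ) * (1 + 1) := by
                gcongr
                exact (price_union_le p _ _).trans (add_le_add hi hj)
            _ < ((7 : ℝ≥0) : ℝ≥0∞) := by norm_num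
            _ = d * w := by rw [← hdw]; push_cast; rfl)
      refine ⟨f.symm (⟨(i, j), hij⟩, x), ?_, ?_⟩
      · simpa using hcov x
      · simpa using hx
    · have : (k : ℝ≥0) * k * w = 7 := by
        rw [← hdw, hd']; push_cast; ring
      rw [this]
      norm_num

end Tollbooth

/-- There is a constant `c > 0` such that for every `M` there is a
tollbooth instance on a graph with `m ≥ M` edges on which every item pricing `p` admits an
arrival order `σ` such that, for every tie-breaking choice `t`,
`Wel(p,σ,t) ≤ c · m^{-1/8} · OPT`. -/
theorem general_graph_lower_bound :
    ∃ c : ℝ, 0 < c ∧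
      ∀ M : ℕ, ∃ (V : Type) (iV : Fintype V) (dV : DecidableEq V) (G : SimpleGraph V)
        (n : ℕ) (Q : Fin n → Finset (Sym2 V)) (v : Fin n → ℝ≥0),
        Tollbooth.Instance G Q v ∧ M ≤ G.edgeFinset.card ∧
          ∀ p : Sym2 V → ℝ≥0∞, ∃ σ : Equiv.Perm (Fin n), ∀ t : Fin n → Bool,
            (Tollbooth.Wel G p Q v σ t : ℝ) ≤
              c * (G.edgeFinset.card : ℝ) ^ (-(1 : ℝ) / 8) * (Tollbooth.OPT Q v : ℝ) := by
  refine ⟨16, by norm_num, fun M => ?_⟩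
  obtain ⟨V, iV, dV, G, n, Q, v, hI, hm, hm', hopt, hwel⟩ :=
    Tollbooth.exists_instance (Nat.succ_pos M)
  refine ⟨V, iV, dV, G, n, Q, v, hI, (Nat.le_succ M).trans hm, fun p => ⟨1, fun t => ?_⟩⟩
  set k := M + 1
  have hk : (0 : ℝ) < k := by positivity
  have hm0 : (0 : ℝ) < G.edgeFinset.card := hk.trans_le (by exact_mod_cast hm)
  have hroot : (2 * k : ℝ)⁻¹ ≤ (G.edgeFinset.card : ℝ) ^ (-(1 : ℝ) / 8) := by
    calc (2 * k : ℝ)⁻¹ = (((2 * k : ℝ)) ^ (8 : ℝ)) ^ (-(1 : ℝ) / 8) := by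
          rw [← Real.rpow_mul (by positivity), ← Real.rpow_neg_one]
          norm_num
      _ ≤ (G.edgeFinset.card : ℝ) ^ (-(1 : ℝ) / 8) := by
          refine Real.rpow_le_rpow_of_nonpos hm0 ?_ (by norm_num)
          have : (G.edgeFinset.card : ℝ) ≤ 256 * k ^ 8 := by exact_mod_cast hm'
          rw [show (8 : ℝ) = (8 : ℕ) by norm_num, Real.rpow_natCast, mul_pow]
          linarith
  have hopt' : (k : ℝ) ≤ Tollbooth.OPT Q v := by exact_mod_cast hopt
  calc (Tollbooth.Wel G p Q v 1 t : ℝ) ≤ 8 := by exact_mod_cast hwel p t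
    _ = 16 * (2 * k : ℝ)⁻¹ * k := by field_simp; norm_num
    _ ≤ _ := by gcongr
end
end

section
/- Let G be a spider (a finite tree with at most one vertex of degree at least 3), and let Q_1,…,Q_n be paths in G (each identified with its nonempty set of edges) with values v_1,…,v_n ≥ 0. Then the linear program maximize Σ_{j=1}^n v_j·y_j subject to y_j ≥ 0 for all j and Σ_{j : e ∈ Q_j} y_j ≤ 1 for every edge e of G, attains its maximum at some point y* with y*_j ∈ {0, 1/2, 1} for every j. -/
open scoped Classical

noncomputable section

/-- A spider: a tree with at most one vertex of degree at least `3`. -/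
def IsSpider {V : Type*} [Fintype V] [DecidableEq V] (G : SimpleGraph V) : Prop :=
  G.IsTree ∧ {w : V | 3 ≤ G.degree w}.Subsingleton

/-- `s` is the (nonempty) edge set of a path of `G`. -/
def IsPathEdges {V : Type*} [DecidableEq V] (G : SimpleGraph V) (s : Finset (Sym2 V)) :
    Prop :=
  ∃ (a b : V) (W : G.Walk a b), W.IsPath ∧ W.edges ≠ [] ∧ s = W.edges.toFinset

/-- The odd function which is `1` on `θ + Z`, `-1` on `-θ + Z` and `0` elsewhere, for a
subgroup `Z` with `2 * θ ∉ Z`. -/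
def cosetSign (Z : AddSubgroup ℝ) (θ z : ℝ) : ℝ :=
  if z - θ ∈ Z then 1 else if z + θ ∈ Z then -1 else 0

lemma cosetSign_eq_neg {Z : AddSubgroup ℝ} {θ z w : ℝ} (hθ : 2 * θ ∉ Z) (h : z + w ∈ Z) :
    cosetSign Z θ z = -cosetSign Z θ w := by
  have h1 : z - θ ∈ Z ↔ w + θ ∈ Z := by
    rw [← Z.neg_mem_iff (x := z - θ), ← Z.add_mem_cancel_left h]
    ring_nf
  have h2 : w - θ ∈ Z ↔ z + θ ∈ Z := by
    rw [← Z.neg_mem_iff (x := w - θ), ← Z.add_mem_cancel_left h]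
    ring_nf
  have h3 : ¬ (w - θ ∈ Z ∧ w + θ ∈ Z) := fun ⟨a, b⟩ => hθ (by
    have := Z.sub_mem b a
    ring_nf at this ⊢
    exact this)
  unfold cosetSign
  rw [h1, ← h2]
  split_ifs <;> simp_all

lemma cosetSign_eq_zero {Z : AddSubgroup ℝ} {θ z : ℝ} (hθ : 2 * θ ∉ Z) (h : z ∈ Z) :
    cosetSign Z θ z = 0 := by
  have h1 := cosetSign_eq_neg hθ (Z.add_mem h h)
  linarith

lemma cosetSign_self {Z : AddSubgroup ℝ} {θ : ℝ} : cosetSign Z θ θ = 1 := by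
  simp [cosetSign]

/-- A linear system whose matrix has entries in `{-1, 0, 1}` and at most two nonzero entries in
each column: a solution modulo `Z` with an entry outside `Z / 2` can be moved along a nonzero
kernel vector supported on the entries outside `Z`. -/
theorem exists_ker_of_two_mul_notMem {I J : Type*} [Fintype I] [Fintype J]
    (B : J → I → ℝ) (hB : ∀ r i, B r i = 0 ∨ B r i = 1 ∨ B r i = -1)
    (hcol : ∀ i, (Finset.univ.filter fun r => B r i ≠ 0).card ≤ 2)
    (Z : AddSubgroup ℝ) (x : I → ℝ) (hx : ∀ r, ∑ i, B r i * x i ∈ Z)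
    (i₀ : I) (hi₀ : 2 * x i₀ ∉ Z) :
    ∃ d : I → ℝ, d ≠ 0 ∧ (∀ r, ∑ i, B r i * d i = 0) ∧ ∀ i, x i ∈ Z → d i = 0 := by
  set F : Finset I := Finset.univ.filter fun i => x i ∉ Z with hF
  set R : Finset J := Finset.univ.filter fun r => ∃ i ∈ F, B r i ≠ 0 with hR
  have hsmul : ∀ r i, x i ∈ Z → B r i * x i ∈ Z := by
    intro r i h
    rcases hB r i with h' | h' | h' <;> simp [h', h, Z.zero_mem]
  have hrow : ∀ r, ∑ i ∈ F.filter (fun i => B r i ≠ 0), B r i * x i ∈ Z := by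
    intro r
    have h1 := hx r
    rw [← Finset.sum_filter_add_sum_filter_not Finset.univ (fun i => x i ∉ Z ∧ B r i ≠ 0)] at h1
    rw [hF, Finset.filter_filter]
    refine (Z.add_mem_cancel_right (Z.sum_mem fun i hi => ?_)).1 h1
    by_cases hxi : x i ∈ Z
    · exact hsmul r i hxi
    · have : B r i = 0 := by simpa [hxi] using hi
      simp [this, Z.zero_mem]
  have hzero : ∀ d : I → ℝ, (∀ i, x i ∈ Z → d i = 0) → ∀ r,
      ∑ i, B r i * d i = ∑ i ∈ F.filter (fun i => B r i ≠ 0), B r i * d i := by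
    intro d hd r
    symm
    apply Finset.sum_subset (Finset.subset_univ _)
    intro i _ hi
    by_cases hxi : x i ∈ Z
    · simp [hd i hxi]
    · have : B r i = 0 := by simpa [hF, hxi] using hi
      simp [this]
  have htwo : ∀ r ∈ R, 2 ≤ (F.filter fun i => B r i ≠ 0).card := by
    intro r hr
    by_contra hlt
    obtain ⟨i, hi, hri⟩ := (Finset.mem_filter.1 hr).2
    have hmem : i ∈ F.filter fun i => B r i ≠ 0 := Finset.mem_filter.2 ⟨hi, hri⟩
    have hpos := Finset.card_pos.2 ⟨i, hmem⟩
    obtain ⟨k, hk⟩ := Finset.card_eq_one.1 (show (F.filter fun i => B r i ≠ 0).card = 1 by omega)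
    rw [hk, Finset.mem_singleton] at hmem
    have := hrow r
    rw [hk, Finset.sum_singleton, ← hmem] at this
    refine (Finset.mem_filter.1 hi).2 ?_
    rcases hB r i with h' | h' | h' <;> simp_all
  have hcount : ∑ r ∈ R, (F.filter fun i => B r i ≠ 0).card ≤ 2 * F.card := by
    have := Finset.sum_card_bipartiteAbove_eq_sum_card_bipartiteBelow (s := R) (t := F)
      (fun r i => B r i ≠ 0)
    simp only [Finset.bipartiteAbove, Finset.bipartiteBelow] at this
    rw [this, mul_comm, ← smul_eq_mul]
    refine Finset.sum_le_card_nsmul _ _ _ fun i _ => le_trans (Finset.card_le_card ?_) (hcol i)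
    exact Finset.filter_subset_filter _ (Finset.subset_univ _)
  by_cases hcard : R.card < F.card
  · let L : (F → ℝ) →ₗ[ℝ] (R → ℝ) := (Matrix.of fun (r : R) (i : F) => B r i).mulVecLin
    have hL : LinearMap.ker L ≠ ⊥ := LinearMap.ker_ne_bot_of_finrank_lt (by simpa using hcard)
    obtain ⟨e, he, he0⟩ := (Submodule.ne_bot_iff _).1 hL
    have hd : ∀ i, x i ∈ Z → (fun i => if h : i ∈ F then e ⟨i, h⟩ else 0) i = 0 := by
      intro i hi
      simp [hF, hi]
    refine ⟨fun i => if h : i ∈ F then e ⟨i, h⟩ else 0, ?_, ?_, hd⟩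
    · intro h
      refine he0 (funext fun i => ?_)
      simpa using congrFun h i.1
    · intro r
      by_cases hr : r ∈ R
      · have h1 : ∑ i : F, B r i * e i = 0 := by
          simpa [L, Matrix.mulVec, dotProduct] using congrFun (LinearMap.mem_ker.1 he) ⟨r, hr⟩
        refine Eq.trans ?_ h1
        rw [← Finset.sum_subset (Finset.subset_univ F), ← Finset.sum_coe_sort]
        · simp
        · intro i _ hi
          simp only [dif_neg hi, mul_zero]
      · rw [hzero _ hd]
        refine Finset.sum_eq_zero fun i hi => ?_
        exact absurd (Finset.mem_filter.2 ⟨Finset.mem_univ r, i, Finset.mem_filter.1 hi⟩) hr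
  · have hexact : ∀ r ∈ R, (F.filter fun i => B r i ≠ 0).card = 2 := by
      have h1 : ∑ r ∈ R, 2 = ∑ r ∈ R, (F.filter fun i => B r i ≠ 0).card := by
        refine le_antisymm (Finset.sum_le_sum htwo) ?_
        simp only [Finset.sum_const, smul_eq_mul]
        omega
      exact fun r hr => ((Finset.sum_eq_sum_iff_of_le htwo).1 h1 r hr).symm
    have hd : ∀ i, x i ∈ Z → cosetSign Z (x i₀) (x i) = 0 := fun i => cosetSign_eq_zero hi₀
    refine ⟨fun i => cosetSign Z (x i₀) (x i), ?_, ?_, hd⟩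
    · intro h
      have := congrFun h i₀
      simp [cosetSign_self] at this
    · intro r
      rw [hzero _ hd]
      by_cases hr : r ∈ R
      · obtain ⟨j, k, hjk, hT⟩ := Finset.card_eq_two.1 (hexact r hr)
        have hsum := hrow r
        have hj : B r j ≠ 0 := (Finset.mem_filter.1 (show j ∈ F.filter (fun i => B r i ≠ 0) by simp [hT])).2
        have hk : B r k ≠ 0 := (Finset.mem_filter.1
          (show k ∈ F.filter (fun i => B r i ≠ 0) by simp [hT])).2
        have hodd : ∀ i, B r i ≠ 0 →
            B r i * cosetSign Z (x i₀) (x i) = cosetSign Z (x i₀) (B r i * x i) := by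
          intro i hi
          rcases hB r i with h' | h' | h'
          · exact absurd h' hi
          · simp [h']
          · rw [h', cosetSign_eq_neg (z := -1 * x i) (w := x i) hi₀ (by simp [Z.zero_mem]),
              neg_one_mul]
        rw [hT, Finset.sum_pair hjk] at hsum ⊢
        rw [hodd j hj, hodd k hk, cosetSign_eq_neg hi₀ hsum, neg_add_cancel]
      · refine Finset.sum_eq_zero fun i hi => ?_
        exact absurd (Finset.mem_filter.2 ⟨Finset.mem_univ r, i, Finset.mem_filter.1 hi⟩) hr

lemma SimpleGraph.Walk.IsPath.exists_ne_mem_edges {V : Type*} {G : SimpleGraph V} {a b u w : V}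
    {W : G.Walk a b} (hW : W.IsPath) (ha : u ≠ a) (hb : u ≠ b) (h : s(u, w) ∈ W.edges) :
    ∃ w' ≠ w, s(u, w') ∈ W.edges := by
  obtain ⟨i, rfl, hi⟩ := SimpleGraph.Walk.mem_support_iff_exists_getVert.1
    (W.fst_mem_support_of_mem_edges h)
  have h0 : i ≠ 0 := by
    rintro rfl
    simp at ha
  have hl : i < W.length := by
    refine lt_of_le_of_ne hi ?_
    rintro rfl
    simp at hb
  obtain ⟨w', hw', hne⟩ := Set.exists_ne_of_one_lt_ncard
    (hW.ncard_neighborSet_toSubgraph_internal_eq_two h0 hl ▸ one_lt_two) w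
  refine ⟨w', hne, ?_⟩
  rwa [SimpleGraph.Subgraph.mem_neighborSet, ← SimpleGraph.Subgraph.mem_edgeSet,
    SimpleGraph.Walk.mem_edges_toSubgraph] at hw'

lemma SimpleGraph.IsTree.eq_of_adj_of_dist_lt {V : Type*} {G : SimpleGraph V} (hG : G.IsTree)
    {c u w w' : V} (hw : G.Adj u w) (hw' : G.Adj u w') (hd : G.dist c w < G.dist c u)
    (hd' : G.dist c w' < G.dist c u) : w = w' := by
  obtain ⟨p, hp, hpl⟩ := hG.connected.exists_path_of_dist c u
  have key : ∀ {z}, G.Adj u z → G.dist c z < G.dist c u → z = p.penultimate := by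
    intro z hz hzd
    refine hG.isAcyclic.eq_penultimate_of_adj_end hp hz ?_
    by_contra hzp
    obtain ⟨q, hq, hql⟩ := hG.connected.exists_path_of_dist c z
    have hu : u ∈ q.support := by
      by_contra hu
      exact hzp (hG.isAcyclic.mem_support_of_ne_mem_support_of_adj_of_isPath hp hq hz hu)
    have := SimpleGraph.dist_le (q.takeUntil u hu)
    have := q.length_takeUntil_le_length hu
    omega
  rw [key hw hd, key hw' hd']

lemma SimpleGraph.Connected.exists_adj_dist_lt {V : Type*} {G : SimpleGraph V}
    (hG : G.Connected) {c u : V} (hu : u ≠ c) : ∃ w, G.Adj u w ∧ G.dist c w < G.dist c u := by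
  obtain ⟨p, hp⟩ := hG.exists_walk_length_eq_dist u c
  cases p with
  | nil => exact absurd rfl hu
  | cons h q =>
    refine ⟨_, h, ?_⟩
    have := SimpleGraph.dist_le q
    rw [SimpleGraph.dist_comm, SimpleGraph.dist_comm (u := c), ← hp, SimpleGraph.Walk.length_cons]
    omega

/-- In a spider with centre `c`, every `u ≠ c` has a parent `p u` and at most one child `q u`;
`q u = u` records that there is no child. -/
lemma IsSpider.exists_parent_child {V : Type*} [Fintype V] [DecidableEq V] {G : SimpleGraph V}
    (hG : IsSpider G) : ∃ (c : V) (p q : V → V), ∀ u, u ≠ c →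
      (G.Adj u (p u) ∧ G.dist c (p u) < G.dist c u) ∧
      (∀ w, G.Adj u w → w = p u ∨ w = q u) ∧
      (q u = u ∨ (q u ≠ p u ∧ G.Adj u (q u) ∧ G.dist c u < G.dist c (q u))) := by
  obtain ⟨hT, hdeg⟩ := hG
  obtain ⟨c, hc⟩ : ∃ c, ∀ u, u ≠ c → G.degree u ≤ 2 := by
    by_cases h : ∃ c, 3 ≤ G.degree c
    · obtain ⟨c, hc⟩ := h
      refine ⟨c, fun u hu => ?_⟩
      by_contra hlt
      exact hu (hdeg (show 3 ≤ G.degree u by omega) hc)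
    · obtain ⟨c⟩ := hT.connected.nonempty
      exact ⟨c, fun u _ => by
        by_contra hlt
        exact h ⟨u, by omega⟩⟩
  have key : ∀ u, ∃ p q : V, u ≠ c →
      (G.Adj u p ∧ G.dist c p < G.dist c u) ∧ (∀ w, G.Adj u w → w = p ∨ w = q) ∧
      (q = u ∨ (q ≠ p ∧ G.Adj u q ∧ G.dist c u < G.dist c q)) := by
    intro u
    by_cases hu : u = c
    · exact ⟨u, u, fun h => absurd hu h⟩
    obtain ⟨p, hp, hpd⟩ := hT.connected.exists_adj_dist_lt hu
    by_cases hq : ∃ q, q ≠ p ∧ G.Adj u q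
    · obtain ⟨q, hqp, hq⟩ := hq
      refine ⟨p, q, fun _ => ⟨⟨hp, hpd⟩, fun w hw => ?_, Or.inr ⟨hqp, hq, ?_⟩⟩⟩
      · by_contra! hne
        have h3 : ({p, q, w} : Finset V).card ≤ G.degree u := by
          rw [← SimpleGraph.card_neighborFinset_eq_degree]
          refine Finset.card_le_card fun z hz => ?_
          rw [SimpleGraph.mem_neighborFinset]
          simp only [Finset.mem_insert, Finset.mem_singleton] at hz
          rcases hz with rfl | rfl | rfl <;> assumption
        rw [Finset.card_eq_three.2 ⟨p, q, w, hqp.symm, hne.1.symm, hne.2.symm, rfl⟩] at h3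
        have := hc u hu
        omega
      · refine lt_of_le_of_ne (not_lt.1 fun hlt => ?_) (hT.dist_ne_of_adj c hq)
        exact hqp (hT.eq_of_adj_of_dist_lt hq hp hlt hpd)
    · push Not at hq
      exact ⟨p, u, fun _ => ⟨⟨hp, hpd⟩, fun w hw => Or.inl (by
        by_contra hne
        exact hq w hne hw), Or.inl rfl⟩⟩
  choose p q h using key
  exact ⟨c, p, q, h⟩

/-- A weight on the edges of a spider which is balanced at every vertex `u ≠ c` vanishes. -/
lemma eq_zero_of_parent_eq_child {V : Type*} [Fintype V] {G : SimpleGraph V} (hG : G.IsTree)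
    {c : V} {p q : V → V} (h : ∀ u, u ≠ c →
      (G.Adj u (p u) ∧ G.dist c (p u) < G.dist c u) ∧
      (∀ w, G.Adj u w → w = p u ∨ w = q u) ∧
      (q u = u ∨ (q u ≠ p u ∧ G.Adj u (q u) ∧ G.dist c u < G.dist c (q u))))
    {g : Sym2 V → ℝ} (hdiag : ∀ u, g s(u, u) = 0)
    (hg : ∀ u, u ≠ c → g s(u, p u) = g s(u, q u)) {e : Sym2 V} (he : e ∈ G.edgeSet) :
    g e = 0 := by
  have hparent : ∀ u w, G.Adj u w → G.dist c w < G.dist c u → u ≠ c ∧ w = p u := by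
    intro u w huw hd
    have hu : u ≠ c := by
      rintro rfl
      simp at hd
    exact ⟨hu, hG.eq_of_adj_of_dist_lt huw (h u hu).1.1 hd (h u hu).1.2⟩
  obtain ⟨N, hN⟩ : ∃ N, ∀ u, G.dist c u ≤ N := by
    obtain ⟨N, hN⟩ := (Set.finite_range (G.dist c)).bddAbove
    exact ⟨N, fun u => hN ⟨u, rfl⟩⟩
  have hzero : ∀ k u, u ≠ c → N - G.dist c u = k → g s(u, p u) = 0 := by
    intro k
    induction k using Nat.strong_induction_on with
    | _ k ih =>
      intro u hu hk
      rw [hg u hu]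
      rcases (h u hu).2.2 with hq | ⟨-, hadj, hd⟩
      · rw [hq, hdiag]
      · obtain ⟨hqc, hpq⟩ := hparent _ _ hadj.symm hd
        have := ih (N - G.dist c (q u)) (by have := hN (q u); omega) _ hqc rfl
        rwa [← hpq, Sym2.eq_swap] at this
  induction e using Sym2.ind with
  | _ a b =>
    rw [SimpleGraph.mem_edgeSet] at he
    rcases lt_or_gt_of_ne (hG.dist_ne_of_adj c he) with hd | hd
    · obtain ⟨hb, hab⟩ := hparent _ _ he.symm hd
      rw [Sym2.eq_swap, hab]
      exact hzero _ _ hb rfl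
    · obtain ⟨ha, hba⟩ := hparent _ _ he hd
      rw [hba]
      exact hzero _ _ ha rfl

lemma IsPathEdges.nonempty {V : Type*} [DecidableEq V] {G : SimpleGraph V} {s : Finset (Sym2 V)}
    (hs : IsPathEdges G s) : s.Nonempty := by
  obtain ⟨a, b, W, -, hne, rfl⟩ := hs
  exact List.toFinset_nonempty_iff _ |>.2 hne

lemma IsPathEdges.subset_edgeSet {V : Type*} [DecidableEq V] {G : SimpleGraph V}
    {s : Finset (Sym2 V)} (hs : IsPathEdges G s) {e : Sym2 V} (he : e ∈ s) : e ∈ G.edgeSet := by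
  obtain ⟨a, b, W, -, -, rfl⟩ := hs
  exact W.edges_subset_edgeSet (List.mem_toFinset.1 he)

/-- A path uses the parent edge and the child edge of a vertex simultaneously, except at its two
endpoints. -/
lemma IsPathEdges.exists_forall_parent_mem_iff {V : Type*} [DecidableEq V] {G : SimpleGraph V}
    {s : Finset (Sym2 V)} (hs : IsPathEdges G s) {c : V} {p q : V → V}
    (h : ∀ u, u ≠ c → ∀ w, G.Adj u w → w = p u ∨ w = q u) :
    ∃ a b, ∀ u, u ≠ c → u ≠ a → u ≠ b → (s(u, p u) ∈ s ↔ s(u, q u) ∈ s) := by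
  obtain ⟨a, b, W, hW, -, rfl⟩ := hs
  refine ⟨a, b, fun u hu ha hb => ?_⟩
  simp only [List.mem_toFinset]
  constructor <;> intro hm <;> obtain ⟨w, hw, hwm⟩ := hW.exists_ne_mem_edges ha hb hm <;>
    rcases h u hu w (W.edges_subset_edgeSet hwm) with rfl | rfl <;> first | assumption | simp at hw

lemma eventually_nonneg_add_sub {a d : ℝ} (ha : 0 ≤ a) (h : d ≠ 0 → 0 < a) :
    ∀ᶠ t : ℝ in nhdsWithin 0 (Set.Ioi 0), 0 ≤ a + t * d ∧ 0 ≤ a - t * d := by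
  by_cases hd : d = 0
  · simp [hd, ha]
  · have h1 : Filter.Tendsto (fun t : ℝ => a + t * d) (nhds 0) (nhds a) := by
      have : Continuous fun t : ℝ => a + t * d := by fun_prop
      simpa using this.tendsto 0
    have h2 : Filter.Tendsto (fun t : ℝ => a - t * d) (nhds 0) (nhds a) := by
      have : Continuous fun t : ℝ => a - t * d := by fun_prop
      simpa using this.tendsto 0
    filter_upwards [nhdsWithin_le_nhds (h1.eventually (lt_mem_nhds (h hd))),
      nhdsWithin_le_nhds (h2.eventually (lt_mem_nhds (h hd)))] with t ht1 ht2
    exact ⟨ht1.le, ht2.le⟩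

/-- The feasible region of the packing linear program. -/
def packingPolytope {V : Type*} [DecidableEq V] (G : SimpleGraph V) {n : ℕ}
    (Q : Fin n → Finset (Sym2 V)) : Set (Fin n → ℝ) :=
  {y | (∀ j, 0 ≤ y j) ∧
    ∀ e ∈ G.edgeSet, ∑ j ∈ Finset.univ.filter (fun j => e ∈ Q j), y j ≤ 1}

lemma le_one_of_mem_packingPolytope {V : Type*} [DecidableEq V] {G : SimpleGraph V} {n : ℕ}
    {Q : Fin n → Finset (Sym2 V)} (hQ : ∀ j, IsPathEdges G (Q j)) {y : Fin n → ℝ}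
    (hy : y ∈ packingPolytope G Q) (j : Fin n) : y j ≤ 1 := by
  obtain ⟨e, he⟩ := (hQ j).nonempty
  refine le_trans ?_ (hy.2 e ((hQ j).subset_edgeSet he))
  exact Finset.single_le_sum (f := y) (fun i _ => hy.1 i) (by simp [he])

lemma isCompact_packingPolytope {V : Type*} [DecidableEq V] {G : SimpleGraph V} {n : ℕ}
    {Q : Fin n → Finset (Sym2 V)} (hQ : ∀ j, IsPathEdges G (Q j)) :
    IsCompact (packingPolytope G Q) := by
  refine (isCompact_Icc (a := (0 : Fin n → ℝ)) (b := 1)).of_isClosed_subset ?_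
    fun y hy => ⟨hy.1, le_one_of_mem_packingPolytope hQ hy⟩
  simp only [packingPolytope, Set.ofPred_and, Set.ofPred_forall]
  refine IsClosed.inter (isClosed_iInter fun j => ?_)
    (isClosed_iInter fun e => isClosed_iInter fun _ => ?_)
  · exact isClosed_le continuous_const (continuous_apply j)
  · exact isClosed_le (by fun_prop) continuous_const

/-- A feasible point which is not half-integral is the midpoint of a feasible segment. -/
lemma exists_add_sub_mem_packingPolytope {V : Type*} [Fintype V] [DecidableEq V]
    {G : SimpleGraph V} (hG : IsSpider G) {n : ℕ} {Q : Fin n → Finset (Sym2 V)}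
    (hQ : ∀ j, IsPathEdges G (Q j)) {y : Fin n → ℝ} (hy : y ∈ packingPolytope G Q)
    {j₀ : Fin n} (hj₀ : 2 * y j₀ ∉ (Int.castAddHom ℝ).range) :
    ∃ d : Fin n → ℝ, d ≠ 0 ∧ y + d ∈ packingPolytope G Q ∧ y - d ∈ packingPolytope G Q := by
  obtain ⟨c, p, q, hpq⟩ := hG.exists_parent_child
  let load : (Fin n → ℝ) → Sym2 V → ℝ :=
    fun z e => ∑ j ∈ Finset.univ.filter (fun j => e ∈ Q j), z j
  let A : Sym2 V → Fin n ⊕ Sym2 V → ℝ := fun e => Sum.elim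
    (fun j => if e ∈ Q j then 1 else 0) (fun e' => if e = e' then -1 else 0)
  have hA : ∀ (e : Sym2 V) (z : Fin n ⊕ Sym2 V → ℝ), ∑ i, A e i * z i = load (fun j => z (.inl j)) e - z (.inr e) := by
    intro e z
    simp [A, load, Fintype.sum_sum_type, Finset.sum_filter, sub_eq_add_neg]
  let B : V → Fin n ⊕ Sym2 V → ℝ :=
    fun u i => if u = c then 0 else A s(u, p u) i - A s(u, q u) i
  have hBsum : ∀ u, u ≠ c → ∀ z : Fin n ⊕ Sym2 V → ℝ,
      ∑ i, B u i * z i = ∑ i, A s(u, p u) i * z i - ∑ i, A s(u, q u) i * z i := by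
    intro u hu z
    simp [B, hu, sub_mul]
  have hentry : ∀ r i, B r i = 0 ∨ B r i = 1 ∨ B r i = -1 := by
    rintro r (j | e) <;> simp only [B, A, Sum.elim_inl, Sum.elim_inr] <;> split_ifs <;> norm_num
  have hcol : ∀ i, (Finset.univ.filter fun r => B r i ≠ 0).card ≤ 2 := by
    intro i
    obtain ⟨a, b, hab⟩ : ∃ a b, ∀ u, u ≠ a → u ≠ b → B u i = 0 := by
      rcases i with j | e
      · obtain ⟨a, b, hab⟩ := (hQ j).exists_forall_parent_mem_iff fun u hu => (hpq u hu).2.1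
        refine ⟨a, b, fun u ha hb => ?_⟩
        by_cases hu : u = c
        · simp [B, hu]
        · simp [B, A, hu, hab u hu ha hb]
      · induction e using Sym2.ind with
        | _ a b =>
          refine ⟨a, b, fun u ha hb => ?_⟩
          simp [B, A, ha, hb]
    refine (Finset.card_le_card (t := {a, b}) fun u hu => ?_).trans Finset.card_le_two
    by_contra hne
    simp only [Finset.mem_insert, Finset.mem_singleton, not_or] at hne
    exact (Finset.mem_filter.1 hu).2 (hab u hne.1 hne.2)
  have hload0 : ∀ z e, e ∉ G.edgeSet → load z e = 0 := by
    intro z e he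
    refine Finset.sum_eq_zero fun j hj => absurd ?_ he
    exact (hQ j).subset_edgeSet (Finset.mem_filter.1 hj).2
  obtain ⟨d, hd0, hBd, hdZ⟩ := exists_ker_of_two_mul_notMem B hentry hcol
    (Int.castAddHom ℝ).range (Sum.elim y (load y)) (fun u => by
      by_cases hu : u = c
      · simp only [B, if_pos hu, zero_mul, Finset.sum_const_zero]
        exact zero_mem _
      · rw [hBsum u hu, hA, hA]
        simp) (.inl j₀) hj₀
  have hd_off : ∀ e, e ∉ G.edgeSet → d (.inr e) = 0 := by
    intro e he
    refine hdZ _ ?_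
    rw [Sum.elim_inr, hload0 _ _ he]
    exact zero_mem _
  have hd_load : ∀ e, load (fun j => d (.inl j)) e = d (.inr e) := by
    intro e
    by_cases he : e ∈ G.edgeSet
    · rw [← sub_eq_zero, ← hA]
      refine eq_zero_of_parent_eq_child hG.1 hpq (g := fun e => ∑ i, A e i * d i) ?_ ?_ he
      · intro u
        simp only [hA]
        rw [hload0 _ _ (by simp), hd_off _ (by simp), sub_zero]
      · intro u hu
        rw [← sub_eq_zero, ← hBsum u hu, hBd]
    · rw [hload0 _ _ he, hd_off _ he]
  have hsmall : ∀ᶠ t : ℝ in nhdsWithin 0 (Set.Ioi 0),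
      (∀ j, 0 ≤ y j + t * d (.inl j) ∧ 0 ≤ y j - t * d (.inl j)) ∧
      ∀ e : Sym2 V, e ∈ G.edgeSet →
        0 ≤ (1 - load y e) + t * d (.inr e) ∧ 0 ≤ (1 - load y e) - t * d (.inr e) := by
    refine (Filter.eventually_all.2 fun j => ?_).and (Filter.eventually_all.2 fun e => ?_)
    · refine eventually_nonneg_add_sub (hy.1 j) fun hne => lt_of_le_of_ne (hy.1 j) fun h => ?_
      refine hne (hdZ _ ?_)
      rw [Sum.elim_inl, ← h]
      exact zero_mem _
    · by_cases he : e ∈ G.edgeSet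
      · have hle : 0 ≤ 1 - load y e := sub_nonneg.2 (hy.2 e he)
        have hev := eventually_nonneg_add_sub (d := d (.inr e)) hle fun hne =>
          lt_of_le_of_ne hle fun h => hne (hdZ _ ⟨1, by
            simp only [Int.coe_castAddHom, Int.cast_one, Sum.elim_inr]
            linarith⟩)
        filter_upwards [hev] with t ht _
        exact ht
      · exact Filter.Eventually.of_forall fun t h => absurd h he
  obtain ⟨t, ⟨hty, hte⟩, ht⟩ := (hsmall.and self_mem_nhdsWithin).exists
  have ht0 : t ≠ 0 := (Set.mem_Ioi.1 ht).ne'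
  have htd : ∀ e, ∑ j ∈ Finset.univ.filter (fun j => e ∈ Q j), t * d (.inl j) =
      t * d (.inr e) := by
    intro e
    rw [← Finset.mul_sum, ← hd_load]
  refine ⟨fun j => t * d (.inl j), ?_, ⟨fun j => (hty j).1, fun e he => ?_⟩,
    ⟨fun j => (hty j).2, fun e he => ?_⟩⟩
  · intro h
    have hl : ∀ j, d (.inl j) = 0 := fun j => by simpa [ht0] using congrFun h j
    refine hd0 (funext fun i => ?_)
    rcases i with j | e
    · exact hl j
    · rw [← hd_load]
      simp [load, hl]
  · simp only [Pi.add_apply, Finset.sum_add_distrib, htd]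
    have := (hte e he).2
    simp only [load] at this
    linarith
  · simp only [Pi.sub_apply, Finset.sum_sub_distrib, htd]
    have := (hte e he).1
    simp only [load] at this
    linarith

/-- If `G` is a spider and `Q_1, …, Q_n` are paths in `G` with nonnegative
values `v_1, …, v_n`, then the LP maximizing `∑ v_j y_j` subject to `y_j ≥ 0` and
`∑_{j : e ∈ Q_j} y_j ≤ 1` for every edge `e` attains its maximum at a half-integral point. -/
theorem spider_LP_halfIntegral_optimum
    {V : Type*} [Fintype V] [DecidableEq V] (G : SimpleGraph V) (hG : IsSpider G)
    {n : ℕ} (Q : Fin n → Finset (Sym2 V)) (hQ : ∀ j, IsPathEdges G (Q j))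
    (v : Fin n → ℝ) (hv : ∀ j, 0 ≤ v j) :
    ∃ y : Fin n → ℝ,
      ((∀ j, 0 ≤ y j) ∧
        ∀ e ∈ G.edgeSet, ∑ j ∈ Finset.univ.filter (fun j => e ∈ Q j), y j ≤ 1) ∧
      (∀ z : Fin n → ℝ,
        ((∀ j, 0 ≤ z j) ∧
          ∀ e ∈ G.edgeSet, ∑ j ∈ Finset.univ.filter (fun j => e ∈ Q j), z j ≤ 1) →
        ∑ j, v j * z j ≤ ∑ j, v j * y j) ∧
      ∀ j, y j ∈ ({0, 1 / 2, 1} : Set ℝ) := by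
  have hcont : Continuous fun y : Fin n → ℝ => ∑ j, v j * y j := by fun_prop
  have hP : IsCompact (packingPolytope G Q) := isCompact_packingPolytope hQ
  obtain ⟨y₀, hy₀, hmax₀⟩ := hP.exists_isMaxOn ⟨0, by simp [packingPolytope]⟩ hcont.continuousOn
  have hK : IsCompact (packingPolytope G Q ∩ {y | ∑ j, v j * y₀ j ≤ ∑ j, v j * y j}) :=
    hP.inter_right (isClosed_le continuous_const hcont)
  obtain ⟨y, ⟨hy, hyv⟩, hext⟩ := hK.extremePoints_nonempty ⟨y₀, hy₀, le_refl (∑ j, v j * y₀ j)⟩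
  have hmax : ∀ z ∈ packingPolytope G Q, ∑ j, v j * z j ≤ ∑ j, v j * y j :=
    fun z hz => (hmax₀ hz).trans hyv
  have hhalf : ∀ j, 2 * y j ∈ (Int.castAddHom ℝ).range := by
    by_contra! hne
    obtain ⟨j, hj⟩ := hne
    obtain ⟨d, hd, hadd, hsub⟩ := exists_add_sub_mem_packingPolytope hG hQ hy hj
    have h1 := hmax _ hadd
    have h2 := hmax _ hsub
    simp only [Pi.add_apply, Pi.sub_apply, mul_add, mul_sub, Finset.sum_add_distrib,
      Finset.sum_sub_distrib] at h1 h2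
    simp only [Set.mem_ofPred_eq] at hyv
    refine hd (add_eq_left.1 (hext (x₁ := y + d) ⟨hadd, ?_⟩ (x₂ := y - d) ⟨hsub, ?_⟩ ?_))
    · simp only [Set.mem_ofPred_eq, Pi.add_apply, mul_add, Finset.sum_add_distrib]
      linarith
    · simp only [Set.mem_ofPred_eq, Pi.sub_apply, mul_sub, Finset.sum_sub_distrib]
      linarith
    · refine ⟨1 / 2, 1 / 2, by norm_num, by norm_num, by norm_num, ?_⟩
      module
  refine ⟨y, hy, hmax, fun j => ?_⟩
  obtain ⟨k, hk⟩ := hhalf j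
  rw [Int.coe_castAddHom] at hk
  have h0 := hy.1 j
  have h1 := le_one_of_mem_packingPolytope hQ hy j
  have hk0 : 0 ≤ k := by
    have : (0 : ℝ) ≤ k := by linarith
    exact_mod_cast this
  have hk2 : k ≤ 2 := by
    have : (k : ℝ) ≤ 2 := by linarith
    exact_mod_cast this
  simp only [Set.mem_insert_iff, Set.mem_singleton_iff]
  interval_cases k
  · left
    push_cast at hk
    linarith
  · right; left
    push_cast at hk
    linarith
  · right; right
    push_cast at hk
    linarith
end
end
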